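/- There exist constants κ > 0, C ≥ 1, c > 0 and N₀ (depending only on h and the choice of the roots z_p) such that the following holds. Let N ≥ N₀ be an integer, let d ≤ N^ρ be a positive integer, let A ⊆ {1,…,N} be h_d-free with density σ = |A|/N > (log N)^{−log log log N}, and let ν ≥ N^{−1/2}. Then at least one of the following holds: (i) there exist a positive integer N* ≥ c·ν·σ^C·N, an integer q with 1 ≤ q ≤ C·σ^{−C}, and an h_{qd}-free subset A* ⊆ {1,…,N*} with density σ* = |A*|/N* ≥ (1 + ν/73)·σ; or (ii) there exist a real number B with c·σ^C ≤ B ≤ C·σ^{−C}, an integer Q with 1 ≤ Q ≤ C·σ^{−C}, a set Γ ⊆ {(a,q) : 1 ≤ q ≤ Q, 1 ≤ a ≤ q, gcd(a,q) = 1}, and frequencies γ_{a,q} ∈ 𝔐_{a,q}(N, κ/σ) for (a,q) ∈ Γ, such that ∑_{(a,q) ∈ Γ} |1̂_A(γ_{a,q})| ≥ c·B·|A|·Q^{1/2}/( (log N)^{1/4}·(log(1/σ))² ), for each (a,q) ∈ Γ one has ∫_{𝔐_{a,q}(N,κ/σ)} | 1̂_A(γ) − σ·1̂_{[N]}(γ)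 |² dγ ≥ c·σ·|A|/B², and additionally #{a : (a,q) ∈ Γ} ≤ C·ν·B² for every q ≤ Q. -/

import Mathlib

/-- `e(x) = e^{2πix}`. -/
noncomputable def e (x : ℝ) : ℂ := Complex.exp (2 * Real.pi * Complex.I * x)
/-- The distance from `x` to the nearest integer, i.e. the norm of the image of `x` in
`𝕋 = ℝ/ℤ`. -/
noncomputable def torusNorm (x : ℝ) : ℝ := |x - round x|

lemma e_add (x y : ℝ) : e (x + y) = e x * e y := by
  unfold e; rw [← Complex.exp_add]; congr 1; push_cast; ring

lemma e_zero : e 0 = 1 := by simp [e]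

lemma norm_e (x : ℝ) : ‖e x‖ = 1 := by
  unfold e
  rw [show (2 * Real.pi * Complex.I * x : ℂ) = ((2 * Real.pi * x : ℝ) : ℂ) * Complex.I by push_cast; ring]
  exact Complex.norm_exp_ofReal_mul_I _

lemma e_int (n : ℤ) : e n = 1 := by
  unfold e
  rw [Complex.exp_eq_one_iff]
  exact ⟨n, by push_cast; ring⟩

lemma e_add_int (x : ℝ) (n : ℤ) : e (x + n) = e x := by rw [e_add, e_int, mul_one]

lemma e_sub_int (x : ℝ) (n : ℤ) : e (x - n) = e x := by
  have := e_add_int (x - n) n; rw [← this]; congr 1; ring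

lemma e_neg (x : ℝ) : e (-x) = (starRingEnd ℂ) (e x) := by
  unfold e; rw [← Complex.exp_conj]; congr 1; simp [Complex.conj_ofNat]

lemma e_nat_mul (n : ℕ) (x : ℝ) : e (n * x) = e x ^ n := by
  unfold e; rw [← Complex.exp_nat_mul]; congr 1; push_cast; ring

lemma e_sum {ι : Type*} (s : Finset ι) (f : ι → ℝ) : e (∑ i ∈ s, f i) = ∏ i ∈ s, e (f i) := by
  classical
  induction s using Finset.induction_on with
  | empty => simp [e_zero]
  | insert a s ha ih => rw [Finset.sum_insert ha, Finset.prod_insert ha, e_add, ih]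

lemma norm_e_sub_one_le (x : ℝ) : ‖e x - 1‖ ≤ 2 * Real.pi * |x| := by
  have := Real.norm_exp_I_mul_ofReal_sub_one_le (x := 2 * Real.pi * x)
  unfold e
  rw [show (2 * Real.pi * Complex.I * x : ℂ) = Complex.I * ((2 * Real.pi * x : ℝ) : ℂ) by push_cast; ring]
  refine this.trans (le_of_eq ?_)
  rw [Real.norm_eq_abs, abs_mul, abs_of_pos (by positivity)]

lemma norm_e_sub_e_le (x y : ℝ) : ‖e x - e y‖ ≤ 2 * Real.pi * |x - y| := by
  have h : e x - e y = (e (x - y) - 1) * e y := by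
    rw [sub_mul, ← e_add]; simp
  rw [h, norm_mul, norm_e, mul_one]
  exact norm_e_sub_one_le _

lemma norm_e_sub_one (x : ℝ) : ‖e x - 1‖ = 2 * |Real.sin (Real.pi * x)| := by
  unfold e
  rw [show (2 * Real.pi * Complex.I * x : ℂ) = Complex.I * ((2 * Real.pi * x : ℝ) : ℂ) by push_cast; ring,
    Complex.norm_exp_I_mul_ofReal_sub_one, Real.norm_eq_abs, abs_mul, abs_of_pos (by norm_num : (0:ℝ) < 2)]
  congr 3; ring

lemma torusNorm_nonneg (x : ℝ) : 0 ≤ torusNorm x := abs_nonneg _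

lemma torusNorm_le_abs_sub (x : ℝ) (n : ℤ) : torusNorm x ≤ |x - n| := round_le x n

lemma torusNorm_le_half (x : ℝ) : torusNorm x ≤ 1 / 2 := abs_sub_round x

lemma torusNorm_add_le (x y : ℝ) : torusNorm (x + y) ≤ torusNorm x + torusNorm y := by
  refine (torusNorm_le_abs_sub (x + y) (round x + round y)).trans ?_
  unfold torusNorm
  refine (le_of_eq ?_).trans (abs_add_le _ _)
  push_cast; congr 1; ring

lemma torusNorm_neg (x : ℝ) : torusNorm (-x) = torusNorm x := by
  have key : ∀ x, torusNorm (-x) ≤ torusNorm x := by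
    intro x
    refine (torusNorm_le_abs_sub (-x) (-round x)).trans (le_of_eq ?_)
    unfold torusNorm; rw [← abs_neg]; congr 1; push_cast; ring
  exact le_antisymm (key x) (by simpa using key (-x))

lemma torusNorm_sub_le (x y : ℝ) : torusNorm (x - y) ≤ torusNorm x + torusNorm y := by
  rw [sub_eq_add_neg]; refine (torusNorm_add_le _ _).trans_eq (by rw [torusNorm_neg])

lemma torusNorm_int_mul_le (n : ℤ) (x : ℝ) : torusNorm (n * x) ≤ |(n : ℝ)| * torusNorm x := by
  refine (torusNorm_le_abs_sub (n * x) (n * round x)).trans (le_of_eq ?_)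
  unfold torusNorm; rw [← abs_mul]; congr 1; push_cast; ring

lemma torusNorm_nat_mul_le (n : ℕ) (x : ℝ) : torusNorm (n * x) ≤ n * torusNorm x := by
  have := torusNorm_int_mul_le n x; simpa using this

lemma torusNorm_sum_le {ι : Type*} (s : Finset ι) (f : ι → ℝ) :
    torusNorm (∑ i ∈ s, f i) ≤ ∑ i ∈ s, torusNorm (f i) := by
  classical
  induction s using Finset.induction_on with
  | empty => simp [torusNorm]
  | insert a s ha ih =>
    rw [Finset.sum_insert ha, Finset.sum_insert ha]
    exact (torusNorm_add_le _ _).trans (by linarith)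

lemma four_torusNorm_le (x : ℝ) : 4 * torusNorm x ≤ ‖e x - 1‖ := by
  have h1 : e x = e (x - round x) := (e_sub_int x _).symm
  rw [h1, norm_e_sub_one]
  unfold torusNorm
  set y := x - round x
  have hy : |y| ≤ 1 / 2 := abs_sub_round x
  have h2 : |Real.sin (Real.pi * y)| = Real.sin (Real.pi * |y|) := by
    rcases le_total 0 y with h | h
    · rw [abs_of_nonneg h]; rw [abs_of_nonneg h] at hy
      exact abs_of_nonneg (Real.sin_nonneg_of_nonneg_of_le_pi (by positivity) (by nlinarith [Real.pi_pos]))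
    · rw [abs_of_nonpos h, mul_neg, Real.sin_neg]; rw [abs_of_nonpos h] at hy
      refine abs_of_nonpos ?_
      have := Real.sin_nonneg_of_nonneg_of_le_pi (x := Real.pi * (-y))
        (mul_nonneg Real.pi_pos.le (by linarith)) (by nlinarith [Real.pi_pos])
      rw [mul_neg, Real.sin_neg] at this; linarith
  rw [h2]
  have h3 := Real.mul_le_sin (x := Real.pi * |y|) (by positivity) (by nlinarith [Real.pi_pos])
  have h4 : 2 / Real.pi * (Real.pi * |y|) = 2 * |y| := by field_simp
  linarith

/-- geometric sum -/
lemma norm_geom_e (J : ℕ) (x : ℝ) : ‖∑ j ∈ Finset.range J, e (j * x)‖ * (2 * torusNorm x) ≤ 1 := by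
  have h : (∑ j ∈ Finset.range J, e (j * x)) * (e x - 1) = e x ^ J - 1 := by
    simp_rw [e_nat_mul]; exact geom_sum_mul (e x) J
  have h1 : ‖∑ j ∈ Finset.range J, e (j * x)‖ * ‖e x - 1‖ ≤ 2 := by
    rw [← norm_mul, h]
    refine (norm_sub_le _ _).trans ?_
    rw [norm_pow, norm_e]; norm_num
  have h2 := four_torusNorm_le x
  nlinarith [norm_nonneg (∑ j ∈ Finset.range J, e (j * x)), torusNorm_nonneg x]

lemma card_le_of_diff (T : Finset ℤ) (L : ℝ) (hL : 0 ≤ L)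
    (h : ∀ a ∈ T, ∀ b ∈ T, ((a : ℝ) - b) ≤ L) : (T.card : ℝ) ≤ L + 1 := by
  rcases T.eq_empty_or_nonempty with rfl | hne
  · simp; linarith
  · set m := T.min' hne
    have hsub : T ⊆ Finset.Icc m (m + ⌊L⌋) := by
      intro a ha
      rw [Finset.mem_Icc]
      refine ⟨T.min'_le a ha, ?_⟩
      have h1 := h a ha m (T.min'_mem hne)
      have : a - m ≤ ⌊L⌋ := Int.le_floor.2 (by push_cast; exact h1)
      linarith
    have h2 := Finset.card_le_card hsub
    rw [Int.card_Icc] at h2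
    have h3 : (0:ℤ) ≤ ⌊L⌋ := Int.floor_nonneg.2 hL
    have h4 : (T.card : ℤ) ≤ ⌊L⌋ + 1 := by omega
    have h5 : ((T.card : ℤ) : ℝ) ≤ ((⌊L⌋ + 1 : ℤ) : ℝ) := by exact_mod_cast h4
    push_cast at h5
    linarith [Int.floor_le L]

lemma ap_count (T : Finset ℤ) (L ε c θ : ℝ) (hL : 0 ≤ L) (hθ : θ ≠ 0) (hε : 0 ≤ ε) (hε1 : 2 * ε ≤ 1)
    (h : ∀ a ∈ T, ∀ b ∈ T, ((a : ℝ) - b) ≤ L) (hT : ∀ a ∈ T, torusNorm (c + a * θ) ≤ ε) :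
    (T.card : ℝ) ≤ (|θ| * L + 2) * (2 * ε / |θ| + 1) := by
  have hpos : 0 < |θ| := abs_pos.2 hθ
  set f : ℤ → ℤ := fun a => round (c + a * θ)
  have hf : ∀ a ∈ T, |c + a * θ - f a| ≤ ε := hT
  have habs : ∀ a ∈ T, ∀ b ∈ T, |(a : ℝ) - b| ≤ L := fun a ha b hb =>
    abs_le.2 ⟨by linarith [h b hb a ha], h a ha b hb⟩
  have h1 : ((T.image f).card : ℝ) ≤ |θ| * L + 2 := by
    refine (card_le_of_diff _ (|θ| * L + 1) (by positivity) ?_).trans (by linarith)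
    intro x hx y hy
    obtain ⟨a, ha, rfl⟩ := Finset.mem_image.1 hx
    obtain ⟨b, hb, rfl⟩ := Finset.mem_image.1 hy
    have e1 := abs_le.1 (hf a ha); have e2 := abs_le.1 (hf b hb)
    have e3 : ((a : ℝ) - b) * θ ≤ |θ| * L := by
      refine (le_abs_self _).trans ?_
      rw [abs_mul, mul_comm]
      exact mul_le_mul_of_nonneg_left (habs a ha b hb) hpos.le
    nlinarith
  have h2 : ∀ n ∈ T.image f, ((T.filter (fun a => f a = n)).card : ℝ) ≤ 2 * ε / |θ| + 1 := by
    intro n _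
    refine card_le_of_diff _ _ (by positivity) ?_
    intro a ha b hb
    rw [Finset.mem_filter] at ha hb
    have e1 := hf a ha.1; have e2 := hf b hb.1
    rw [ha.2] at e1; rw [hb.2] at e2
    rw [le_div_iff₀ hpos]
    have : ((a : ℝ) - b) * |θ| ≤ |((a : ℝ) - b) * θ| := by
      rw [abs_mul]; exact mul_le_mul_of_nonneg_right (le_abs_self _) hpos.le
    refine this.trans ?_
    have e3 : ((a : ℝ) - b) * θ = (c + a * θ - n) - (c + b * θ - n) := by ring
    rw [e3]
    exact (abs_sub _ _).trans (by linarith)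
  have h3 : (T.card : ℝ) = ∑ n ∈ T.image f, ((T.filter (fun a => f a = n)).card : ℝ) := by
    rw [← Nat.cast_sum]
    exact_mod_cast Finset.card_eq_sum_card_image f T
  rw [h3]
  refine (Finset.sum_le_sum h2).trans ?_
  rw [Finset.sum_const, nsmul_eq_mul]
  exact mul_le_mul_of_nonneg_right h1 (by positivity)

lemma recur (θ ε σ : ℝ) (M : ℕ) (S : Finset ℕ) (hS : ∀ h ∈ S, h ≤ M) (hσ : 0 < σ) (hσ1 : σ ≤ 1)
    (hcard : σ * M ≤ S.card) (hε : 0 ≤ ε) (hθ : ∀ h ∈ S, torusNorm (h * θ) ≤ ε) (hεσ : 16 * ε ≤ σ)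
    (hM : 16 ≤ σ ^ 2 * M) :
    ∃ q : ℕ, 1 ≤ q ∧ (q : ℝ) ≤ 2 / σ ∧ torusNorm (q * θ) * M ≤ 16 * ε / σ ^ 2 := by
  have hMpos : (0:ℝ) < M := by
    by_contra hh
    have : (M:ℝ) = 0 := le_antisymm (not_lt.1 hh) (Nat.cast_nonneg _)
    rw [this] at hM; norm_num at hM
  have hσM : 16 ≤ σ * M := by nlinarith
  -- pigeonhole
  have hpig : ∃ x ∈ S, ∃ y ∈ S, x ≠ y ∧ ⌊(x:ℝ) * σ / 2⌋₊ = ⌊(y:ℝ) * σ / 2⌋₊ := by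
    have hmaps : ∀ a ∈ S, ⌊(a:ℝ) * σ / 2⌋₊ ∈ Finset.range (⌊(M:ℝ) * σ / 2⌋₊ + 1) := by
      intro a ha
      rw [Finset.mem_range, Nat.lt_succ_iff]
      apply Nat.floor_le_floor
      have : (a:ℝ) ≤ M := by exact_mod_cast hS a ha
      nlinarith
    refine Finset.exists_ne_map_eq_of_card_lt_of_maps_to ?_ hmaps
    rw [Finset.card_range]
    have h1 := Nat.floor_le (a := (M:ℝ) * σ / 2) (by positivity)
    have : ((⌊(M:ℝ) * σ / 2⌋₊ + 1 : ℕ) : ℝ) < S.card := by push_cast; nlinarith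
    exact_mod_cast this
  obtain ⟨q, hq1, hq2, hq3⟩ : ∃ q : ℕ, 1 ≤ q ∧ (q : ℝ) ≤ 2 / σ ∧ torusNorm (q * θ) ≤ 2 * ε := by
    obtain ⟨x, hx, y, hy, hne, hfl⟩ := hpig
    wlog hlt : y < x generalizing x y
    · exact this y hy x hx hne.symm hfl.symm (by omega)
    refine ⟨x - y, by omega, ?_, ?_⟩
    · rw [Nat.cast_sub hlt.le, le_div_iff₀ hσ]
      have h1 := Nat.floor_le (a := (y:ℝ) * σ / 2) (by positivity)
      have h2 := Nat.lt_floor_add_one ((x:ℝ) * σ / 2)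
      rw [hfl] at h2
      linarith
    · rw [Nat.cast_sub hlt.le, sub_mul]
      exact (torusNorm_sub_le _ _).trans (by linarith [hθ x hx, hθ y hy])
  refine ⟨q, hq1, hq2, ?_⟩
  set φ : ℝ := q * θ - round (q * θ) with hφ
  have hδ : torusNorm (q * θ) = |φ| := rfl
  rw [hδ] at hq3 ⊢
  by_cases h0 : φ = 0
  · rw [h0, abs_zero, zero_mul]; positivity
  have hpos : 0 < |φ| := abs_pos.2 h0
  have hqpos : (0:ℝ) < q := by exact_mod_cast hq1
  have hres : ∀ r ∈ Finset.range q, ((S.filter (fun h => h % q = r)).card : ℝ) ≤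
      (|φ| * (M / q) + 2) * (2 * ε / |φ| + 1) := by
    intro r hr
    have hinj : Set.InjOn (fun h : ℕ => ((h / q : ℕ) : ℤ)) (S.filter (fun h => h % q = r)) := by
      intro a ha b hb hab
      rw [Finset.mem_coe, Finset.mem_filter] at ha hb
      have h1 : a / q = b / q := Int.ofNat.inj hab
      rw [← Nat.div_add_mod a q, ← Nat.div_add_mod b q, h1, ha.2, hb.2]
    rw [← Finset.card_image_of_injOn hinj]
    refine ap_count _ (M / q) ε (r * θ) φ (by positivity) h0 hε (by linarith) ?_ ?_
    · intro a' ha' b' hb'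
      obtain ⟨a, ha, rfl⟩ := Finset.mem_image.1 ha'
      obtain ⟨b, hb, rfl⟩ := Finset.mem_image.1 hb'
      rw [Finset.mem_filter] at ha hb
      have h1 : (((a / q : ℕ) : ℤ) : ℝ) ≤ M / q := by
        rw [Int.cast_natCast]
        refine Nat.cast_div_le.trans ?_
        have : (a:ℝ) ≤ M := by exact_mod_cast hS a ha.1
        gcongr
      have h2 : (0:ℝ) ≤ (((b / q : ℕ) : ℤ) : ℝ) := by positivity
      linarith
    · intro a' ha'
      obtain ⟨a, ha, rfl⟩ := Finset.mem_image.1 ha'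
      rw [Finset.mem_filter] at ha
      have h1 := hθ a ha.1
      have h2 : (a:ℝ) = q * (a / q : ℕ) + r := by
        have := Nat.div_add_mod a q
        rw [ha.2] at this
        exact_mod_cast this.symm
      have h3 : (r:ℝ) * θ + (((a / q : ℕ) : ℤ) : ℝ) * φ = a * θ - ((((a / q : ℕ) : ℤ) * round (q * θ) : ℤ) : ℝ) := by
        simp only [Int.cast_mul, Int.cast_natCast]; rw [hφ, h2]; ring
      rw [h3]
      have key : ∀ (x : ℝ) (n : ℤ), torusNorm (x - n) = torusNorm x := by
        intro x n; unfold torusNorm; rw [round_sub_intCast]; congr 1; push_cast; ring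
      rw [key]; exact h1
  have htot : (S.card : ℝ) ≤ q * ((|φ| * (M / q) + 2) * (2 * ε / |φ| + 1)) := by
    have : S.card = ∑ r ∈ Finset.range q, (S.filter (fun h => h % q = r)).card :=
      Finset.card_eq_sum_card_fiberwise (fun a _ => Finset.mem_coe.2 (Finset.mem_range.2 (Nat.mod_lt _ (by omega))))
    rw [this, Nat.cast_sum]
    refine (Finset.sum_le_sum hres).trans ?_
    rw [Finset.sum_const, Finset.card_range, nsmul_eq_mul]
  have hexp : (q:ℝ) * ((|φ| * (M / q) + 2) * (2 * ε / |φ| + 1)) = 2 * ε * M + |φ| * M + 4 * ε * q / |φ| + 2 * q := by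
    field_simp; ring
  rw [hexp] at htot
  have hq2' : q * σ ≤ 2 := by rwa [le_div_iff₀ hσ] at hq2
  have e1 : |φ| * M ≤ 2 * ε * M := mul_le_mul_of_nonneg_right hq3 hMpos.le
  have e2 : 4 * (2 * (q:ℝ)) ≤ σ * M := by
    have : 8 * (q:ℝ) * σ ≤ σ * M * σ := by nlinarith
    nlinarith
  have e3 : 4 * (4 * ε * M) ≤ σ * M := by nlinarith
  have e4 : σ * M / 2 ≤ 4 * ε * q / |φ| := by nlinarith
  rw [le_div_iff₀ hpos] at e4
  rw [le_div_iff₀ (by positivity)]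
  nlinarith [mul_le_mul_of_nonneg_left hq2' (by positivity : 0 ≤ 8 * ε)]

open Polynomial in
lemma taylor_sub_facts (k : ℕ) (P : ℝ[X]) (hP : P.natDegree ≤ k + 1) (h : ℝ) :
    (taylor h P - P).natDegree ≤ k ∧ (taylor h P - P).coeff k = (k + 1) * h * P.coeff (k + 1) := by
  have hd : ∀ j, (hasseDeriv j P).natDegree ≤ k + 1 - j := fun j =>
    (natDegree_hasseDeriv_le P j).trans (by omega)
  constructor
  · rw [natDegree_le_iff_coeff_eq_zero]
    intro N hN
    rw [coeff_sub, taylor_coeff]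
    rcases Nat.lt_or_ge N (k + 2) with hlt | hge
    · have : N = k + 1 := by omega
      subst this
      have h0 := hd (k + 1)
      rw [Nat.sub_self] at h0
      rw [eq_C_of_natDegree_le_zero h0, eval_C, hasseDeriv_coeff]
      simp
    · have h1 : P.coeff N = 0 := coeff_eq_zero_of_natDegree_lt (by omega)
      rw [h1, hasseDeriv_eq_zero_of_lt_natDegree _ _ (by omega)]; simp
  · rw [coeff_sub, taylor_coeff]
    have h0 := hd k
    rw [eval_eq_sum_range' (n := 2) (by omega)]
    rw [Finset.sum_range_succ, Finset.sum_range_one, hasseDeriv_coeff, hasseDeriv_coeff]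
    simp [Nat.add_comm 1 k]
    ring

lemma vdc_eq (f : ℕ → ℂ) (M : ℕ) : ‖∑ n ∈ Finset.range M, f n‖ ^ 2 =
    ∑ n ∈ Finset.range M, ‖f n‖ ^ 2 + 2 * (∑ h ∈ Finset.range M, ∑ n ∈ Finset.range (M - (h + 1)),
      f (n + (h + 1)) * (starRingEnd ℂ) (f n)).re := by
  induction M with
  | zero => simp
  | succ M ih =>
    rw [Finset.sum_range_succ, Finset.sum_range_succ, Finset.sum_range_succ _ M, Nat.sub_self,
      Finset.range_zero, Finset.sum_empty, add_zero]
    have h1 : ∑ h ∈ Finset.range M, ∑ n ∈ Finset.range (M + 1 - (h + 1)),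
        f (n + (h + 1)) * (starRingEnd ℂ) (f n) = ∑ h ∈ Finset.range M, ∑ n ∈ Finset.range (M - (h + 1)),
        f (n + (h + 1)) * (starRingEnd ℂ) (f n) + f M * (starRingEnd ℂ) (∑ n ∈ Finset.range M, f n) := by
      rw [map_sum, ← Finset.sum_range_reflect (fun n => (starRingEnd ℂ) (f n)), Finset.mul_sum,
        ← Finset.sum_add_distrib]
      refine Finset.sum_congr rfl fun h hh => ?_
      rw [Finset.mem_range] at hh
      rw [show M + 1 - (h + 1) = (M - (h + 1)) + 1 by omega, Finset.sum_range_succ,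
        show M - (h + 1) + (h + 1) = M by omega, show M - 1 - h = M - (h + 1) by omega]
    rw [h1, Complex.add_re]
    have h2 : ∀ a b : ℂ, ‖a + b‖ ^ 2 = ‖a‖ ^ 2 + ‖b‖ ^ 2 + 2 * (b * (starRingEnd ℂ) a).re := by
      intro a b
      rw [Complex.sq_norm, Complex.sq_norm, Complex.sq_norm, Complex.normSq_add]
      have : (a * (starRingEnd ℂ) b).re = (b * (starRingEnd ℂ) a).re := by
        simp [Complex.mul_re]; ring
      rw [this]
    rw [h2, ih]; ring

open Polynomial in
lemma WL (k : ℕ) (hk : 1 ≤ k) : ∃ C : ℕ, ∀ (M : ℕ) (R : ℝ) (P : ℝ[X]), 1 ≤ M → 2 ≤ R →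
    P.natDegree ≤ k → (M : ℝ) ≤ ‖∑ n ∈ Finset.range M, e (P.eval (n : ℝ))‖ * R →
    ∃ q : ℕ, 1 ≤ q ∧ (q : ℝ) ≤ R ^ C ∧ torusNorm (q * P.coeff k) * M ^ k ≤ R ^ C := by
  induction k, hk using Nat.le_induction with
  | base =>
    refine ⟨1, fun M R P hM hR hP h => ⟨1, le_rfl, by simp; linarith, ?_⟩⟩
    have h1 : ∀ n : ℕ, e (P.eval (n:ℝ)) = e (P.coeff 0) * e (n * P.coeff 1) := by
      intro n
      rw [← e_add, eval_eq_sum_range' (n := 2) (by omega), Finset.sum_range_succ, Finset.sum_range_one]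
      congr 1; ring
    simp_rw [h1] at h
    rw [← Finset.mul_sum, norm_mul, norm_e, one_mul] at h
    have h2 := norm_geom_e M (P.coeff 1)
    have h3 := torusNorm_nonneg (P.coeff 1)
    simp only [Nat.cast_one, one_mul, pow_one]
    nlinarith [mul_le_mul_of_nonneg_right h h3]
  | succ k hk ih =>
    obtain ⟨C, hC⟩ := ih
    refine ⟨5 * (3 * C + k + 5) * (k + 2), fun M R P hM hR hP h => ?_⟩
    set R' : ℝ := 8 * R ^ 2 with hR'
    have hR'32 : 32 ≤ R' := by nlinarith
    have hR1 : 1 ≤ R := by linarith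
    have hR'1 : 1 ≤ R' := by linarith
    have hR'5 : R' ≤ R ^ 5 := by
      have : (2:ℝ) ^ 3 ≤ R ^ 3 := by gcongr
      calc R' = 2 ^ 3 * R ^ 2 := by rw [hR']; norm_num
        _ ≤ R ^ 3 * R ^ 2 := by gcongr
        _ = R ^ 5 := by ring
    have hpow : ∀ j : ℕ, R' ^ j ≤ R ^ (5 * j) := by
      intro j; rw [pow_mul]; gcongr
    have hMpos : (0:ℝ) < M := by exact_mod_cast hM
    by_cases hbig : (M : ℝ) < R' ^ (3 * C + k + 5)
    · refine ⟨1, le_rfl, by rw [Nat.cast_one]; exact one_le_pow₀ hR1, ?_⟩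
      have h1 : (M:ℝ) ^ (k + 1) ≤ R ^ (5 * (3 * C + k + 5) * (k + 1)) := by
        rw [pow_mul]
        exact pow_le_pow_left₀ hMpos.le (hbig.le.trans (hpow _)) _
      have h2 : R ^ (5 * (3 * C + k + 5) * (k + 1)) ≤ R ^ (5 * (3 * C + k + 5) * (k + 2)) :=
        pow_le_pow_right₀ hR1 (by gcongr; omega)
      have h3 := torusNorm_le_half (((1:ℕ):ℝ) * P.coeff (k + 1))
      have h4 := torusNorm_nonneg (((1:ℕ):ℝ) * P.coeff (k + 1))
      calc _ ≤ 1 * (M:ℝ) ^ (k + 1) := by gcongr; exact h3.trans (by norm_num)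
        _ ≤ _ := by rw [one_mul]; exact h1.trans h2
    push Not at hbig
    set β := P.coeff (k + 1) with hβ
    let T : ℕ → ℂ := fun h => ∑ n ∈ Finset.range (M - (h + 1)),
      e ((taylor ((h + 1 : ℕ) : ℝ) P - P).eval (n:ℝ))
    have hvdc : ‖∑ n ∈ Finset.range M, e (P.eval (n:ℝ))‖ ^ 2 ≤ M + 2 * ∑ h ∈ Finset.range M, ‖T h‖ := by
      rw [vdc_eq]
      have e1 : ∑ n ∈ Finset.range M, ‖e (P.eval (n:ℝ))‖ ^ 2 = (M:ℝ) := by simp [norm_e]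
      rw [e1]
      gcongr
      refine (Complex.re_le_norm _).trans ((norm_sum_le _ _).trans (le_of_eq ?_))
      refine Finset.sum_congr rfl fun h _ => ?_
      congr 1
      refine Finset.sum_congr rfl fun n _ => ?_
      rw [← e_neg, ← e_add, eval_sub, taylor_eval]
      push_cast; congr 1
    have hTle : ∀ h, ‖T h‖ ≤ ((M - (h + 1) : ℕ) : ℝ) := by
      intro h
      refine (norm_sum_le _ _).trans (le_of_eq ?_)
      simp [norm_e]
    have hTleM : ∀ h, ‖T h‖ ≤ M := fun h => (hTle h).trans (by exact_mod_cast Nat.sub_le _ _)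
    have hMR' : R' ≤ M := (le_self_pow₀ hR'1 (by omega)).trans hbig
    -- many good h
    set G := (Finset.range M).filter (fun h => (M:ℝ) ≤ ‖T h‖ * R') with hG
    have hsum : (M:ℝ) ^ 2 * 2 ≤ (∑ h ∈ Finset.range M, ‖T h‖) * R' := by
      have h1 : (M:ℝ) ^ 2 ≤ (M + 2 * ∑ h ∈ Finset.range M, ‖T h‖) * R ^ 2 := by
        calc (M:ℝ) ^ 2 ≤ (‖∑ n ∈ Finset.range M, e (P.eval (n:ℝ))‖ * R) ^ 2 := by gcongr
          _ = ‖∑ n ∈ Finset.range M, e (P.eval (n:ℝ))‖ ^ 2 * R ^ 2 := by ring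
          _ ≤ _ := by gcongr
      rw [hR']
      rw [hR'] at hMR'
      nlinarith
    have hGcard : (M:ℝ) ≤ G.card * R' := by
      have h1 : ∑ h ∈ Finset.range M, ‖T h‖ ≤ ∑ h ∈ Finset.range M, ((if (M:ℝ) ≤ ‖T h‖ * R' then (M:ℝ) else 0) + M / R') := by
        refine Finset.sum_le_sum fun h _ => ?_
        split_ifs with hh
        · linarith [hTleM h, div_nonneg hMpos.le (by linarith : 0 ≤ R')]
        · rw [zero_add, le_div_iff₀ (by linarith)]; linarith
      rw [Finset.sum_add_distrib, ← Finset.sum_filter, Finset.sum_const, Finset.sum_const, Finset.card_range,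
        nsmul_eq_mul, nsmul_eq_mul] at h1
      have h2 : (∑ h ∈ Finset.range M, ‖T h‖) * R' ≤ G.card * M * R' + M * M := by
        calc _ ≤ (G.card * M + M * (M / R')) * R' := by gcongr
          _ = _ := by field_simp
      nlinarith
    have hgood : ∀ h ∈ G, ∃ q : ℕ, 1 ≤ q ∧ (q:ℝ) ≤ R' ^ C ∧
        torusNorm (((h + 1 : ℕ) : ℝ) * (q * (k + 1) * β)) * M ^ k ≤ R' ^ (C + k) := by
      intro h hh
      rw [hG, Finset.mem_filter] at hh
      have hmh : (M:ℝ) ≤ ((M - (h + 1) : ℕ) : ℝ) * R' :=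
        hh.2.trans (mul_le_mul_of_nonneg_right (hTle h) (by linarith))
      have hm1 : 1 ≤ M - (h + 1) := by
        by_contra hc
        have : M - (h + 1) = 0 := by omega
        rw [this] at hmh; simp at hmh; omega
      obtain ⟨f1, f2⟩ := taylor_sub_facts k P hP ((h + 1 : ℕ) : ℝ)
      obtain ⟨q, q1, q2, q3⟩ := hC (M - (h + 1)) R' _ hm1 (by linarith) f1
        ((by exact_mod_cast Nat.sub_le _ _ : ((M - (h + 1) : ℕ) : ℝ) ≤ M).trans hh.2)
      refine ⟨q, q1, q2, ?_⟩
      rw [f2] at q3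
      have e1 : (q:ℝ) * ((k + 1) * ((h + 1 : ℕ) : ℝ) * β) = ((h + 1 : ℕ) : ℝ) * (q * (k + 1) * β) := by ring
      rw [e1] at q3
      calc _ ≤ torusNorm (((h + 1 : ℕ) : ℝ) * (q * (k + 1) * β)) * (((M - (h + 1) : ℕ) : ℝ) * R') ^ k := by
            gcongr; exact torusNorm_nonneg _
        _ = (torusNorm (((h + 1 : ℕ) : ℝ) * (q * (k + 1) * β)) * ((M - (h + 1) : ℕ) : ℝ) ^ k) * R' ^ k := by ring
        _ ≤ R' ^ C * R' ^ k := by gcongr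
        _ = _ := by ring
    choose! qh hq1 hq2 hq3 using hgood
    set Q := ⌊R' ^ C⌋₊
    have hQ : (Q:ℝ) ≤ R' ^ C := Nat.floor_le (by positivity)
    have hmaps : ∀ h ∈ G, qh h ∈ Finset.Icc 1 Q := fun h hh =>
      Finset.mem_Icc.2 ⟨hq1 h hh, Nat.le_floor (hq2 h hh)⟩
    set σ : ℝ := (R' ^ (C + 1))⁻¹ with hσ
    have hσpos : 0 < σ := by positivity
    have hσR : σ * R' ^ (C + 1) = 1 := by rw [hσ]; field_simp
    have hGne : G.Nonempty := by
      rw [Finset.nonempty_iff_ne_empty]; intro hc; rw [hc] at hGcard; simp at hGcard; omega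
    obtain ⟨h0, hh0⟩ := hGne
    obtain ⟨q, hq, hqc⟩ := Finset.exists_le_card_fiber_of_nsmul_le_card_of_maps_to (b := σ * (M:ℝ)) hmaps
      ⟨_, hmaps h0 hh0⟩ (by
        rw [Nat.card_Icc, nsmul_eq_mul, Nat.add_sub_cancel]
        have e1 : (Q:ℝ) * (σ * M) * R' ≤ G.card * R' := by
          calc (Q:ℝ) * (σ * M) * R' ≤ R' ^ C * (σ * M) * R' := by gcongr
            _ = σ * R' ^ (C + 1) * M := by ring
            _ = M := by rw [hσR, one_mul]
            _ ≤ _ := hGcard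
        exact le_of_mul_le_mul_right e1 (by linarith))
    rw [Finset.mem_Icc] at hq
    set S := (G.filter (fun h => qh h = q)).image (fun h => h + 1) with hS
    have hScard : S.card = (G.filter (fun h => qh h = q)).card :=
      Finset.card_image_of_injective _ (fun a b hab => by simpa using hab)
    have hMk : R' ^ (3 * C + k + 5) ≤ (M:ℝ) ^ k := by
      exact hbig.trans (le_self_pow₀ (by linarith) (by omega))
    have hε : 16 * (R' ^ (C + k) / (M:ℝ) ^ k) ≤ σ := by
      rw [hσ, ← mul_div_assoc, div_le_iff₀ (by positivity), ← div_eq_inv_mul, le_div_iff₀ (by positivity)]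
      calc 16 * R' ^ (C + k) * R' ^ (C + 1) ≤ R' * R' ^ (C + k) * R' ^ (C + 1) := by gcongr; linarith
        _ = R' ^ (2 * C + k + 2) := by ring
        _ ≤ R' ^ (3 * C + k + 5) := pow_le_pow_right₀ hR'1 (by omega)
        _ ≤ _ := hMk
    have hσM : 16 ≤ σ ^ 2 * M := by
      rw [hσ, inv_pow, ← div_eq_inv_mul, le_div_iff₀ (by positivity)]
      calc 16 * (R' ^ (C + 1)) ^ 2 ≤ R' * (R' ^ (C + 1)) ^ 2 := by gcongr; linarith
        _ = R' ^ (2 * C + 3) := by ring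
        _ ≤ R' ^ (3 * C + k + 5) := pow_le_pow_right₀ hR'1 (by omega)
        _ ≤ _ := hbig
    obtain ⟨q2, hq21, hq22, hq23⟩ := recur (q * (k + 1) * β) (R' ^ (C + k) / (M:ℝ) ^ k) σ M S
      (by
        intro x hx
        obtain ⟨h, hh, rfl⟩ := Finset.mem_image.1 hx
        rw [Finset.mem_filter, hG, Finset.mem_filter, Finset.mem_range] at hh
        omega) hσpos (inv_le_one_of_one_le₀ (one_le_pow₀ hR'1)) (by rw [hScard]; exact hqc) (by positivity)
      (by
        intro x hx
        obtain ⟨h, hh, rfl⟩ := Finset.mem_image.1 hx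
        rw [Finset.mem_filter] at hh
        rw [le_div_iff₀ (by positivity)]
        have := hq3 h hh.1
        rwa [hh.2] at this) hε hσM
    have hkR : ((k:ℝ) + 1) ≤ R ^ (k + 1) := by
      have h1 : k + 1 < 2 ^ (k + 1) := Nat.lt_two_pow_self
      calc ((k:ℝ) + 1) ≤ 2 ^ (k + 1) := by exact_mod_cast h1.le
        _ ≤ R ^ (k + 1) := by gcongr
    refine ⟨q2 * (q * (k + 1)), Nat.mul_pos hq21 (Nat.mul_pos hq.1 (by omega)), ?_, ?_⟩
    · have hqQ : (q:ℝ) ≤ R' ^ C := le_trans (by exact_mod_cast hq.2) hQ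
      have hq22' : (q2:ℝ) ≤ R' ^ (C + 2) := by
        refine hq22.trans ?_
        rw [hσ, div_inv_eq_mul]
        calc 2 * R' ^ (C + 1) ≤ R' * R' ^ (C + 1) := by gcongr; linarith
          _ = _ := by ring
      push_cast
      calc (q2:ℝ) * (q * (k + 1)) ≤ R' ^ (C + 2) * (R' ^ C * R ^ (k + 1)) := by gcongr
        _ = R' ^ (2 * C + 2) * R ^ (k + 1) := by ring
        _ ≤ R ^ (5 * (2 * C + 2)) * R ^ (k + 1) := by gcongr; exact hpow _
        _ = R ^ (5 * (2 * C + 2) + (k + 1)) := (pow_add _ _ _).symm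
        _ ≤ _ := pow_le_pow_right₀ hR1 (by nlinarith)
    · push_cast
      have e1 : (q2:ℝ) * (q * (k + 1)) * β = q2 * (q * (k + 1) * β) := by ring
      rw [e1, pow_succ', ← mul_assoc]
      calc torusNorm (q2 * (q * (k + 1) * β)) * M * M ^ k ≤ 16 * (R' ^ (C + k) / M ^ k) / σ ^ 2 * M ^ k := by
            gcongr
        _ = 16 * R' ^ (C + k) * (R' ^ (C + 1)) ^ 2 := by rw [hσ]; field_simp
        _ ≤ R' * R' ^ (C + k) * (R' ^ (C + 1)) ^ 2 := by gcongr; linarith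
        _ = R' ^ (3 * C + k + 3) := by ring
        _ ≤ R ^ (5 * (3 * C + k + 3)) := hpow _
        _ ≤ _ := pow_le_pow_right₀ hR1 (by nlinarith)

lemma shift_sum (f : ℕ → ℂ) (hf : ∀ n, ‖f n‖ ≤ 1) (M s : ℕ) :
    ‖∑ n ∈ Finset.range M, f (n + s) - ∑ n ∈ Finset.range M, f n‖ ≤ 2 * s := by
  have h1 : ∑ n ∈ Finset.range (M + s), f n = ∑ n ∈ Finset.range M, f n + ∑ n ∈ Finset.range s, f (M + n) :=
    Finset.sum_range_add f M s
  have h2 : ∑ n ∈ Finset.range (s + M), f n = ∑ n ∈ Finset.range s, f n + ∑ n ∈ Finset.range M, f (s + n) :=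
    Finset.sum_range_add f s M
  rw [Nat.add_comm s M, h1] at h2
  have h3 : ∑ n ∈ Finset.range M, f (n + s) = ∑ n ∈ Finset.range M, f (s + n) :=
    Finset.sum_congr rfl fun n _ => by rw [Nat.add_comm]
  have h4 : ∑ n ∈ Finset.range M, f (n + s) - ∑ n ∈ Finset.range M, f n =
      ∑ n ∈ Finset.range s, f (M + n) - ∑ n ∈ Finset.range s, f n := by
    rw [h3]; linear_combination -h2
  rw [h4]
  have h5 : ∀ g : ℕ → ℂ, (∀ n, ‖g n‖ ≤ 1) → ‖∑ n ∈ Finset.range s, g n‖ ≤ s := by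
    intro g hg
    refine (norm_sum_le _ _).trans ((Finset.sum_le_sum fun n _ => hg n).trans ?_)
    simp
  refine (norm_sub_le _ _).trans ?_
  linarith [h5 _ hf, h5 (fun n => f (M + n)) (fun n => hf _)]

lemma ap_avg (f : ℕ → ℂ) (hf : ∀ n, ‖f n‖ ≤ 1) (M M' q : ℕ) (δ : ℝ) (hM : 0 < M)
    (hS : δ * M ≤ ‖∑ n ∈ Finset.range M, f n‖) (h : 2 * (q:ℝ) * M' ≤ δ / 2 * M) :
    ∃ n0 < M, δ / 2 * M' ≤ ‖∑ m ∈ Finset.range M', f (n0 + q * m)‖ := by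
  by_contra hcon
  push Not at hcon
  have h1 : ∑ n ∈ Finset.range M, ‖∑ m ∈ Finset.range M', f (n + q * m)‖ < M * (δ / 2 * M') := by
    have := Finset.sum_lt_sum_of_nonempty (s := Finset.range M) ⟨0, Finset.mem_range.2 hM⟩
      (fun n hn => hcon n (Finset.mem_range.1 hn))
    simpa using this
  have h2 : ‖∑ n ∈ Finset.range M, ∑ m ∈ Finset.range M', f (n + q * m)‖ < M * (δ / 2 * M') :=
    (norm_sum_le _ _).trans_lt h1
  rw [Finset.sum_comm] at h2
  set S := ∑ n ∈ Finset.range M, f n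
  have h3 : ‖∑ m ∈ Finset.range M', ∑ n ∈ Finset.range M, f (n + q * m) - ∑ m ∈ Finset.range M', S‖ ≤
      M' * (2 * q * M') := by
    rw [← Finset.sum_sub_distrib]
    refine (norm_sum_le _ _).trans ?_
    have : ∀ m ∈ Finset.range M', ‖∑ n ∈ Finset.range M, f (n + q * m) - S‖ ≤ 2 * q * M' := by
      intro m hm
      refine (shift_sum f hf M (q * m)).trans ?_
      have : (m:ℝ) ≤ M' := by exact_mod_cast (Finset.mem_range.1 hm).le
      push_cast; rw [mul_assoc]; gcongr
    refine (Finset.sum_le_sum this).trans (by simp)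
  rw [Finset.sum_const, Finset.card_range, nsmul_eq_mul] at h3
  have h4 : ‖(M':ℂ) * S‖ = M' * ‖S‖ := by rw [norm_mul, Complex.norm_natCast]
  have h5 := norm_sub_norm_le ((M':ℂ) * S) (∑ m ∈ Finset.range M', ∑ n ∈ Finset.range M, f (n + q * m))
  rw [norm_sub_rev] at h3
  have h6 : (0:ℝ) ≤ M' := Nat.cast_nonneg _
  nlinarith [mul_le_mul_of_nonneg_left hS h6, mul_le_mul_of_nonneg_left h h6]

open Polynomial in
lemma coeff_comp_lin (k : ℕ) (P : ℝ[X]) (hP : P.natDegree ≤ k) (a b : ℝ) (hb : b ≠ 0) (j : ℕ) :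
    P.coeff j = ∑ i ∈ Finset.range (k + 1), (P.comp (C a + C b * X)).coeff i * b⁻¹ ^ i * ((-a) ^ (i - j) * (i.choose j)) := by
  set Q := P.comp (C a + C b * X)
  have hQ : Q.natDegree < k + 1 := by
    have h1 : (C a + C b * X : ℝ[X]).natDegree ≤ 1 := by
      refine (natDegree_add_le _ _).trans (max_le (by simp) ?_)
      exact (natDegree_C_mul_le _ _).trans natDegree_X_le
    have h2 : Q.natDegree ≤ P.natDegree * (C a + C b * X : ℝ[X]).natDegree := natDegree_comp_le
    have : P.natDegree * (C a + C b * X : ℝ[X]).natDegree ≤ k * 1 := Nat.mul_le_mul hP h1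
    omega
  have h1 : P = Q.comp (C b⁻¹ * (X + C (-a))) := by
    have : (C a + C b * X : ℝ[X]).comp (C b⁻¹ * (X + C (-a))) = X := by
      simp only [add_comp, C_comp, mul_comp, X_comp]
      rw [← mul_assoc, ← C_mul, mul_inv_cancel₀ hb]; simp
    rw [comp_assoc, this, comp_X]
  conv_lhs => rw [h1, comp, eval₂_eq_sum_range' _ hQ]
  rw [finsetSum_coeff]
  refine Finset.sum_congr rfl fun i _ => ?_
  rw [mul_pow, ← C_pow, coeff_C_mul, coeff_C_mul, coeff_X_add_C_pow]; ring

lemma pow_succ_sub_le (n : ℕ) (x y B : ℝ) (hy : 0 ≤ y) (hyx : y ≤ x) (hx : x ≤ B) :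
    x ^ (n + 1) - y ^ (n + 1) ≤ (n + 1) * B ^ n * (x - y) := by
  induction n with
  | zero => simp
  | succ n ih =>
    have h0 : 0 ≤ x := hy.trans hyx
    have hB : 0 ≤ B := h0.trans hx
    have e1 : x ^ (n + 1 + 1) - y ^ (n + 1 + 1) = x * (x ^ (n + 1) - y ^ (n + 1)) + y ^ (n + 1) * (x - y) := by ring
    have h1 : 0 ≤ x ^ (n + 1) - y ^ (n + 1) := sub_nonneg.2 (pow_le_pow_left₀ hy hyx _)
    have h2 : y ^ (n + 1) ≤ B ^ (n + 1) := pow_le_pow_left₀ hy (hyx.trans hx) _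
    have h3 : x * (x ^ (n + 1) - y ^ (n + 1)) ≤ B * ((n + 1) * B ^ n * (x - y)) :=
      mul_le_mul hx ih h1 hB
    have h4 : y ^ (n + 1) * (x - y) ≤ B ^ (n + 1) * (x - y) :=
      mul_le_mul_of_nonneg_right h2 (by linarith)
    rw [e1]; push_cast
    have e2 : ((n:ℝ) + 1 + 1) * B ^ (n + 1) * (x - y) = B * ((n + 1) * B ^ n * (x - y)) + B ^ (n + 1) * (x - y) := by ring
    linarith

open Polynomial in
set_option maxHeartbeats 1000000 in
lemma WA (k : ℕ) : ∃ C : ℕ, ∀ (M : ℕ) (R : ℝ) (P : ℝ[X]), 1 ≤ M → 2 ≤ R →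
    P.natDegree ≤ k → (M : ℝ) ≤ ‖∑ n ∈ Finset.range M, e (P.eval (n : ℝ))‖ * R →
    ∃ q : ℕ, 1 ≤ q ∧ (q : ℝ) ≤ R ^ C ∧ ∀ j, 1 ≤ j → j ≤ k →
      torusNorm (q * P.coeff j) * M ^ j ≤ R ^ C := by
  induction k with
  | zero => exact ⟨0, fun M R P _ _ _ _ => ⟨1, le_rfl, by simp, fun j h1 h2 => by omega⟩⟩
  | succ k ih =>
    obtain ⟨C2, hC2⟩ := ih
    obtain ⟨C1, hC1⟩ := WL (k + 1) (by omega)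
    set C3 := 2 * C1 + 2 * k + 8 with hC3
    refine ⟨(C3 + 1) * (k + 1) + C1 * (k + 1) + 3 * C2 + 2 * k + 2, fun M R P hM hR hP h => ?_⟩
    have hR1 : 1 ≤ R := by linarith
    have hMpos : (0:ℝ) < M := by exact_mod_cast hM
    have hM1 : (1:ℝ) ≤ M := by exact_mod_cast hM
    by_cases hbig : (M:ℝ) < R ^ C3
    · refine ⟨1, le_rfl, by rw [Nat.cast_one]; exact one_le_pow₀ hR1, fun j hj1 hj2 => ?_⟩
      calc _ ≤ 1 * (M:ℝ) ^ (k + 1) := by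
            gcongr
            exact (torusNorm_le_half _).trans (by norm_num)
        _ ≤ (R ^ C3) ^ (k + 1) := by rw [one_mul]; gcongr
        _ = R ^ (C3 * (k + 1)) := by rw [pow_mul]
        _ ≤ _ := pow_le_pow_right₀ hR1 (by nlinarith)
    push Not at hbig
    obtain ⟨q1, hq1, hq1R, hq1β⟩ := hC1 M R P hM hR hP h
    set β := P.coeff (k + 1) with hβ
    have hq1pos : (0:ℝ) < q1 := by exact_mod_cast hq1
    have hq11 : (1:ℝ) ≤ q1 := by exact_mod_cast hq1
    set a := round (q1 * β) with ha
    set θ := β - a / q1 with hθ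
    have hθ1 : |θ| * M ^ (k + 1) ≤ R ^ C1 := by
      refine le_trans ?_ hq1β
      gcongr
      have : torusNorm (q1 * β) = q1 * |θ| := by
        unfold torusNorm
        rw [← abs_of_pos hq1pos, ← abs_mul, abs_of_pos hq1pos]
        congr 1; rw [hθ]; field_simp; rw [ha]
      rw [this]; nlinarith [abs_nonneg θ]
    set M' := ⌊(M:ℝ) / R ^ C3⌋₊ with hM'
    have hM'le : (M':ℝ) * R ^ C3 ≤ M := by
      rw [← le_div_iff₀ (by positivity)]; exact Nat.floor_le (by positivity)
    have hM'1 : 1 ≤ M' := Nat.le_floor (by rw [Nat.cast_one, le_div_iff₀ (by positivity)]; linarith)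
    have hM'1r : (1:ℝ) ≤ M' := by exact_mod_cast hM'1
    have hM'ge : (M:ℝ) ≤ 2 * R ^ C3 * M' := by
      have := Nat.lt_floor_add_one ((M:ℝ) / R ^ C3)
      rw [div_lt_iff₀ (by positivity)] at this
      have hp : 0 < R ^ C3 := by positivity
      nlinarith
    have h2pow : ∀ i : ℕ, (2:ℝ) ^ i ≤ R ^ i := fun i => pow_le_pow_left₀ (by norm_num) hR i
    have hq1M' : (q1:ℝ) * M' * R ^ (C1 + 2 * k + 8) ≤ M := by
      calc (q1:ℝ) * M' * R ^ (C1 + 2 * k + 8) ≤ R ^ C1 * M' * R ^ (C1 + 2 * k + 8) := by gcongr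
        _ = M' * R ^ C3 := by rw [hC3]; ring
        _ ≤ M := hM'le
    obtain ⟨n0, hn0, hS'⟩ := ap_avg (fun n => e (P.eval (n:ℝ))) (fun n => (norm_e _).le) M M' q1 R⁻¹ hM
      (by rw [← div_eq_inv_mul, div_le_iff₀ (by linarith)]; exact h)
      (by
        have e1 : 4 * R * (q1 * M') ≤ M := by
          calc 4 * R * (q1 * M') ≤ R ^ 3 * (q1 * M') := by
                gcongr
                nlinarith [h2pow 2]
            _ ≤ R ^ (C1 + 2 * k + 8) * (q1 * M') := by
                gcongr; omega
            _ ≤ M := by linarith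
        have e2 : R⁻¹ / 2 * M = M / (2 * R) := by field_simp
        rw [e2, le_div_iff₀ (by positivity)]
        nlinarith)
    -- remove the top term
    set Pt := P - C β * X ^ (k + 1) with hPt
    have hPtc : ∀ j ≤ k, Pt.coeff j = P.coeff j := by
      intro j hj; rw [hPt, coeff_sub, coeff_C_mul, coeff_X_pow, if_neg (by omega)]; ring
    have hPtd : Pt.natDegree ≤ k := by
      rw [natDegree_le_iff_coeff_eq_zero]
      intro j hj
      rw [hPt, coeff_sub, coeff_C_mul, coeff_X_pow]
      by_cases hjk : j = k + 1
      · rw [if_pos hjk, hjk, hβ]; ring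
      · rw [if_neg hjk, coeff_eq_zero_of_natDegree_lt (by omega)]; ring
    set Q := Pt.comp (C (n0:ℝ) + C (q1:ℝ) * X) with hQ
    have hQd : Q.natDegree ≤ k := by
      have h1 : (C (n0:ℝ) + C (q1:ℝ) * X : ℝ[X]).natDegree ≤ 1 := by
        refine (natDegree_add_le _ _).trans (max_le (by simp) ?_)
        exact (natDegree_C_mul_le _ _).trans natDegree_X_le
      have h2 : Q.natDegree ≤ Pt.natDegree * (C (n0:ℝ) + C (q1:ℝ) * X : ℝ[X]).natDegree := natDegree_comp_le
      have : Pt.natDegree * (C (n0:ℝ) + C (q1:ℝ) * X : ℝ[X]).natDegree ≤ k * 1 := Nat.mul_le_mul hPtd h1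
      omega
    set c0 := e (β * (n0:ℝ) ^ (k + 1)) with hc0
    have hn0M : (n0:ℝ) ≤ M := by exact_mod_cast hn0.le
    have hterm : ∀ m ∈ Finset.range M', ‖e (P.eval ((n0 + q1 * m : ℕ):ℝ)) - c0 * e (Q.eval (m:ℝ))‖ ≤ (4 * R)⁻¹ := by
      intro m hm
      have hmM : (m:ℝ) ≤ M' := by exact_mod_cast (Finset.mem_range.1 hm).le
      set x : ℝ := ((n0 + q1 * m : ℕ):ℝ) with hx
      have hx' : x = n0 + q1 * m := by rw [hx]; push_cast; ring
      have e1 : P.eval x = Q.eval (m:ℝ) + β * x ^ (k + 1) := by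
        rw [hQ, eval_comp, hPt]; simp [hx']
      have e2 : ∃ s : ℤ, β * x ^ (k + 1) = β * (n0:ℝ) ^ (k + 1) + θ * (x ^ (k + 1) - (n0:ℝ) ^ (k + 1)) + s := by
        obtain ⟨s, hs⟩ : (q1:ℤ) ∣ ((n0 + q1 * m : ℕ):ℤ) ^ (k + 1) - (n0:ℤ) ^ (k + 1) := by
          refine dvd_trans ?_ (sub_dvd_pow_sub_pow _ _ _)
          exact ⟨m, by push_cast; ring⟩
        refine ⟨a * s, ?_⟩
        have hs' : x ^ (k + 1) - (n0:ℝ) ^ (k + 1) = q1 * s := by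
          have := congrArg (Int.cast : ℤ → ℝ) hs
          push_cast at this
          rw [hx', this]
        have : β * (x ^ (k + 1) - (n0:ℝ) ^ (k + 1)) = θ * (x ^ (k + 1) - (n0:ℝ) ^ (k + 1)) + a * s := by
          rw [hθ, hs']; field_simp; ring
        push_cast; linear_combination this
      obtain ⟨s, hs⟩ := e2
      have e3 : e (P.eval x) - c0 * e (Q.eval (m:ℝ)) =
          c0 * e (Q.eval (m:ℝ)) * (e (θ * (x ^ (k + 1) - (n0:ℝ) ^ (k + 1))) - 1) := by
        rw [e1, hs, hc0, ← add_assoc, e_add_int, e_add, e_add]; ring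
      rw [e3, norm_mul, norm_mul, hc0, norm_e, norm_e, one_mul, one_mul]
      refine (norm_e_sub_one_le _).trans ?_
      have hxn : (n0:ℝ) ≤ x := by rw [hx']; nlinarith [Nat.cast_nonneg (α := ℝ) m]
      have hqm : (q1:ℝ) * m ≤ q1 * M' := by gcongr
      have hx2 : x ≤ 2 * M := by
        have : (q1:ℝ) * M' ≤ M := by
          refine le_trans ?_ hq1M'
          exact le_mul_of_one_le_right (by positivity) (one_le_pow₀ hR1)
        rw [hx']; linarith
      have e4 := pow_succ_sub_le k x n0 (2 * M) (by positivity) hxn hx2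
      have e4' : 0 ≤ x ^ (k + 1) - (n0:ℝ) ^ (k + 1) := sub_nonneg.2 (pow_le_pow_left₀ (by positivity) hxn _)
      rw [abs_mul, abs_of_nonneg e4', ← one_div, le_div_iff₀ (by positivity)]
      have hk2 : ((k:ℝ) + 1) ≤ R ^ k := by
        have h1 : k < 2 ^ k := Nat.lt_two_pow_self
        calc ((k:ℝ) + 1) ≤ 2 ^ k := by exact_mod_cast h1
          _ ≤ R ^ k := h2pow k
      have h8 : 2 * Real.pi * (4 * R) ≤ R ^ 6 := by
        calc 2 * Real.pi * (4 * R) ≤ 2 ^ 5 * R := by nlinarith [Real.pi_lt_four]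
          _ ≤ R ^ 5 * R := by gcongr
          _ = R ^ 6 := by ring
      have e5 : x - n0 ≤ q1 * M' := by rw [hx']; linarith
      have e6 : |θ| * (x ^ (k + 1) - (n0:ℝ) ^ (k + 1)) * R ^ 6 ≤ 1 := by
        have : |θ| * (x ^ (k + 1) - (n0:ℝ) ^ (k + 1)) * R ^ 6 * (M ^ (k + 1) * R ^ C1) ≤ M ^ (k + 1) * R ^ C1 := by
          calc |θ| * (x ^ (k + 1) - (n0:ℝ) ^ (k + 1)) * R ^ 6 * (M ^ (k + 1) * R ^ C1)
              ≤ |θ| * (R ^ k * (2 * M) ^ k * (q1 * M')) * R ^ 6 * (M ^ (k + 1) * R ^ C1) := by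
                gcongr
                refine e4.trans ?_
                gcongr
            _ = (|θ| * M ^ (k + 1)) * (2 ^ k * R ^ k * M ^ k) * (q1 * M' * R ^ (C1 + 6)) := by
                rw [mul_pow]; ring
            _ ≤ R ^ C1 * (R ^ k * R ^ k * M ^ k) * (q1 * M' * R ^ (C1 + 6)) := by
                gcongr
            _ = R ^ C1 * M ^ k * (q1 * M' * R ^ (C1 + 2 * k + 6)) := by ring
            _ ≤ R ^ C1 * M ^ k * (q1 * M' * R ^ (C1 + 2 * k + 8)) := by
                gcongr; omega
            _ ≤ R ^ C1 * M ^ k * M := by gcongr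
            _ = _ := by ring
        exact le_of_mul_le_mul_right (by linarith) (by positivity : 0 < (M:ℝ) ^ (k + 1) * R ^ C1)
      calc _ = |θ| * (x ^ (k + 1) - (n0:ℝ) ^ (k + 1)) * (2 * Real.pi * (4 * R)) := by ring
        _ ≤ |θ| * (x ^ (k + 1) - (n0:ℝ) ^ (k + 1)) * R ^ 6 := by gcongr
        _ ≤ 1 := e6
    have hQsum : (M':ℝ) ≤ ‖∑ m ∈ Finset.range M', e (Q.eval (m:ℝ))‖ * (4 * R) := by
      have e1 : ‖∑ m ∈ Finset.range M', e (P.eval ((n0 + q1 * m : ℕ):ℝ)) - c0 * ∑ m ∈ Finset.range M', e (Q.eval (m:ℝ))‖ ≤ M' * (4 * R)⁻¹ := by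
        rw [Finset.mul_sum, ← Finset.sum_sub_distrib]
        refine (norm_sum_le _ _).trans ((Finset.sum_le_sum hterm).trans ?_)
        simp
      have e2 := norm_sub_norm_le (∑ m ∈ Finset.range M', e (P.eval ((n0 + q1 * m : ℕ):ℝ))) (c0 * ∑ m ∈ Finset.range M', e (Q.eval (m:ℝ)))
      rw [norm_mul, hc0, norm_e, one_mul] at e2
      have e3 : (M':ℝ) * (4 * R)⁻¹ ≤ ‖∑ m ∈ Finset.range M', e (Q.eval (m:ℝ))‖ := by
        have : R⁻¹ / 2 * (M':ℝ) = 2 * (M' * (4 * R)⁻¹) := by field_simp; norm_num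
        have hS'' : R⁻¹ / 2 * (M':ℝ) ≤ ‖∑ m ∈ Finset.range M', e (P.eval ((n0 + q1 * m : ℕ):ℝ))‖ := hS'
        rw [hc0] at e1
        linarith
      rwa [← div_eq_mul_inv, div_le_iff₀ (by positivity)] at e3
    obtain ⟨q2, hq2, hq2R, hq2c⟩ := hC2 M' (4 * R) Q hM'1 (by linarith) hQd hQsum
    have h4R : (4 * R) ^ C2 ≤ R ^ (3 * C2) := by
      rw [pow_mul]; gcongr
      nlinarith [h2pow 2]
    have hq1k : ∀ i ≤ k + 1, (q1:ℝ) ^ i ≤ R ^ (C1 * (k + 1)) := by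
      intro i hi
      rw [pow_mul]
      exact (pow_le_pow_left₀ hq1pos.le hq1R i).trans (pow_le_pow_right₀ (one_le_pow₀ hR1) hi)
    refine ⟨q2 * q1 ^ (k + 1), Nat.mul_pos hq2 (Nat.pow_pos hq1), ?_, fun j hj1 hj2 => ?_⟩
    · push_cast
      calc (q2:ℝ) * q1 ^ (k + 1) ≤ R ^ (3 * C2) * R ^ (C1 * (k + 1)) := by
            gcongr
            · exact hq2R.trans h4R
            · exact hq1k _ le_rfl
        _ = R ^ (3 * C2 + C1 * (k + 1)) := (pow_add _ _ _).symm
        _ ≤ _ := pow_le_pow_right₀ hR1 (by nlinarith)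
    · rcases Nat.lt_or_ge k j with hjk | hjk
      · have : j = k + 1 := by omega
        subst this
        have e1 : ((q2 * q1 ^ (k + 1) : ℕ):ℝ) * β = ((q2 * q1 ^ k : ℕ):ℝ) * (q1 * β) := by push_cast; ring
        rw [e1]
        calc _ ≤ ((q2 * q1 ^ k : ℕ):ℝ) * torusNorm (q1 * β) * M ^ (k + 1) := by
              gcongr; exact torusNorm_nat_mul_le _ _
          _ = q2 * q1 ^ k * (torusNorm (q1 * β) * M ^ (k + 1)) := by push_cast; ring
          _ ≤ R ^ (3 * C2) * R ^ (C1 * (k + 1)) * R ^ C1 := by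
              gcongr
              · exact mul_nonneg (torusNorm_nonneg _) (by positivity)
              · exact hq2R.trans h4R
              · exact hq1k _ (by omega)
          _ = R ^ (3 * C2 + C1 * (k + 1) + C1) := by rw [pow_add, pow_add]
          _ ≤ _ := pow_le_pow_right₀ hR1 (by rw [hC3]; nlinarith)
      · have e1 := coeff_comp_lin k Pt hPtd n0 q1 hq1pos.ne' j
        rw [hPtc j hjk] at e1
        have e2 : ((q2 * q1 ^ (k + 1) : ℕ):ℝ) * P.coeff j = ∑ i ∈ Finset.range (k + 1),
            (((q1 ^ (k + 1 - i) : ℕ):ℤ) * ((-(n0:ℤ)) ^ (i - j) * (i.choose j : ℤ)) : ℤ) * (q2 * Q.coeff i) := by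
          rw [e1, Finset.mul_sum]
          refine Finset.sum_congr rfl fun i hi => ?_
          rw [Finset.mem_range] at hi
          have : (q1:ℝ) ^ (k + 1) * (q1:ℝ)⁻¹ ^ i = q1 ^ (k + 1 - i) := by
            rw [inv_pow, ← div_eq_mul_inv, div_eq_iff (by positivity), ← pow_add]; congr 1; omega
          push_cast
          rw [← this]; ring
        have e3 : ∀ i ∈ Finset.range (k + 1), torusNorm ((((q1 ^ (k + 1 - i) : ℕ):ℤ) * ((-(n0:ℤ)) ^ (i - j) * (i.choose j : ℤ)) : ℤ) * (q2 * Q.coeff i)) * M ^ j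
            ≤ R ^ (C1 * (k + 1)) * R ^ k * (R ^ ((C3 + 1) * k) * R ^ (3 * C2)) := by
          intro i hi
          rw [Finset.mem_range] at hi
          rcases Nat.lt_or_ge i j with hij | hij
          · rw [Nat.choose_eq_zero_of_lt hij]
            simp [torusNorm]; positivity
          · have f1 := hq2c i (by omega) (by omega)
            have f2 : |((((q1 ^ (k + 1 - i) : ℕ):ℤ) * ((-(n0:ℤ)) ^ (i - j) * (i.choose j : ℤ)) : ℤ):ℝ)| ≤
                R ^ (C1 * (k + 1)) * (M ^ (i - j) * R ^ k) := by
              push_cast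
              rw [abs_mul, abs_mul, abs_pow, abs_pow, abs_neg, Nat.abs_cast, Nat.abs_cast, Nat.abs_cast]
              gcongr
              · exact hq1k _ (by omega)
              · calc ((i.choose j : ℕ):ℝ) ≤ 2 ^ i := by exact_mod_cast Nat.choose_le_two_pow i j
                  _ ≤ 2 ^ k := pow_le_pow_right₀ (by norm_num) (by omega)
                  _ ≤ R ^ k := h2pow k
            have f3 : (M:ℝ) ^ i ≤ R ^ ((C3 + 1) * k) * M' ^ i := by
              calc (M:ℝ) ^ i ≤ (2 * R ^ C3 * M') ^ i := by gcongr
                _ ≤ (R ^ (C3 + 1) * M') ^ i := by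
                    gcongr
                    rw [pow_succ' R C3]; gcongr
                _ = (R ^ (C3 + 1)) ^ i * M' ^ i := mul_pow _ _ _
                _ ≤ (R ^ (C3 + 1)) ^ k * M' ^ i := by
                    gcongr
                    · exact one_le_pow₀ hR1
                    · omega
                _ = _ := by rw [← pow_mul]
            have hnn := torusNorm_nonneg (q2 * Q.coeff i)
            calc _ ≤ |((((q1 ^ (k + 1 - i) : ℕ):ℤ) * ((-(n0:ℤ)) ^ (i - j) * (i.choose j : ℤ)) : ℤ):ℝ)| *
                    torusNorm (q2 * Q.coeff i) * M ^ j := by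
                  gcongr; exact torusNorm_int_mul_le _ _
              _ ≤ R ^ (C1 * (k + 1)) * (M ^ (i - j) * R ^ k) * torusNorm (q2 * Q.coeff i) * M ^ j := by
                  gcongr
              _ = R ^ (C1 * (k + 1)) * R ^ k * (torusNorm (q2 * Q.coeff i) * M ^ i) := by
                  rw [← pow_sub_mul_pow (M:ℝ) hij]; ring
              _ ≤ R ^ (C1 * (k + 1)) * R ^ k * (torusNorm (q2 * Q.coeff i) * (R ^ ((C3 + 1) * k) * M' ^ i)) := by
                  gcongr
              _ = R ^ (C1 * (k + 1)) * R ^ k * (R ^ ((C3 + 1) * k) * (torusNorm (q2 * Q.coeff i) * M' ^ i)) := by ring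
              _ ≤ _ := by gcongr; exact f1.trans h4R
        rw [e2]
        have hk2 : ((k:ℝ) + 1) ≤ R ^ k := by
          have h1 : k < 2 ^ k := Nat.lt_two_pow_self
          calc ((k:ℝ) + 1) ≤ 2 ^ k := by exact_mod_cast h1
            _ ≤ R ^ k := h2pow k
        calc _ ≤ (∑ i ∈ Finset.range (k + 1), torusNorm ((((q1 ^ (k + 1 - i) : ℕ):ℤ) * ((-(n0:ℤ)) ^ (i - j) * (i.choose j : ℤ)) : ℤ) * (q2 * Q.coeff i))) * M ^ j := by
              gcongr; exact torusNorm_sum_le _ _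
          _ ≤ ((k + 1 : ℕ):ℝ) * (R ^ (C1 * (k + 1)) * R ^ k * (R ^ ((C3 + 1) * k) * R ^ (3 * C2))) := by
              rw [Finset.sum_mul]
              refine (Finset.sum_le_sum e3).trans ?_
              rw [Finset.sum_const, Finset.card_range, nsmul_eq_mul]
          _ ≤ R ^ k * (R ^ (C1 * (k + 1)) * R ^ k * (R ^ ((C3 + 1) * k) * R ^ (3 * C2))) := by
              gcongr; push_cast; exact hk2
          _ = R ^ (k + (C1 * (k + 1) + k + ((C3 + 1) * k + 3 * C2))) := by simp only [pow_add]
          _ ≤ _ := pow_le_pow_right₀ hR1 (by nlinarith)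

lemma dvd_of_torusNorm_lt (x c : ℤ) (hc : 0 < c) (h : torusNorm ((x:ℝ) / c) * c < 1) : c ∣ x := by
  have hc' : (0:ℝ) < c := by exact_mod_cast hc
  set n := round ((x:ℝ) / c) with hn
  have h1 : |((x - c * n : ℤ):ℝ)| < 1 := by
    have : torusNorm ((x:ℝ) / c) * c = |((x - c * n : ℤ):ℝ)| := by
      unfold torusNorm
      rw [← abs_of_pos hc', ← abs_mul, abs_of_pos hc', ← hn]
      congr 1; push_cast; field_simp
    rwa [this] at h
  have h2 : |x - c * n| < 1 := by exact_mod_cast h1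
  have h3 : x - c * n = 0 := Int.abs_lt_one_iff.1 h2
  exact ⟨n, by linarith⟩

open Polynomial in
lemma WI (k : ℕ) (hk : 1 ≤ k) : ∃ C : ℕ, ∀ (M : ℕ) (R : ℝ) (H : ℤ[X]) (K : ℕ) (γ : ℝ), 1 ≤ M → 2 ≤ R →
    H.natDegree = k → 0 < H.coeff k → 0 < K →
    (∀ b : ℤ, (∀ j, 1 ≤ j → j ≤ k → H.coeff k ∣ H.coeff j * b) → H.coeff k ∣ K * b) →
    (∀ j, 1 ≤ j → j ≤ k → R ^ C * (H.coeff k + |H.coeff j| : ℤ) < M) →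
    (M : ℝ) ≤ ‖∑ n ∈ Finset.range M, e (γ * (H.eval (n : ℤ) : ℤ))‖ * R →
    ∃ (q : ℕ) (a : ℤ), 1 ≤ q ∧ (q : ℝ) ≤ K * R ^ C ∧ |γ - a / q| * (H.coeff k * M ^ k) ≤ R ^ C := by
  obtain ⟨C, hC⟩ := WA k
  refine ⟨C, fun M R H K γ hM hR hdeg hpos hK hcont hsize hsum => ?_⟩
  set P : ℝ[X] := Polynomial.C γ * H.map (Int.castRingHom ℝ) with hP
  have hcoef : ∀ j, P.coeff j = γ * H.coeff j := by intro j; simp [hP]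
  have hev : ∀ n : ℕ, P.eval (n:ℝ) = γ * (H.eval (n : ℤ) : ℤ) := by
    intro n
    rw [hP, eval_mul, eval_C]
    congr 1
    have := Polynomial.eval_intCast_map (Int.castRingHom ℝ) H (n:ℤ)
    simpa using this
  have hPd : P.natDegree ≤ k := by
    refine (natDegree_C_mul_le _ _).trans (natDegree_map_le.trans hdeg.le)
  obtain ⟨q, hq, hqR, hqc⟩ := hC M R P hM hR hPd (by simp_rw [hev]; exact hsum)
  set c := H.coeff k with hc
  have hcpos : (0:ℝ) < c := by exact_mod_cast hpos
  have hMpos : (0:ℝ) < M := by exact_mod_cast hM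
  have hM1 : (1:ℝ) ≤ M := by exact_mod_cast hM
  have hqpos : (0:ℝ) < q := by exact_mod_cast hq
  have hKpos : (0:ℝ) < K := by exact_mod_cast hK
  have htop := hqc k hk le_rfl
  rw [hcoef] at htop
  set b := round ((q:ℝ) * (γ * c)) with hb
  set δ := (q:ℝ) * (γ * c) - b with hδ
  have htop' : |δ| * M ^ k ≤ R ^ C := htop
  have hdvd : c ∣ K * b := by
    refine hcont b fun j hj1 hj2 => ?_
    rcases Nat.lt_or_ge j k with hjk | hjk
    · have h1 := hqc j hj1 hj2
      rw [hcoef] at h1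
      have h2 : ((H.coeff j * b : ℤ):ℝ) / c = q * (γ * H.coeff j) - δ * H.coeff j / c := by
        rw [hδ]; push_cast; field_simp; ring
      refine dvd_of_torusNorm_lt _ _ hpos ?_
      rw [h2]
      have h3 : torusNorm (q * (γ * H.coeff j)) * M ≤ R ^ C := by
        refine le_trans ?_ h1
        gcongr
        · exact torusNorm_nonneg _
        · exact le_self_pow₀ hM1 (by omega)
      have h4 : |δ| * M ≤ R ^ C := by
        refine le_trans ?_ htop'
        gcongr
        exact le_self_pow₀ hM1 (by omega)
      have h5 : torusNorm (δ * H.coeff j / c) * c ≤ |δ| * |(H.coeff j:ℝ)| := by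
        have := torusNorm_le_abs_sub (δ * H.coeff j / c) 0
        rw [Int.cast_zero, sub_zero, abs_div, abs_mul, abs_of_pos hcpos, le_div_iff₀ hcpos] at this
        exact this
      have h6 := torusNorm_sub_le (q * (γ * H.coeff j)) (δ * H.coeff j / c)
      have h7 := hsize j hj1 hj2
      push_cast at h7
      have h8 : torusNorm (q * (γ * H.coeff j) - δ * H.coeff j / c) * c * M < 1 * M := by
        calc _ ≤ (torusNorm (q * (γ * H.coeff j)) + torusNorm (δ * H.coeff j / c)) * c * M := by gcongr
          _ = torusNorm (q * (γ * H.coeff j)) * M * c + torusNorm (δ * H.coeff j / c) * c * M := by ring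
          _ ≤ R ^ C * c + |δ| * |(H.coeff j:ℝ)| * M := by gcongr
          _ = R ^ C * c + |δ| * M * |(H.coeff j:ℝ)| := by ring
          _ ≤ R ^ C * c + R ^ C * |(H.coeff j:ℝ)| := by gcongr
          _ < 1 * M := by linarith
      exact lt_of_mul_lt_mul_right h8 hMpos.le
    · have : j = k := by omega
      rw [this]; exact Dvd.intro _ rfl
  obtain ⟨a, ha⟩ := hdvd
  refine ⟨K * q, a, Nat.mul_pos hK hq, by push_cast; gcongr, ?_⟩
  have hKb : (K:ℝ) * b = c * a := by exact_mod_cast ha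
  have h1 : γ - a / ((K * q : ℕ):ℝ) = δ / (q * c) := by
    push_cast
    have : (a:ℝ) = K * b / c := by field_simp; linarith
    rw [this, hδ]; field_simp
  rw [h1, abs_div, abs_of_pos (by positivity : 0 < (q:ℝ) * c)]
  calc |δ| / (q * c) * (c * M ^ k) = |δ| * M ^ k / q := by field_simp
    _ ≤ |δ| * M ^ k / 1 := by gcongr; exact_mod_cast hq
    _ ≤ _ := by rw [div_one]; exact htop'

section
open Polynomial

structure Sys (k : ℕ) where
  hk : 0 < k
  h : Polynomial ℤ
  hdeg : h.natDegree = k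
  hlead : 0 < h.leadingCoeff
  z : ∀ (p : ℕ) [Fact p.Prime], ℤ_[p]
  hz : ∀ (p : ℕ) [Fact p.Prime], Polynomial.aeval (z p) h = 0
  lam : ℕ → ℕ
  hlam1 : lam 1 = 1
  hlamMul : ∀ a b : ℕ, lam (a * b) = lam a * lam b
  hlamP : ∀ (p : ℕ) [Fact p.Prime],
      lam p = p ^ Polynomial.rootMultiplicity (z p) (h.map (algebraMap ℤ ℤ_[p]))
  r : ℕ → ℤ
  hr : ∀ d : ℕ, 0 < d → -(d : ℤ) < r d ∧ r d ≤ 0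
  hrz : ∀ d : ℕ, 0 < d → ∀ (p : ℕ) [Fact p.Prime], ∀ α : ℕ, p ^ α ∣ d →
      (p : ℤ_[p]) ^ α ∣ (z p - (r d : ℤ_[p]))
  H : ℕ → Polynomial ℤ
  hH : ∀ d : ℕ, 0 < d →
      Polynomial.C (lam d : ℤ) * H d =
        h.comp (Polynomial.C (r d) + Polynomial.C (d : ℤ) * Polynomial.X)

namespace Sys
variable {k : ℕ} (S : Sys k)

lemma h_ne : S.h ≠ 0 := by
  intro h0; have := S.hlead; rw [h0] at this; simp at this

lemma hmap_ne (p : ℕ) [Fact p.Prime] : S.h.map (algebraMap ℤ ℤ_[p]) ≠ 0 := by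
  rw [Polynomial.map_ne_zero_iff (by
    rw [algebraMap_int_eq]; exact Int.cast_injective)]
  exact S.h_ne

noncomputable def m (p : ℕ) [Fact p.Prime] : ℕ :=
  Polynomial.rootMultiplicity (S.z p) (S.h.map (algebraMap ℤ ℤ_[p]))

lemma m_pos (p : ℕ) [Fact p.Prime] : 1 ≤ S.m p := by
  have : 0 < S.m p := by
    rw [m, Polynomial.rootMultiplicity_pos (S.hmap_ne p), Polynomial.IsRoot.def, Polynomial.eval_map_algebraMap]
    exact S.hz p
  exact this

lemma m_le (p : ℕ) [Fact p.Prime] : S.m p ≤ k := by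
  classical
  have h2 : S.m p ≤ (S.h.map (algebraMap ℤ ℤ_[p])).natDegree := by
    have := Polynomial.count_roots (S.h.map (algebraMap ℤ ℤ_[p])) (a := S.z p)
    rw [m, ← this]
    exact (Multiset.count_le_card _ _).trans (Polynomial.card_roots' _)
  exact h2.trans (natDegree_map_le.trans S.hdeg.le)

lemma lam_prime (p : ℕ) [Fact p.Prime] : S.lam p = p ^ S.m p := S.hlamP p

lemma lam_pow (a n : ℕ) : S.lam (a ^ n) = S.lam a ^ n := by
  induction n with
  | zero => simp [S.hlam1]
  | succ n ih => rw [pow_succ, S.hlamMul, ih, pow_succ]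

lemma lam_prod {ι : Type*} (s : Finset ι) (f : ι → ℕ) : S.lam (∏ i ∈ s, f i) = ∏ i ∈ s, S.lam (f i) := by
  classical
  induction s using Finset.induction_on with
  | empty => simp [S.hlam1]
  | insert a s ha ih => rw [Finset.prod_insert ha, Finset.prod_insert ha, S.hlamMul, ih]

lemma lam_facts (n : ℕ) : 0 < n → n ∣ S.lam n ∧ 0 < S.lam n ∧ S.lam n ≤ n ^ k := by
  induction n using Nat.recOnMul with
  | zero => intro h; omega
  | one => intro _; rw [S.hlam1]; simp
  | prime p hp =>
    intro _
    have := Fact.mk hp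
    rw [S.lam_prime]
    exact ⟨dvd_pow_self _ (by have := S.m_pos p; omega), Nat.pow_pos hp.pos, Nat.pow_le_pow_right hp.pos (S.m_le p)⟩
  | mul a b ha hb =>
    intro hab
    have h1 : 0 < a := Nat.pos_of_mul_pos_right hab
    have h2 : 0 < b := Nat.pos_of_mul_pos_left hab
    obtain ⟨a1, a2, a3⟩ := ha h1
    obtain ⟨b1, b2, b3⟩ := hb h2
    rw [S.hlamMul, mul_pow]
    exact ⟨mul_dvd_mul a1 b1, Nat.mul_pos a2 b2, Nat.mul_le_mul a3 b3⟩

lemma lin_natDegree (d : ℕ) (hd : 0 < d) :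
    (Polynomial.C (S.r d) + Polynomial.C (d : ℤ) * Polynomial.X).natDegree = 1 := by
  rw [add_comm]; exact natDegree_linear (by exact_mod_cast hd.ne')

lemma H_natDegree (d : ℕ) (hd : 0 < d) : (S.H d).natDegree = k := by
  have h1 := congrArg Polynomial.natDegree (S.hH d hd)
  rw [natDegree_comp, S.lin_natDegree d hd, mul_one, S.hdeg] at h1
  rw [natDegree_C_mul] at h1
  · exact h1
  exact_mod_cast (S.lam_facts d hd).2.1.ne'

lemma H_coeff_k (d : ℕ) (hd : 0 < d) : (S.lam d : ℤ) * (S.H d).coeff k = S.h.leadingCoeff * d ^ k := by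
  have h1 := congrArg Polynomial.leadingCoeff (S.hH d hd)
  rw [leadingCoeff_comp (by rw [S.lin_natDegree d hd]; norm_num), leadingCoeff_mul, leadingCoeff_C] at h1
  rw [leadingCoeff, S.H_natDegree d hd, S.hdeg] at h1
  rw [h1]
  congr 2
  rw [leadingCoeff, S.lin_natDegree d hd, coeff_add, coeff_C_of_ne_zero one_ne_zero, coeff_C_mul, coeff_X_one]; simp

lemma H_coeff_k_pos (d : ℕ) (hd : 0 < d) : 0 < (S.H d).coeff k := by
  have h1 := S.H_coeff_k d hd
  have h2 : 0 < S.h.leadingCoeff * (d:ℤ) ^ k := mul_pos S.hlead (by positivity)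
  rw [← h1] at h2
  exact pos_of_mul_pos_right h2 (by positivity)

noncomputable def Ch : ℤ := ∑ i ∈ Finset.range (k + 1), |S.h.coeff i|

lemma lead_le_Ch : S.h.leadingCoeff ≤ S.Ch := by
  rw [leadingCoeff, S.hdeg]
  refine (le_abs_self _).trans ?_
  exact Finset.single_le_sum (f := fun i => |S.h.coeff i|) (fun i _ => abs_nonneg _) (Finset.mem_range.2 (by omega))

lemma h_eval_le (x : ℤ) (hx : 1 ≤ x) : |S.h.eval x| ≤ S.Ch * x ^ k := by
  rw [eval_eq_sum_range' (n := k + 1) (by rw [S.hdeg]; omega), Ch, Finset.sum_mul]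
  refine (Finset.abs_sum_le_sum_abs _ _).trans (Finset.sum_le_sum fun i hi => ?_)
  rw [abs_mul, abs_of_nonneg (by positivity : 0 ≤ x ^ i)]
  exact mul_le_mul_of_nonneg_left (pow_le_pow_right₀ hx (by rw [Finset.mem_range] at hi; omega)) (abs_nonneg _)

lemma H_eval (d : ℕ) (hd : 0 < d) (n : ℤ) : (S.lam d : ℤ) * (S.H d).eval n = S.h.eval (S.r d + d * n) := by
  have := congrArg (Polynomial.eval n) (S.hH d hd)
  simpa [eval_comp] using this

lemma H_eval_le (d : ℕ) (hd : 0 < d) (n : ℕ) (hn : 0 < n) : |(S.H d).eval (n:ℤ)| ≤ S.Ch * (S.H d).coeff k * n ^ k := by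
  obtain ⟨r1, r2⟩ := S.hr d hd
  have hlam : (0:ℤ) < S.lam d := by exact_mod_cast (S.lam_facts d hd).2.1
  have hd' : (0:ℤ) < d := by exact_mod_cast hd
  have hn' : (1:ℤ) ≤ n := by exact_mod_cast hn
  have h1 : 1 ≤ S.r d + d * n := by nlinarith
  have h2 := S.h_eval_le _ h1
  rw [← S.H_eval d hd, abs_mul, abs_of_pos hlam] at h2
  have h3 : (S.r d + d * (n:ℤ)) ^ k ≤ (d * n) ^ k := pow_le_pow_left₀ (by linarith) (by linarith) _
  have hCh : 0 ≤ S.Ch := Finset.sum_nonneg fun i _ => abs_nonneg _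
  have h4 : (d:ℤ) ^ k ≤ S.lam d * (S.H d).coeff k := by
    rw [S.H_coeff_k d hd]
    exact le_mul_of_one_le_left (by positivity) S.hlead
  refine le_of_mul_le_mul_left ?_ hlam
  calc _ ≤ _ := h2
    _ ≤ S.Ch * (d * n) ^ k := by gcongr
    _ = S.Ch * n ^ k * d ^ k := by rw [mul_pow]; ring
    _ ≤ S.Ch * n ^ k * (S.lam d * (S.H d).coeff k) := by gcongr
    _ = _ := by ring

lemma H_coeff_le (d : ℕ) (hd : 0 < d) (j : ℕ) : |(S.H d).coeff j| ≤ S.Ch * 2 ^ k * d ^ k := by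
  obtain ⟨r1, r2⟩ := S.hr d hd
  have hlam : (1:ℤ) ≤ S.lam d := by exact_mod_cast (S.lam_facts d hd).2.1
  have h1 := congrArg (fun P => Polynomial.coeff P j) (S.hH d hd)
  simp only [coeff_C_mul] at h1
  have h2 : |(S.H d).coeff j| ≤ |(S.lam d : ℤ) * (S.H d).coeff j| := by
    rw [abs_mul, abs_of_pos (by linarith : (0:ℤ) < S.lam d)]
    exact le_mul_of_one_le_left (abs_nonneg _) hlam
  refine h2.trans ?_
  rw [h1, comp, eval₂_eq_sum_range' _ (n := k + 1) (by rw [S.hdeg]; omega), finsetSum_coeff, Ch,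
    Finset.sum_mul, Finset.sum_mul]
  refine (Finset.abs_sum_le_sum_abs _ _).trans (Finset.sum_le_sum fun i hi => ?_)
  rw [Finset.mem_range] at hi
  have h3 : ((Polynomial.C (S.r d) + Polynomial.C (d : ℤ) * Polynomial.X) ^ i).coeff j =
      S.r d ^ (i - j) * i.choose j * d ^ j := by
    have e1 : (Polynomial.C (S.r d) + Polynomial.C (d : ℤ) * Polynomial.X : ℤ[X]) ^ i =
        ((X + Polynomial.C (S.r d)) ^ i).comp (Polynomial.C (d:ℤ) * X) := by simp [add_comm]
    rw [e1, comp_C_mul_X_coeff, coeff_X_add_C_pow]; try ring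
  rw [coeff_C_mul, h3, abs_mul, mul_assoc |S.h.coeff i|]
  refine mul_le_mul_of_nonneg_left ?_ (abs_nonneg _)
  rcases Nat.lt_or_ge i j with hij | hij
  · rw [Nat.choose_eq_zero_of_lt hij]; simp
  rw [abs_mul, abs_mul, abs_pow, abs_pow, Nat.abs_cast, Nat.abs_cast]
  have h4 : |S.r d| ≤ d := abs_le.2 ⟨by linarith, by linarith [Int.natCast_nonneg d]⟩
  have hd1 : (1:ℤ) ≤ d := by exact_mod_cast hd
  calc |S.r d| ^ (i - j) * (i.choose j : ℤ) * (d:ℤ) ^ j ≤ (d:ℤ) ^ (i - j) * 2 ^ k * d ^ j := by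
        gcongr
        calc ((i.choose j : ℕ):ℤ) ≤ 2 ^ i := by exact_mod_cast Nat.choose_le_two_pow i j
          _ ≤ 2 ^ k := pow_le_pow_right₀ (by norm_num) (by omega)
    _ = 2 ^ k * d ^ i := by rw [← pow_sub_mul_pow (d:ℤ) hij]; ring
    _ ≤ 2 ^ k * d ^ k := by gcongr; omega

lemma int_dvd_of_padic (c x : ℤ) (h : ∀ (p : ℕ) [Fact p.Prime] (v : ℕ), ((p:ℤ) ^ v) ∣ c → (p : ℤ_[p]) ^ v ∣ (x : ℤ_[p])) :
    c ∣ x := by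
  rw [← Int.natAbs_dvd_natAbs, Nat.dvd_iff_prime_pow_dvd_dvd]
  intro p v hp hv
  have := Fact.mk hp
  have h1 : ((p:ℤ) ^ v) ∣ c := by
    rw [← Int.natAbs_dvd_natAbs, Int.natAbs_pow, Int.natAbs_natCast]; exact hv
  have h2 := h p v h1
  rw [← Ideal.mem_span_singleton, ← PadicInt.norm_le_pow_iff_mem_span_pow, PadicInt.norm_int_le_pow_iff_dvd] at h2
  rw [← Int.natAbs_dvd_natAbs] at h2
  simpa [Int.natAbs_pow] using h2

lemma r_dvd (d q : ℕ) (hd : 0 < d) (hq : 0 < q) : (d:ℤ) ∣ S.r (q * d) - S.r d := by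
  refine int_dvd_of_padic _ _ fun p _ v hv => ?_
  have hv' : p ^ v ∣ d := by exact_mod_cast hv
  have h1 := S.hrz d hd p v hv'
  have h2 := S.hrz (q * d) (Nat.mul_pos hq hd) p v (hv'.mul_left q)
  have := dvd_sub h1 h2
  push_cast
  simpa using this

lemma H_sub (d q : ℕ) (hd : 0 < d) (hq : 0 < q) (n : ℕ) (hn : 0 < n) :
    ∃ n' : ℕ, 0 < n' ∧ (S.lam q : ℤ) * (S.H (q * d)).eval (n:ℤ) = (S.H d).eval (n':ℤ) := by
  obtain ⟨s, hs⟩ := S.r_dvd d q hd hq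
  have hqd : 0 < q * d := Nat.mul_pos hq hd
  obtain ⟨r1, r2⟩ := S.hr (q * d) hqd
  obtain ⟨r3, r4⟩ := S.hr d hd
  push_cast at r1
  have hd' : (0:ℤ) < d := by exact_mod_cast hd
  have hq' : (0:ℤ) < q := by exact_mod_cast hq
  have hn' : (1:ℤ) ≤ n := by exact_mod_cast hn
  have h1 : (d:ℤ) * (s + q * n) = S.r (q * d) - S.r d + q * d * n := by rw [hs]; ring
  have h2 : 0 < s + q * n := by
    have : 0 < (d:ℤ) * (s + q * n) := by
      rw [h1]
      have : (q:ℤ) * d * 1 ≤ q * d * n := by gcongr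
      linarith
    exact pos_of_mul_pos_right this hd'.le
  obtain ⟨n', hn'eq⟩ := Int.eq_ofNat_of_zero_le h2.le
  refine ⟨n', by omega, ?_⟩
  have hlam : (S.lam d : ℤ) ≠ 0 := by exact_mod_cast (S.lam_facts d hd).2.1.ne'
  refine mul_left_cancel₀ hlam ?_
  have e1 := S.H_eval (q * d) hqd n
  have e2 := S.H_eval d hd n'
  rw [e2, ← mul_assoc, ← Nat.cast_mul, ← S.hlamMul, Nat.mul_comm d q, e1]
  congr 1
  rw [← hn'eq]; push_cast; linarith
end Sys
end

section
open Polynomial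
namespace Sys
variable {k : ℕ} (S : Sys k)

lemma exists_R (f : ℚ[X]) (T : ℤ[X]) : ∃ R : ℕ, 0 < R ∧ (IsCoprime f (T.map (Int.castRingHom ℚ)) →
    ∀ (p : ℕ) [Fact p.Prime] (z : ℤ_[p]), aeval (z : ℚ_[p]) f = 0 → aeval z T ∣ (R : ℤ_[p])) := by
  by_cases hc : IsCoprime f (T.map (Int.castRingHom ℚ))
  swap
  · exact ⟨1, one_pos, fun h => absurd h hc⟩
  obtain ⟨u, v, huv⟩ := hc
  obtain ⟨b, hb⟩ := IsLocalization.integerNormalization_map_to_map (nonZeroDivisors ℤ) v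
  set V := IsLocalization.integerNormalization (nonZeroDivisors ℤ) v with hV
  have hb0 : (b : ℤ) ≠ 0 := nonZeroDivisors.coe_ne_zero b
  refine ⟨(b:ℤ).natAbs, Int.natAbs_pos.2 hb0, fun _ p _ z hz => ?_⟩
  have h1 : aeval z V * aeval z T = ((b:ℤ) : ℤ_[p]) := by
    have hcoe : ∀ P : ℤ[X], ((aeval z P : ℤ_[p]) : ℚ_[p]) = aeval (z:ℚ_[p]) (P.map (Int.castRingHom ℚ)) := by
      intro P
      have e1 : aeval (z:ℚ_[p]) (P.map (Int.castRingHom ℚ)) = aeval (z:ℚ_[p]) P := by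
        rw [← algebraMap_int_eq, aeval_map_algebraMap]
      rw [e1]
      exact (aeval_algebraMap_apply ℚ_[p] z P).symm
    have h2 : (((aeval z V * aeval z T : ℤ_[p])) : ℚ_[p]) = ((b:ℤ) : ℚ_[p]) := by
      rw [PadicInt.coe_mul, hcoe, hcoe]
      have hb' : V.map (Int.castRingHom ℚ) = (b:ℤ) • v := hb
      rw [hb', map_zsmul]
      have h3 := congrArg (aeval (z:ℚ_[p])) huv
      rw [map_add, map_mul, hz, mul_zero, zero_add, map_mul, map_one] at h3
      rw [zsmul_eq_mul, mul_assoc, h3, mul_one]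
    have : ((((b:ℤ) : ℤ_[p])) : ℚ_[p]) = ((b:ℤ) : ℚ_[p]) := PadicInt.coe_intCast _
    rw [← this] at h2
    exact Subtype.coe_injective h2
  have h2 : aeval z T ∣ ((b:ℤ) : ℤ_[p]) := ⟨_, by rw [← h1]; ring⟩
  refine h2.trans ?_
  rcases Int.natAbs_eq (b:ℤ) with hh | hh
  · rw [hh]; simp
  · rw [hh]; simp

/-- the `m`-th Taylor coefficient at the root -/
lemma taylor_ne (p : ℕ) [Fact p.Prime] : aeval (S.z p) (hasseDeriv (S.m p) S.h) ≠ 0 ∧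
    (taylor (S.z p) (S.h.map (algebraMap ℤ ℤ_[p]))).coeff (S.m p) = aeval (S.z p) (hasseDeriv (S.m p) S.h) := by
  have h2 : (taylor (S.z p) (S.h.map (algebraMap ℤ ℤ_[p]))).coeff (S.m p) = aeval (S.z p) (hasseDeriv (S.m p) S.h) := by
    rw [taylor_coeff, ← eval_map_algebraMap]
    congr 1
    ext i; simp [hasseDeriv_coeff]
  refine ⟨?_, h2⟩
  rw [← h2]
  obtain ⟨q, hq1, hq2⟩ := Polynomial.exists_eq_pow_rootMultiplicity_mul_and_not_dvd _ (S.hmap_ne p) (S.z p)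
  rw [hq1]
  rw [taylor_mul, taylor_pow]
  have : taylor (S.z p) (X - C (S.z p)) = X := by simp
  rw [this, mul_comm]
  change (taylor (S.z p) q * X ^ (S.m p)).coeff (S.m p) ≠ 0
  have := coeff_mul_X_pow (taylor (S.z p) q) (S.m p) 0
  rw [zero_add] at this
  rw [this, taylor_coeff_zero]
  intro h0
  exact hq2 (dvd_iff_isRoot.2 h0)

lemma exists_K : ∃ K : ℕ, 0 < K ∧ ∀ (p : ℕ) [Fact p.Prime], aeval (S.z p) (hasseDeriv (S.m p) S.h) ∣ (K : ℤ_[p]) := by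
  classical
  set hQ := S.h.map (Int.castRingHom ℚ) with hhQ
  have hQ0 : hQ ≠ 0 := (Polynomial.map_ne_zero_iff Int.cast_injective).2 S.h_ne
  choose R hR1 hR2 using fun (f : ℚ[X]) (i : ℕ) => exists_R f (hasseDeriv i S.h)
  refine ⟨∏ f ∈ (UniqueFactorizationMonoid.normalizedFactors hQ).toFinset, ∏ i ∈ Finset.range (k + 1), R f i,
    Finset.prod_pos fun f _ => Finset.prod_pos fun i _ => hR1 f i, fun p _ => ?_⟩
  obtain ⟨hne, -⟩ := S.taylor_ne p
  set z := S.z p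
  have hcoe : ∀ P : ℤ[X], aeval (z:ℚ_[p]) (P.map (Int.castRingHom ℚ)) = ((aeval z P : ℤ_[p]) : ℚ_[p]) := by
    intro P
    have e1 : aeval (z:ℚ_[p]) (P.map (Int.castRingHom ℚ)) = aeval (z:ℚ_[p]) P := by
      rw [← algebraMap_int_eq, aeval_map_algebraMap]
    rw [e1]
    exact aeval_algebraMap_apply ℚ_[p] z P
  have hroot : aeval (z:ℚ_[p]) hQ = 0 := by rw [hcoe, S.hz p]; rfl
  obtain ⟨f, hf, hfz⟩ : ∃ f ∈ UniqueFactorizationMonoid.normalizedFactors hQ, aeval (z:ℚ_[p]) f = 0 := by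
    have h1 := UniqueFactorizationMonoid.prod_normalizedFactors hQ0
    obtain ⟨w, hw⟩ := h1
    rw [← hw, map_mul, mul_eq_zero] at hroot
    rcases hroot with h0 | h0
    · rw [map_multiset_prod, Multiset.prod_eq_zero_iff, Multiset.mem_map] at h0
      exact h0
    · exact absurd h0 (w.isUnit.map (aeval (z:ℚ_[p]))).ne_zero
  have hirr := UniqueFactorizationMonoid.irreducible_of_normalized_factor f hf
  have hcop : IsCoprime f ((hasseDeriv (S.m p) S.h).map (Int.castRingHom ℚ)) := by
    rw [hirr.coprime_iff_not_dvd]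
    rintro ⟨g, hg⟩
    have := congrArg (aeval (z:ℚ_[p])) hg
    rw [map_mul, hfz, zero_mul, hcoe] at this
    exact hne (Subtype.coe_injective this)
  have h1 := hR2 f (S.m p) hcop p z hfz
  refine h1.trans ?_
  have h2 : R f (S.m p) ∣ ∏ f ∈ (UniqueFactorizationMonoid.normalizedFactors hQ).toFinset, ∏ i ∈ Finset.range (k + 1), R f i :=
    (Finset.dvd_prod_of_mem (fun i => R f i) (Finset.mem_range.2 (by have := S.m_le p; omega))).trans
      (Finset.dvd_prod_of_mem (fun f => ∏ i ∈ Finset.range (k + 1), R f i) (Multiset.mem_toFinset.2 hf))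
  exact_mod_cast Nat.cast_dvd_cast (α := ℤ_[p]) h2

lemma content : ∃ K : ℕ, 0 < K ∧ ∀ d : ℕ, 0 < d → ∀ b : ℤ,
    (∀ j, 1 ≤ j → j ≤ k → (S.H d).coeff k ∣ (S.H d).coeff j * b) → (S.H d).coeff k ∣ K * b := by
  obtain ⟨K, hK, hKp⟩ := S.exists_K
  refine ⟨K, hK, fun d hd b hb => ?_⟩
  set c := (S.H d).coeff k with hc
  refine int_dvd_of_padic _ _ fun p _ v hv => ?_
  have hv' : (p:ℤ_[p]) ^ v ∣ (c:ℤ_[p]) := by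
    obtain ⟨y, hy⟩ := hv; exact ⟨y, by rw [hy]; push_cast; ring⟩
  refine hv'.trans ?_
  obtain ⟨t, d', hd'p, hdd⟩ := Nat.exists_eq_pow_mul_and_not_dvd hd.ne' p (Fact.out : p.Prime).ne_one
  obtain ⟨s, hs⟩ := S.hrz d hd p t ⟨d', hdd⟩
  have hunit : IsUnit (d':ℤ_[p]) := by
    rw [PadicInt.isUnit_iff]
    have := (PadicInt.norm_natCast_eq_one_iff (p := p) (n := d')).2
      (((Fact.out : p.Prime).coprime_iff_not_dvd).2 hd'p)
    exact this
  obtain ⟨u, hu⟩ := hunit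
  set F := (S.H d).map (algebraMap ℤ ℤ_[p]) with hF
  set L : ℤ_[p][X] := C (u⁻¹ : (ℤ_[p])ˣ).val * (X + C s) with hL
  set mm := S.m p with hmm
  -- the key identity
  have hlamd : (S.lam d : ℤ_[p]) = (p:ℤ_[p]) ^ (t * mm) * (S.lam d' : ℤ_[p]) := by
    rw [hdd, S.hlamMul, S.lam_pow, S.lam_prime]; push_cast; rw [← pow_mul, Nat.mul_comm]
  have hid : C (S.lam d : ℤ_[p]) * F.comp L = (taylor (S.z p) (S.h.map (algebraMap ℤ ℤ_[p]))).comp (C ((p:ℤ_[p]) ^ t) * X) := by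
    have e1 := congrArg (fun P => (Polynomial.map (algebraMap ℤ ℤ_[p]) P).comp L) (S.hH d hd)
    simp only [Polynomial.map_mul, Polynomial.map_comp, mul_comp, Polynomial.map_add, map_C, map_X, C_comp, comp_assoc, add_comp, X_comp] at e1
    rw [taylor_apply, comp_assoc]
    have e2 : (C ((algebraMap ℤ ℤ_[p]) (S.r d)) + C ((algebraMap ℤ ℤ_[p]) (d:ℤ)) * L : ℤ_[p][X]) =
        (X + C (S.z p)).comp (C ((p:ℤ_[p]) ^ t) * X) := by
      have h1 : (S.z p) = (p:ℤ_[p]) ^ t * s + (S.r d : ℤ_[p]) := by rw [← hs]; ring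
      have h2 : (d:ℤ_[p]) * (u⁻¹ : (ℤ_[p])ˣ).val = (p:ℤ_[p]) ^ t := by
        rw [hdd]; push_cast; rw [← hu, mul_assoc, Units.mul_inv, mul_one]
      rw [hL, h1, ← mul_assoc, ← C_mul]
      simp only [algebraMap_int_eq, eq_intCast, Int.cast_natCast]
      rw [h2]
      simp only [add_comp, X_comp, C_comp, C_add, C_mul, mul_add, mul_comp]
      ring
    rw [e2] at e1
    simpa [hF] using e1
  have hcoef := congrArg (fun P => coeff P mm) hid
  simp only [coeff_C_mul] at hcoef
  rw [comp_C_mul_X_coeff, (S.taylor_ne p).2, hlamd, ← pow_mul] at hcoef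
  have hp0 : (p:ℤ_[p]) ^ (t * mm) ≠ 0 := pow_ne_zero _ (by exact_mod_cast (Fact.out : p.Prime).ne_zero)
  have hkey : (S.lam d' : ℤ_[p]) * (F.comp L).coeff mm = aeval (S.z p) (hasseDeriv mm S.h) := by
    refine mul_left_cancel₀ hp0 ?_
    rw [← mul_assoc, hcoef]; ring
  -- divisibility of coefficients
  have hdiv : (c:ℤ_[p]) ∣ (F.comp L).coeff mm * (b:ℤ_[p]) := by
    have hFd : F.natDegree < k + 1 := by
      have := natDegree_map_le (f := algebraMap ℤ ℤ_[p]) (p := S.H d)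
      rw [S.H_natDegree d hd] at this; exact Nat.lt_succ_of_le this
    rw [comp, eval₂_eq_sum_range' _ hFd, finsetSum_coeff, Finset.sum_mul]
    refine Finset.dvd_sum fun i hi => ?_
    rw [Finset.mem_range] at hi
    rw [coeff_C_mul]
    rcases Nat.eq_zero_or_pos i with h0 | h0
    · subst h0
      rw [pow_zero, coeff_one, if_neg (by have := S.m_pos p; omega)]; simp
    · obtain ⟨y, hy⟩ := hb i h0 (by omega)
      have : F.coeff i * (b:ℤ_[p]) = c * y := by
        rw [hF, coeff_map, algebraMap_int_eq, eq_intCast]; exact_mod_cast congrArg (Int.cast : ℤ → ℤ_[p]) hy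
      exact ⟨y * (L ^ i).coeff mm, by linear_combination (L ^ i).coeff mm * this⟩
  obtain ⟨y, hy⟩ := hKp p
  rw [← hkey] at hy
  push_cast
  rw [hy]
  obtain ⟨w, hw⟩ := hdiv
  exact ⟨S.lam d' * y * w, by linear_combination (S.lam d' : ℤ_[p]) * y * hw⟩
end Sys
end

set_option maxHeartbeats 1000000 in
lemma D1_pt (s : ℕ) (hs : 1 ≤ s) (b τ c : ℝ) (hb : 0 ≤ b) (hτ : 0 ≤ τ) (hc : |c| ≤ b * τ) :
    (b ^ 2 + 2 * (1 / (8 * s)) * c + (1 / (8 * s)) ^ 2 * τ ^ 2) ^ s ≤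
      (b ^ 2) ^ s + 1 / 4 * (b ^ 2) ^ (s - 1) * c + s * (b ^ 2) ^ (s - 1) * τ ^ 2 + (τ ^ 2) ^ s := by
  obtain ⟨u, rfl⟩ : ∃ u, s = u + 1 := ⟨s - 1, by omega⟩
  simp only [Nat.add_sub_cancel]
  set S : ℝ := ((u + 1 : ℕ) : ℝ) with hS
  have hS1 : 1 ≤ S := by rw [hS]; exact_mod_cast hs
  set ρ : ℝ := 1 / (8 * S) with hρ
  have hSρ : S * ρ = 1 / 8 := by rw [hρ]; field_simp
  have hρ0 : 0 < ρ := by rw [hρ]; positivity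
  have hρ1 : ρ ≤ 1 / 8 := by nlinarith
  obtain ⟨hc1, hc2⟩ := abs_le.1 hc
  rcases le_or_gt τ b with h | h
  · rcases hb.eq_or_lt with h0 | h0
    · have hb0 : b = 0 := h0.symm
      have hτ0 : τ = 0 := le_antisymm (by linarith) hτ
      have hc0 : c = 0 := by rw [hb0] at hc1 hc2; linarith
      rw [hb0, hτ0, hc0]; simp
    · set r := τ / b with hr
      have hr0 : 0 ≤ r := by positivity
      have hr1 : r ≤ 1 := by rw [hr, div_le_one h0]; exact h
      have hτr : τ = r * b := by rw [hr]; field_simp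
      set c' := c / b ^ 2 with hc'
      have hcc : c = c' * b ^ 2 := by rw [hc']; field_simp
      have hb2 : 0 < b ^ 2 := by positivity
      have hc1' : -r ≤ c' := by
        rw [hc', le_div_iff₀ hb2]; rw [hτr] at hc1; linarith [hc1, (by ring : -r * b ^ 2 = -(b * (r * b)))]
      have hc2' : c' ≤ r := by
        rw [hc', div_le_iff₀ hb2]; rw [hτr] at hc2; linarith [(by ring : r * b ^ 2 = (b * (r * b)))]
      set v := 2 * ρ * c' + ρ ^ 2 * r ^ 2 with hv
      have e1 : b ^ 2 + 2 * ρ * c + ρ ^ 2 * τ ^ 2 = b ^ 2 * (1 + v) := by rw [hcc, hτr, hv]; ring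
      have hsv : S * v = 1 / 4 * c' + 1 / 8 * ρ * r ^ 2 := by
        rw [hv]; linear_combination (2 * c' + ρ * r ^ 2) * hSρ
      have hr2 : r ^ 2 ≤ r := by nlinarith
      have hx1 : S * v ≤ 17 / 64 * r := by rw [hsv]; nlinarith
      have hx2 : -(17 / 64 * r) ≤ S * v := by rw [hsv]; nlinarith [mul_nonneg hρ0.le (sq_nonneg r)]
      have habs : |S * v| ≤ 1 := abs_le.2 ⟨by linarith, by linarith⟩
      have hv1 : 0 ≤ 1 + v := by
        have : -(1:ℝ) ≤ v := by
          by_contra hcon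
          push Not at hcon
          nlinarith
        linarith
      have h1 : (1 + v) ^ (u + 1) ≤ Real.exp (S * v) := by
        rw [hS, Real.exp_nat_mul]
        exact pow_le_pow_left₀ hv1 (by linarith [Real.add_one_le_exp v]) _
      have h2 : Real.exp (S * v) ≤ 1 + S * v + (S * v) ^ 2 := by
        have := Real.abs_exp_sub_one_sub_id_le habs
        have := (abs_le.1 this).2
        linarith
      have h3 : (S * v) ^ 2 ≤ (17 / 64 * r) ^ 2 := sq_le_sq' (by linarith) hx1
      have h4 : (1 + v) ^ (u + 1) ≤ 1 + 1 / 4 * c' + S * r ^ 2 := by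
        rw [hsv] at h1 h2 h3
        nlinarith [mul_le_mul_of_nonneg_right hρ1 (sq_nonneg r), mul_le_mul_of_nonneg_right hS1 (sq_nonneg r)]
      rw [e1, mul_pow]
      have h5 : (b ^ 2) ^ (u + 1) * (1 + v) ^ (u + 1) ≤ (b ^ 2) ^ (u + 1) * (1 + 1 / 4 * c' + S * r ^ 2) :=
        mul_le_mul_of_nonneg_left h4 (by positivity)
      refine h5.trans ?_
      rw [hcc, hτr]
      have : 0 ≤ ((r * b) ^ 2) ^ (u + 1) := by positivity
      have e2 : (b ^ 2) ^ (u + 1) = (b ^ 2) ^ u * b ^ 2 := pow_succ _ _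
      rw [e2]
      have e3 : (b ^ 2) ^ u * b ^ 2 * (1 + 1 / 4 * c' + S * r ^ 2) = (b ^ 2) ^ u * b ^ 2 + 1 / 4 * (b ^ 2) ^ u * (c' * b ^ 2) + S * (b ^ 2) ^ u * (r * b) ^ 2 := by ring
      linarith
  · have hτ0 : 0 < τ := lt_of_le_of_lt hb h
    have h1 : b ^ 2 + 2 * ρ * c + ρ ^ 2 * τ ^ 2 ≤ (b + ρ * τ) ^ 2 := by nlinarith
    have h0 : 0 ≤ b ^ 2 + 2 * ρ * c + ρ ^ 2 * τ ^ 2 := by nlinarith [sq_nonneg (b - ρ * τ)]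
    have h2 := pow_le_pow_left₀ h0 h1 (u + 1)
    refine h2.trans ?_
    have hB : 0 ≤ (b ^ 2) ^ u := by positivity
    have h3 : 0 ≤ 1 / 4 * (b ^ 2) ^ u * c + S * (b ^ 2) ^ u * τ ^ 2 := by
      have : 0 ≤ (b ^ 2) ^ u * (1 / 4 * c + S * τ ^ 2) := mul_nonneg hB (by nlinarith)
      linarith
    suffices hh : ((b + ρ * τ) ^ 2) ^ (u + 1) ≤ (b ^ 2) ^ (u + 1) + (τ ^ 2) ^ (u + 1) by linarith
    rcases le_or_gt b ((1 - ρ) * τ) with h4 | h4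
    · have : (b + ρ * τ) ^ 2 ≤ τ ^ 2 := pow_le_pow_left₀ (by positivity) (by linarith) _
      have := pow_le_pow_left₀ (by positivity) this (u + 1)
      have : 0 ≤ (b ^ 2) ^ (u + 1) := by positivity
      linarith
    · have h5 : ((b + ρ * τ) ^ 2) ^ (u + 1) ≤ (((1 + ρ) * τ) ^ 2) ^ (u + 1) := by
        gcongr; linarith
      have h6 : (((1 - ρ) * τ) ^ 2) ^ (u + 1) ≤ (b ^ 2) ^ (u + 1) := by
        have : 0 ≤ (1 - ρ) * τ := mul_nonneg (by linarith) hτ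
        gcongr
      have e5 : (((1 + ρ) * τ) ^ 2) ^ (u + 1) = (τ ^ 2) ^ (u + 1) * (1 + ρ) ^ (2 * (u + 1)) := by
        rw [← pow_mul, ← pow_mul, mul_pow, mul_comm]
      have e6 : (((1 - ρ) * τ) ^ 2) ^ (u + 1) = (τ ^ 2) ^ (u + 1) * (1 - ρ) ^ (2 * (u + 1)) := by
        rw [← pow_mul, ← pow_mul, mul_pow, mul_comm]
      have hT : 0 ≤ (τ ^ 2) ^ (u + 1) := by positivity
      have h7 : (1 + ρ) ^ (2 * (u + 1)) ≤ 3 / 2 := by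
        have a1 : (1 + ρ) ^ (2 * (u + 1)) ≤ Real.exp (1 / 4) := by
          have : (1:ℝ) / 4 = ((2 * (u + 1) : ℕ) : ℝ) * ρ := by
            push_cast
            rw [hS] at hSρ; push_cast at hSρ; linarith
          rw [this, Real.exp_nat_mul]
          exact pow_le_pow_left₀ (by linarith) (by linarith [Real.add_one_le_exp ρ]) _
        have := Real.abs_exp_sub_one_sub_id_le (x := 1 / 4) (by rw [abs_le]; constructor <;> norm_num)
        have := (abs_le.1 this).2
        nlinarith
      have h8 : 3 / 4 ≤ (1 - ρ) ^ (2 * (u + 1)) := by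
        have := one_add_mul_le_pow (a := -ρ) (by linarith) (2 * (u + 1))
        rw [hS] at hSρ; push_cast at hSρ this
        have e7 : (1 + -ρ) = 1 - ρ := by ring
        rw [e7] at this
        linarith
      rw [e5] at h5; rw [e6] at h6
      nlinarith [mul_le_mul_of_nonneg_left h7 hT, mul_le_mul_of_nonneg_left h8 hT]

lemma D1_bern (s : ℕ) (hs : 1 ≤ s) (b z : ℝ) (hb : 0 ≤ b) (hz : 0 ≤ z) :
    b ^ s + s * b ^ (s - 1) * z ≤ (b + z) ^ s := by
  obtain ⟨u, rfl⟩ : ∃ u, s = u + 1 := ⟨s - 1, by omega⟩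
  simp only [Nat.add_sub_cancel]
  clear hs
  induction u with
  | zero => simp
  | succ u ih =>
    rw [pow_succ (b + z)]
    have h1 := mul_le_mul_of_nonneg_right ih (by linarith : 0 ≤ b + z)
    refine le_trans ?_ h1
    push_cast
    have : 0 ≤ ((u:ℝ) + 1) * b ^ u * z * z := by positivity
    have e1 : (b ^ (u + 1) + ((u:ℝ) + 1) * b ^ u * z) * (b + z) = b ^ (u + 1 + 1) + ((u:ℝ) + 1 + 1) * b ^ (u + 1) * z + ((u:ℝ) + 1) * b ^ u * z * z := by ring
    linarith

/-- average over the coordinate `i` -/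
noncomputable def av (P : ℕ → ℕ) (i : ℕ) (φ : (ℕ → ℕ) → ℝ) (x : ℕ → ℕ) : ℝ :=
  (∑ t ∈ Finset.range (P i), φ (Function.update x i t)) / P i

noncomputable def avL (P : ℕ → ℕ) : List ℕ → ((ℕ → ℕ) → ℝ) → (ℕ → ℕ) → ℝ
  | [], φ => φ
  | i :: l, φ => av P i (avL P l φ)

def Ind (i : ℕ) (φ : (ℕ → ℕ) → ℝ) : Prop := ∀ x t, φ (Function.update x i t) = φ x

section
variable {P : ℕ → ℕ} (hP : ∀ i, 0 < P i)

lemma av_add (i : ℕ) (φ ψ : (ℕ → ℕ) → ℝ) : av P i (fun x => φ x + ψ x) = fun x => av P i φ x + av P i ψ x := by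
  funext x; simp only [av]; rw [Finset.sum_add_distrib, add_div]

lemma av_mono (i : ℕ) (φ ψ : (ℕ → ℕ) → ℝ) (h : ∀ x, φ x ≤ ψ x) (x : ℕ → ℕ) : av P i φ x ≤ av P i ψ x := by
  simp only [av]; gcongr; exact h _

include hP in
lemma av_of_ind (i : ℕ) (φ : (ℕ → ℕ) → ℝ) (h : Ind i φ) : av P i φ = φ := by
  funext x; simp only [av]; simp only [h x]; have := hP i; simp; field_simp

lemma av_mul_ind (i : ℕ) (φ ψ : (ℕ → ℕ) → ℝ) (h : Ind i φ) :
    av P i (fun x => φ x * ψ x) = fun x => φ x * av P i ψ x := by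
  funext x; simp only [av]; simp only [h x]; rw [← Finset.mul_sum, mul_div_assoc]

lemma av_const_mul (i : ℕ) (c : ℝ) (ψ : (ℕ → ℕ) → ℝ) : av P i (fun x => c * ψ x) = fun x => c * av P i ψ x :=
  av_mul_ind i (fun _ => c) ψ (fun _ _ => rfl)

lemma av_sum {ι : Type*} (s : Finset ι) (i : ℕ) (φ : ι → (ℕ → ℕ) → ℝ) :
    av P i (fun x => ∑ a ∈ s, φ a x) = fun x => ∑ a ∈ s, av P i (φ a) x := by
  funext x; simp only [av]; rw [Finset.sum_comm, Finset.sum_div]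

lemma av_comm (i j : ℕ) (φ : (ℕ → ℕ) → ℝ) : av P i (av P j φ) = av P j (av P i φ) := by
  by_cases h : i = j
  · rw [h]
  · funext x; simp only [av]
    simp only [← Finset.sum_div]
    rw [Finset.sum_comm, div_right_comm]
    congr 2
    refine Finset.sum_congr rfl fun a _ => Finset.sum_congr rfl fun b _ => ?_
    rw [Function.update_comm (Ne.symm h)]

lemma ind_av_self (i : ℕ) (φ : (ℕ → ℕ) → ℝ) : Ind i (av P i φ) := by
  intro x t; simp [av]

lemma ind_av (i j : ℕ) (φ : (ℕ → ℕ) → ℝ) (h : Ind i φ) : Ind i (av P j φ) := by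
  by_cases hij : i = j
  · rw [hij]; exact ind_av_self _ _
  · intro x t
    simp only [av]
    congr 1
    refine Finset.sum_congr rfl fun a _ => ?_
    rw [Function.update_comm hij, h]

lemma ind_avL (i : ℕ) (l : List ℕ) (φ : (ℕ → ℕ) → ℝ) (h : Ind i φ) : Ind i (avL P l φ) := by
  induction l with
  | nil => exact h
  | cons j l ih => exact ind_av _ _ _ ih

lemma avL_add (l : List ℕ) (φ ψ : (ℕ → ℕ) → ℝ) : avL P l (fun x => φ x + ψ x) = fun x => avL P l φ x + avL P l ψ x := by
  induction l with
  | nil => rfl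
  | cons i l ih => simp only [avL]; rw [ih, av_add]

lemma avL_mono (l : List ℕ) (φ ψ : (ℕ → ℕ) → ℝ) (h : ∀ x, φ x ≤ ψ x) (x : ℕ → ℕ) : avL P l φ x ≤ avL P l ψ x := by
  induction l generalizing x with
  | nil => exact h x
  | cons i l ih => exact av_mono _ _ _ ih x

lemma avL_mul_ind (l : List ℕ) (φ ψ : (ℕ → ℕ) → ℝ) (h : ∀ i ∈ l, Ind i φ) :
    avL P l (fun x => φ x * ψ x) = fun x => φ x * avL P l ψ x := by
  induction l with
  | nil => rfl
  | cons i l ih =>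
    simp only [avL]; rw [ih (fun j hj => h j (List.mem_cons_of_mem _ hj)), av_mul_ind _ _ _ (h i (by simp))]

lemma avL_const_mul (l : List ℕ) (c : ℝ) (ψ : (ℕ → ℕ) → ℝ) : avL P l (fun x => c * ψ x) = fun x => c * avL P l ψ x :=
  avL_mul_ind l (fun _ => c) ψ (fun _ _ _ _ => rfl)

lemma avL_sum {ι : Type*} (s : Finset ι) (l : List ℕ) (φ : ι → (ℕ → ℕ) → ℝ) :
    avL P l (fun x => ∑ a ∈ s, φ a x) = fun x => ∑ a ∈ s, avL P l (φ a) x := by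
  induction l with
  | nil => rfl
  | cons i l ih => simp only [avL]; rw [ih, av_sum]

lemma avL_comm (i : ℕ) (l : List ℕ) (φ : (ℕ → ℕ) → ℝ) : avL P l (av P i φ) = av P i (avL P l φ) := by
  induction l with
  | nil => rfl
  | cons j l ih => simp only [avL]; rw [ih, av_comm]

include hP in
lemma avL_of_ind (l : List ℕ) (φ : (ℕ → ℕ) → ℝ) (h : ∀ i ∈ l, Ind i φ) : avL P l φ = φ := by
  induction l with
  | nil => rfl
  | cons i l ih =>
    simp only [avL]; rw [ih (fun j hj => h j (List.mem_cons_of_mem _ hj)), av_of_ind hP _ _ (h i (by simp))]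

include hP in
lemma avL_const (l : List ℕ) (c : ℝ) (x : ℕ → ℕ) : avL P l (fun _ => c) x = c := by
  rw [avL_of_ind hP l _ (fun _ _ _ _ => rfl)]

lemma avL_zero_of (l : List ℕ) (i : ℕ) (hi : i ∈ l) (φ : (ℕ → ℕ) → ℝ) (h : av P i φ = fun _ => 0) :
    avL P l φ = fun _ => 0 := by
  induction l with
  | nil => simp at hi
  | cons j l ih =>
    simp only [avL]
    rcases List.mem_cons.1 hi with rfl | hi
    · rw [← avL_comm, h]
      have := avL_const_mul (P := P) l 0 (fun _ => 0)
      simpa using this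
    · rw [ih hi]; funext x; simp [av]

lemma avL_append (l l' : List ℕ) (φ : (ℕ → ℕ) → ℝ) : avL P (l ++ l') φ = avL P l (avL P l' φ) := by
  induction l with
  | nil => rfl
  | cons j l ih => simp only [avL, List.cons_append]; rw [ih]

lemma avL_congr (l : List ℕ) (φ ψ : (ℕ → ℕ) → ℝ) (x₀ : ℕ → ℕ)
    (h : ∀ x, (∀ i, i ∉ l → x i = x₀ i) → φ x = ψ x) : avL P l φ x₀ = avL P l ψ x₀ := by
  induction l generalizing x₀ with
  | nil => exact h x₀ (fun _ _ => rfl)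
  | cons j l ih =>
    simp only [avL, av]
    congr 1
    refine Finset.sum_congr rfl fun t _ => ih _ fun x hx => h x fun i hi => ?_
    rw [List.mem_cons, not_or] at hi
    rw [hx i hi.2, Function.update_of_ne hi.1]

/-- Cauchy-Schwarz -/
lemma avL_CS (l : List ℕ) (φ ψ : (ℕ → ℕ) → ℝ) (x : ℕ → ℕ) :
    (avL P l (fun x => φ x * ψ x) x) ^ 2 ≤ avL P l (fun x => φ x ^ 2) x * avL P l (fun x => ψ x ^ 2) x := by
  have h : ∀ r : ℝ, 0 ≤ avL P l (fun x => φ x ^ 2) x * (r * r) + (2 * avL P l (fun x => φ x * ψ x) x) * r + avL P l (fun x => ψ x ^ 2) x := by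
    intro r
    have h1 : avL P l (fun x => (r * r) * φ x ^ 2 + ((2 * r) * (φ x * ψ x) + ψ x ^ 2)) x = avL P l (fun x => φ x ^ 2) x * (r * r) + (2 * avL P l (fun x => φ x * ψ x) x) * r + avL P l (fun x => ψ x ^ 2) x := by
      rw [avL_add, avL_add, avL_const_mul, avL_const_mul]; ring
    rw [← h1]
    have h2 : avL P l (fun _ => 0 * 0) x = 0 := by rw [avL_const_mul]; simp
    have h3 := avL_mono (P := P) l (fun _ => 0 * 0) (fun x => (r * r) * φ x ^ 2 + ((2 * r) * (φ x * ψ x) + ψ x ^ 2))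
      (fun x => by nlinarith [sq_nonneg (r * φ x + ψ x)]) x
    linarith
  have := discrim_le_zero h
  rw [discrim] at this
  nlinarith

lemma avL_nonneg (l : List ℕ) (φ : (ℕ → ℕ) → ℝ) (h : ∀ x, 0 ≤ φ x) (x : ℕ → ℕ) : 0 ≤ avL P l φ x := by
  have h2 : avL P l (fun _ => 0 * 0) x = 0 := by rw [avL_const_mul]; simp
  rw [← h2]
  exact avL_mono l _ _ (fun x => by simpa using h x) x

include hP in
/-- one-coordinate hypercontractive step -/
lemma hyper_one (s : ℕ) (hs : 1 ≤ s) (i : ℕ) (B : List ℕ) (F0 F1 : (ℕ → ℕ) → ℝ) (h0 : Ind i F0)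
    (h1 : av P i F1 = fun _ => 0) (x : ℕ → ℕ) :
    av P i (fun x => (avL P B (fun x => (F0 x + 1 / (8 * s) * F1 x) ^ 2) x) ^ s) x ≤
      (avL P (i :: B) (fun x => (F0 x + F1 x) ^ 2) x) ^ s + av P i (fun x => (avL P B (fun x => F1 x ^ 2) x) ^ s) x := by
  set β := avL P B (fun x => F0 x ^ 2) with hβ
  set c := avL P B (fun x => F0 x * F1 x) with hc
  set θ := avL P B (fun x => F1 x ^ 2) with hθ
  have hβ0 : ∀ x, 0 ≤ β x := avL_nonneg B _ (fun x => sq_nonneg _)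
  have hθ0 : ∀ x, 0 ≤ θ x := avL_nonneg B _ (fun x => sq_nonneg _)
  have hexp : ∀ (r : ℝ) x, avL P B (fun x => (F0 x + r * F1 x) ^ 2) x = β x + 2 * r * c x + r ^ 2 * θ x := by
    intro r x
    have : (fun x => (F0 x + r * F1 x) ^ 2) = fun x => F0 x ^ 2 + ((2 * r) * (F0 x * F1 x) + r ^ 2 * F1 x ^ 2) := by
      funext x; ring
    rw [this, avL_add, avL_add, avL_const_mul, avL_const_mul]; ring
  have hβi : Ind i β := ind_avL _ _ _ (fun x t => by simp only [h0 x t])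
  have hci : av P i c = fun _ => 0 := by
    rw [hc, ← avL_comm, av_mul_ind _ _ _ h0, h1]
    have := avL_const_mul (P := P) B 0 (fun _ => 0)
    simpa using this
  have hcs : ∀ x, |c x| ≤ Real.sqrt (β x) * Real.sqrt (θ x) := by
    intro x
    rw [← Real.sqrt_mul (hβ0 x)]
    exact Real.abs_le_sqrt (avL_CS B F0 F1 x)
  have hpt : ∀ x, (avL P B (fun x => (F0 x + 1 / (8 * s) * F1 x) ^ 2) x) ^ s ≤
      β x ^ s + ((1 / 4 * β x ^ (s - 1)) * c x + ((s * β x ^ (s - 1)) * θ x + θ x ^ s)) := by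
    intro x
    have := D1_pt s hs _ _ (c x) (Real.sqrt_nonneg (β x)) (Real.sqrt_nonneg (θ x)) (hcs x)
    rw [Real.sq_sqrt (hβ0 x), Real.sq_sqrt (hθ0 x)] at this
    rw [hexp]
    linarith
  have hpow : ∀ m : ℕ, Ind i (fun x => β x ^ m) := fun m x t => by simp only [hβi x t]
  refine (av_mono i _ _ hpt x).trans ?_
  rw [av_add, av_add, av_add, av_of_ind hP i _ (hpow s), av_mul_ind i (fun x => 1 / 4 * β x ^ (s - 1)) c (fun x t => by simp only [hβi x t]),
    av_mul_ind i (fun x => s * β x ^ (s - 1)) θ (fun x t => by simp only [hβi x t]), hci]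
  have e2 : avL P (i :: B) (fun x => (F0 x + F1 x) ^ 2) x = β x + av P i θ x := by
    simp only [avL]
    have : avL P B (fun x => (F0 x + F1 x) ^ 2) = fun x => β x + (2 * c x + θ x) := by
      funext x
      have := hexp 1 x
      simp only [one_mul, mul_one, one_pow] at this
      rw [this]; ring
    rw [this, av_add, av_add, av_of_ind hP i _ hβi, av_const_mul, hci]; ring
  rw [e2]
  have h3 : 0 ≤ av P i θ x := by
    simp only [av]; exact div_nonneg (Finset.sum_nonneg fun t _ => hθ0 _) (by positivity)
  have := D1_bern s hs (β x) (av P i θ x) (hβ0 x) h3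
  linarith

noncomputable def wt (c : ℝ) (l : List ℕ) (S : Finset ℕ) : ℝ := (l.map fun i => if i ∈ S then c else 1).prod

lemma wt_cons (c : ℝ) (i : ℕ) (l : List ℕ) (S : Finset ℕ) : wt c (i :: l) S = (if i ∈ S then c else 1) * wt c l S := by
  simp [wt]

lemma diag (f : Finset ℕ → (ℕ → ℕ) → ℝ) (hf1 : ∀ S i, i ∉ S → Ind i (f S))
    (hf2 : ∀ S i, i ∈ S → av P i (f S) = fun _ => 0) (𝒮 : Finset (Finset ℕ)) (B : List ℕ)
    (hB : ∀ S ∈ 𝒮, ∀ S' ∈ 𝒮, ∀ i ∈ S, i ∉ S' → i ∈ B) (x : ℕ → ℕ) :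
    avL P B (fun x => (∑ S ∈ 𝒮, f S x) ^ 2) x = ∑ S ∈ 𝒮, avL P B (fun x => f S x ^ 2) x := by
  have e2 : (fun x => (∑ S ∈ 𝒮, f S x) ^ 2) = fun x => ∑ S ∈ 𝒮, ∑ S' ∈ 𝒮, f S x * f S' x := by
    funext x; rw [sq, Finset.sum_mul_sum]
  rw [e2, avL_sum]
  refine Finset.sum_congr rfl fun S hS => ?_
  rw [avL_sum]
  have key : ∀ S₁ ∈ 𝒮, ∀ S₂ ∈ 𝒮, ∀ i ∈ S₁, i ∉ S₂ → avL P B (fun x => f S₁ x * f S₂ x) = fun _ => 0 := by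
    intro S₁ h1 S₂ h2 i hi1 hi2
    refine avL_zero_of B i (hB _ h1 _ h2 i hi1 hi2) _ ?_
    have : (fun x => f S₁ x * f S₂ x) = fun x => f S₂ x * f S₁ x := by funext x; ring
    rw [this, av_mul_ind _ _ _ (hf1 _ _ hi2), hf2 _ _ hi1]; simp
  beta_reduce
  rw [Finset.sum_eq_single S]
  · congr 1; funext x; ring
  · intro S' hS' hne
    have : ¬ (S ⊆ S' ∧ S' ⊆ S) := fun h => hne (Finset.Subset.antisymm h.2 h.1)
    rw [not_and_or] at this
    rcases this with h | h
    · obtain ⟨i, hi1, hi2⟩ := Finset.not_subset.1 h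
      rw [key S hS S' hS' i hi1 hi2]
    · obtain ⟨i, hi1, hi2⟩ := Finset.not_subset.1 h
      have := key S' hS' S hS i hi1 hi2
      have e3 : (fun x => f S x * f S' x) = fun x => f S' x * f S x := by funext x; ring
      rw [e3, this]
  · intro h; exact absurd hS h

include hP in
/-- hypercontractivity with leaf bound `m` -/
lemma hyper (s : ℕ) (hs : 1 ≤ s) (f : Finset ℕ → (ℕ → ℕ) → ℝ) (hf1 : ∀ S i, i ∉ S → Ind i (f S))
    (hf2 : ∀ S i, i ∈ S → av P i (f S) = fun _ => 0) (I : Finset ℕ) (𝒮 : Finset (Finset ℕ)) (h𝒮 : ∀ S ∈ 𝒮, S ⊆ I)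
    (m : ℝ) (hleaf : ∀ (T : Finset ℕ) (B : List ℕ), B.Nodup → (∀ i ∈ B, i ∉ T ∧ i ∈ I) → T ⊆ I → (∀ i ∈ I, i ∉ T → i ∈ B) →
      ∀ x, avL P B (fun x => (∑ S ∈ 𝒮 with T ⊆ S, f S x) ^ 2) x ≤ m) :
    ∀ (l : List ℕ) (T : Finset ℕ) (B : List ℕ), (l ++ B).Nodup → (∀ i ∈ l ++ B, i ∉ T ∧ i ∈ I) → T ⊆ I →
      (∀ i ∈ I, i ∉ T → i ∈ l ++ B) → ∀ x,
      avL P l (fun x => (avL P B (fun x => (∑ S ∈ 𝒮 with T ⊆ S, wt (1 / (8 * s)) l S * f S x) ^ 2) x) ^ s) x ≤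
        m ^ (s - 1) * ∑ S ∈ 𝒮 with T ⊆ S, wt 2 l S * avL P l (avL P B (fun x => f S x ^ 2)) x := by
  intro l
  induction l with
  | nil =>
    intro T B hnd hB hT hI x
    simp only [wt, List.map_nil, List.prod_nil, one_mul, avL]
    simp only [List.nil_append] at hnd hB hI
    have hl := hleaf T B hnd hB hT hI x
    have h0 : 0 ≤ avL P B (fun x => (∑ S ∈ 𝒮 with T ⊆ S, f S x) ^ 2) x := avL_nonneg B _ (fun x => sq_nonneg _) x
    have e1 := diag f hf1 hf2 (𝒮.filter (T ⊆ ·)) B (by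
      intro S hS S' hS' i hi hi'
      simp only [Finset.mem_filter] at hS hS'
      exact hI i (h𝒮 _ hS.1 hi) (fun h => hi' (hS'.2 h))) x
    rw [← e1]
    calc _ = (avL P B (fun x => (∑ S ∈ 𝒮 with T ⊆ S, f S x) ^ 2) x) ^ (s - 1) * avL P B (fun x => (∑ S ∈ 𝒮 with T ⊆ S, f S x) ^ 2) x := by
          rw [← pow_succ]; congr 1; omega
      _ ≤ _ := by gcongr
  | cons i l ih =>
    intro T B hnd hB hT hI x
    set ρ : ℝ := 1 / (8 * s) with hρ
    have hi := hB i (by simp)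
    set F0 : (ℕ → ℕ) → ℝ := fun x => ∑ S ∈ (𝒮.filter (T ⊆ ·)) with i ∉ S, wt ρ l S * f S x with hF0
    set F1 : (ℕ → ℕ) → ℝ := fun x => ∑ S ∈ (𝒮.filter (T ⊆ ·)) with i ∈ S, wt ρ l S * f S x with hF1
    have hsum : ∀ x, F0 x + F1 x = ∑ S ∈ 𝒮 with T ⊆ S, wt ρ l S * f S x := by
      intro x; rw [hF0, hF1, add_comm]; exact Finset.sum_filter_add_sum_filter_not _ _ _
    have hsum2 : ∀ x, ∑ S ∈ 𝒮 with T ⊆ S, wt ρ (i :: l) S * f S x = F0 x + ρ * F1 x := by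
      intro x
      rw [← Finset.sum_filter_add_sum_filter_not _ (fun S => i ∈ S), add_comm, hF0, hF1, Finset.mul_sum]
      congr 1
      · refine Finset.sum_congr rfl fun S hS => ?_
        rw [wt_cons, if_neg (Finset.mem_filter.1 hS).2, one_mul]
      · refine Finset.sum_congr rfl fun S hS => ?_
        rw [wt_cons, if_pos (Finset.mem_filter.1 hS).2, mul_assoc]
    have hind : Ind i F0 := by
      intro x t
      refine Finset.sum_congr rfl fun S hS => ?_
      rw [hf1 S i (Finset.mem_filter.1 hS).2]
    have hav : av P i F1 = fun _ => 0 := by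
      rw [hF1, av_sum]
      funext x
      refine Finset.sum_eq_zero fun S hS => ?_
      rw [av_const_mul, hf2 S i (Finset.mem_filter.1 hS).2]; simp
    have hfil : (𝒮.filter (T ⊆ ·)).filter (i ∈ ·) = 𝒮.filter (insert i T ⊆ ·) := by
      ext S; simp only [Finset.mem_filter, Finset.insert_subset_iff]; tauto
    simp only [avL, hsum2]
    rw [← avL_comm]
    refine (avL_mono l _ _ (hyper_one hP s hs i B F0 F1 hind hav) x).trans ?_
    rw [avL_add]
    have ih1 := ih T (i :: B) (by
        refine List.Perm.nodup ?_ hnd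
        rw [List.cons_append]; exact List.perm_middle.symm) (by
        intro j hj; apply hB; simp only [List.mem_append, List.mem_cons] at hj ⊢; tauto) hT (by
        intro j hj hjT; have := hI j hj hjT; simp only [List.mem_append, List.mem_cons] at this ⊢; tauto) x
    have hnd' : (l ++ B).Nodup := by rw [List.cons_append] at hnd; exact (List.nodup_cons.1 hnd).2
    have hnotin : i ∉ l ++ B := by rw [List.cons_append] at hnd; exact (List.nodup_cons.1 hnd).1
    have ih2 := ih (insert i T) B hnd' (by
        intro j hj
        have := hB j (by rw [List.cons_append]; exact List.mem_cons_of_mem _ hj)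
        refine ⟨?_, this.2⟩
        rw [Finset.mem_insert, not_or]
        exact ⟨fun h => hnotin (h ▸ hj), this.1⟩) (Finset.insert_subset hi.2 hT) (by
        intro j hj hjT
        rw [Finset.mem_insert, not_or] at hjT
        have := hI j hj hjT.2
        rw [List.cons_append, List.mem_cons] at this
        exact this.resolve_left hjT.1)
    simp only [hsum]
    rw [avL_comm]
    have ih3 := av_mono (P := P) i _ _ ih2 x
    simp only [← hfil] at ih3
    rw [av_const_mul, av_sum] at ih3
    refine (add_le_add ih1 ih3).trans (le_of_eq ?_)
    rw [← mul_add]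
    congr 1
    rw [← Finset.sum_filter_add_sum_filter_not (𝒮.filter (T ⊆ ·)) (fun S => i ∈ S) (fun S => wt 2 (i :: l) S * _),
      ← Finset.sum_filter_add_sum_filter_not (𝒮.filter (T ⊆ ·)) (fun S => i ∈ S), add_right_comm, ← Finset.sum_add_distrib]
    congr 1
    · refine Finset.sum_congr rfl fun S hS => ?_
      rw [wt_cons, if_pos (Finset.mem_filter.1 hS).2, av_const_mul]
      simp only [avL]
      rw [avL_comm]; ring
    · refine Finset.sum_congr rfl fun S hS => ?_
      rw [wt_cons, if_neg (Finset.mem_filter.1 hS).2]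
      simp only [avL]
      rw [avL_comm]; ring

end

lemma periodic_sum (ψ : ℕ → ℝ) (p : ℕ) (hp : 0 < p) (hper : ∀ j, ψ (p + j) = ψ j) (M : ℝ) (hM : ∀ j, |ψ j| ≤ M) (n : ℕ) :
    |∑ j ∈ Finset.range n, ψ j - n / p * ∑ j ∈ Finset.range p, ψ j| ≤ 2 * p * M := by
  have hb : ∀ m : ℕ, |∑ j ∈ Finset.range m, ψ j| ≤ m * M := by
    intro m
    refine (Finset.abs_sum_le_sum_abs _ _).trans ?_
    refine (Finset.sum_le_sum fun j _ => hM j).trans ?_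
    simp
  have hM0 : 0 ≤ M := (abs_nonneg _).trans (hM 0)
  have hp' : (0:ℝ) < p := by exact_mod_cast hp
  induction n using Nat.strong_induction_on with
  | _ n ih =>
    by_cases h : n < p
    · have h1 : |(n:ℝ) / p * ∑ j ∈ Finset.range p, ψ j| ≤ p * M := by
        rw [abs_mul, abs_of_nonneg (by positivity)]
        have : (n:ℝ) / p ≤ 1 := by rw [div_le_one hp']; exact_mod_cast h.le
        calc _ ≤ 1 * (p * M) := by gcongr; exact hb p
          _ = _ := one_mul _
      have h2 : |∑ j ∈ Finset.range n, ψ j| ≤ p * M := (hb n).trans (by gcongr)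
      refine (abs_sub _ _).trans ?_
      linarith
    · obtain ⟨n', rfl⟩ : ∃ n', n = p + n' := ⟨n - p, by omega⟩
      have := ih n' (by omega)
      rw [Finset.sum_range_add]
      simp only [hper]
      refine le_trans (le_of_eq ?_) this
      congr 1
      push_cast
      field_simp
      ring

section
variable {P : ℕ → ℕ} 

def Dep (P : ℕ → ℕ) (U : Finset ℕ) (φ : (ℕ → ℕ) → ℝ) : Prop := ∀ x y : ℕ → ℕ, (∀ i ∈ U, x i ≡ y i [MOD P i]) → φ x = φ y

lemma Dep.ind {U : Finset ℕ} {φ : (ℕ → ℕ) → ℝ} (h : Dep P U φ) (i : ℕ) (hi : i ∉ U) : Ind i φ := by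
  intro x t
  refine h _ _ fun j hj => ?_
  have : j ≠ i := fun h => hi (h ▸ hj)
  rw [Function.update_of_ne this]

lemma avL_crt (hP : ∀ i, 0 < P i) (l : List ℕ) (hnd : l.Nodup) (hcop : ∀ i ∈ l, ∀ j ∈ l, i ≠ j → Nat.Coprime (P i) (P j)) :
    ∀ (U : Finset ℕ) (φ : (ℕ → ℕ) → ℝ) (x : ℕ → ℕ), (∀ i ∈ U, i ∈ l) → Dep P U φ →
    ∑ j ∈ Finset.range (∏ i ∈ U, P i), φ (fun _ => j) = (∏ i ∈ U, P i : ℕ) * avL P l φ x := by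
  induction l with
  | nil =>
    intro U φ x hU hφ
    have : U = ∅ := by ext i; constructor <;> intro h <;> simp_all
    subst this
    simp only [Finset.prod_empty, Finset.range_one, Finset.sum_singleton, avL, Nat.cast_one, one_mul]
    exact hφ _ _ (by simp)
  | cons i l ih =>
    intro U φ x hU hφ
    have ih' := ih (List.nodup_cons.1 hnd).2 (fun a ha b hb => hcop a (List.mem_cons_of_mem _ ha) b (List.mem_cons_of_mem _ hb))
    have hil := (List.nodup_cons.1 hnd).1
    by_cases hi : i ∈ U
    · set U' := U.erase i with hU'
      have hU'l : ∀ j ∈ U', j ∈ l := fun j hj => by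
        have := hU j (Finset.mem_of_mem_erase hj)
        rcases List.mem_cons.1 this with h | h
        · exact absurd h (Finset.ne_of_mem_erase hj)
        · exact h
      set b := ∏ j ∈ U', P j with hb
      have hprod : ∏ j ∈ U, P j = P i * b := (Finset.mul_prod_erase U P hi).symm
      have h1 : ∀ t, (b:ℝ) * avL P l φ (Function.update x i t) = ∑ j ∈ Finset.range b, φ (Function.update (fun _ => j) i t) := by
        intro t
        have e1 : avL P l φ (Function.update x i t) = avL P l (fun y => φ (Function.update y i t)) (Function.update x i t) := by
          refine avL_congr l _ _ _ fun y hy => ?_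
          have := hy i hil
          rw [Function.update_self] at this
          rw [← this, Function.update_eq_self]
        rw [e1, ← ih' U' (fun y => φ (Function.update y i t)) _ hU'l]
        intro y z hyz
        refine hφ _ _ fun j hj => ?_
        by_cases hji : j = i
        · subst hji; simp [Nat.ModEq.refl]
        · rw [Function.update_of_ne hji, Function.update_of_ne hji]
          exact hyz j (Finset.mem_erase.2 ⟨hji, hj⟩)
      rw [hprod]
      simp only [avL, av]
      have hPi : (P i : ℝ) ≠ 0 := by exact_mod_cast (hP i).ne'
      have e2 : ((P i * b : ℕ) : ℝ) * ((∑ t ∈ Finset.range (P i), avL P l φ (Function.update x i t)) / P i) =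
          ∑ t ∈ Finset.range (P i), ∑ j ∈ Finset.range b, φ (Function.update (fun _ => j) i t) := by
        simp only [← h1]
        rw [← Finset.mul_sum]; push_cast; field_simp
      rw [e2, ← Finset.sum_product']
      have hbpos : 0 < b := Finset.prod_pos fun j _ => hP j
      have hcopb : Nat.Coprime (P i) b := Nat.Coprime.prod_right fun j hj =>
        hcop i (by simp) j (List.mem_cons_of_mem _ (hU'l j hj)) (Finset.ne_of_mem_erase hj).symm
      refine Finset.sum_nbij (fun j => (j % P i, j % b)) ?_ ?_ ?_ ?_
      · intro j _
        simp only [Finset.mem_product, Finset.mem_range]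
        exact ⟨Nat.mod_lt _ (hP i), Nat.mod_lt _ hbpos⟩
      · intro j hj j' hj' h
        simp only [Prod.mk.injEq] at h
        have h3 : j ≡ j' [MOD P i * b] := (Nat.modEq_and_modEq_iff_modEq_mul hcopb).1 ⟨h.1, h.2⟩
        simp only [Finset.coe_range, Set.mem_Iio] at hj hj'
        exact Nat.ModEq.eq_of_lt_of_lt h3 hj hj'
      · rintro ⟨u, v⟩ huv
        simp only [Finset.coe_product, Finset.coe_range, Set.mem_prod, Set.mem_Iio] at huv
        obtain ⟨k, hk1, hk2⟩ := Nat.chineseRemainder hcopb u v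
        refine ⟨k % (P i * b), ?_, ?_⟩
        · simp only [Finset.coe_range, Set.mem_Iio]; exact Nat.mod_lt _ (Nat.mul_pos (hP i) hbpos)
        · simp only [Nat.mod_mul_right_mod, Nat.mod_mul_left_mod, Prod.mk.injEq]
          exact ⟨Eq.trans (show k % P i = u % P i from hk1) (Nat.mod_eq_of_lt huv.1), Eq.trans (show k % b = v % b from hk2) (Nat.mod_eq_of_lt huv.2)⟩
      · intro j _
        refine hφ _ _ fun j' hj' => ?_
        by_cases hji : j' = i
        · subst hji; simp only [Function.update_self]; exact (Nat.mod_modEq _ _).symm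
        · rw [Function.update_of_ne hji]
          exact ((Nat.mod_modEq j b).symm).of_dvd (Finset.dvd_prod_of_mem P (Finset.mem_erase.2 ⟨hji, hj'⟩))
    · have hφi := hφ.ind i hi
      simp only [avL]
      rw [av_of_ind hP i _ (ind_avL i l φ hφi)]
      refine ih' U φ x (fun j hj => ?_) hφ
      rcases List.mem_cons.1 (hU j hj) with h | h
      · exact absurd (h ▸ hj) hi
      · exact h

lemma transfer (hP : ∀ i, 0 < P i) (l : List ℕ) (hnd : l.Nodup) (hcop : ∀ i ∈ l, ∀ j ∈ l, i ≠ j → Nat.Coprime (P i) (P j))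
    (U : Finset ℕ) (φ : (ℕ → ℕ) → ℝ) (x : ℕ → ℕ) (hU : ∀ i ∈ U, i ∈ l) (hφ : Dep P U φ) (M : ℝ) (hM : ∀ x, |φ x| ≤ M)
    (n : ℕ) (hn : 0 < n) :
    |(∑ j ∈ Finset.range n, φ (fun _ => j)) / n - avL P l φ x| ≤ 2 * (∏ i ∈ U, P i : ℕ) * M / n := by
  have hp : 0 < ∏ i ∈ U, P i := Finset.prod_pos fun j _ => hP j
  have h := periodic_sum (fun j => φ (fun _ => j)) (∏ i ∈ U, P i) hp (by
    intro j
    refine hφ _ _ fun i hi => ?_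
    have : (∏ i ∈ U, P i) ≡ 0 [MOD P i] := (Nat.modEq_zero_iff_dvd).2 (Finset.dvd_prod_of_mem P hi)
    simpa using this.add_right j) M (fun j => hM _) n
  rw [avL_crt hP l hnd hcop U φ x hU hφ] at h
  have hn' : (0:ℝ) < n := by exact_mod_cast hn
  have hp' : ((∏ i ∈ U, P i : ℕ) : ℝ) ≠ 0 := by exact_mod_cast hp.ne'
  rw [le_div_iff₀ hn', ← abs_of_pos hn', ← abs_mul, abs_of_pos hn']
  refine le_trans (le_of_eq ?_) h
  congr 1
  field_simp

end

def del (P : ℕ → ℕ) (i t j : ℕ) : ℝ := if j ≡ t [MOD P i] then (P i : ℝ) else 0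

noncomputable def ff (P : ℕ → ℕ) (n : ℕ) (a : ℕ → ℝ) (V S : Finset ℕ) (y x : ℕ → ℕ) : ℝ :=
  (∑ j ∈ Finset.range n, a j * (∏ i ∈ V, del P i (y i) j) * ∏ i ∈ S, (del P i (x i) j - 1)) / n

section
variable {P : ℕ → ℕ}

lemma del_nonneg (i t j : ℕ) : 0 ≤ del P i t j := by
  unfold del; split_ifs <;> positivity

lemma del_le (i t j : ℕ) : del P i t j ≤ P i := by
  unfold del; split_ifs
  · exact le_rfl
  · positivity

lemma del_sub_abs (hP : ∀ i, 0 < P i) (i t j : ℕ) : |del P i t j - 1| ≤ P i := by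
  have h1 := del_nonneg (P := P) i t j
  have h2 := del_le (P := P) i t j
  have h3 : (1:ℝ) ≤ P i := by exact_mod_cast hP i
  rw [abs_le]; constructor <;> linarith

lemma del_congr (i t t' j : ℕ) (h : t ≡ t' [MOD P i]) : del P i t j = del P i t' j := by
  unfold del
  have : (j ≡ t [MOD P i]) ↔ (j ≡ t' [MOD P i]) := ⟨fun h1 => h1.trans h, fun h1 => h1.trans h.symm⟩
  simp only [this]

lemma del_avg (hP : ∀ i, 0 < P i) (i j : ℕ) (φ : ℕ → ℝ) (hφ : ∀ t, φ (t % P i) = φ t) :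
    ∑ t ∈ Finset.range (P i), del P i t j * φ t = P i * φ j := by
  rw [Finset.sum_eq_single (j % P i)]
  · unfold del; rw [if_pos (Nat.mod_modEq _ _).symm, hφ]
  · intro t ht hne
    rw [Finset.mem_range] at ht
    unfold del; rw [if_neg, zero_mul]
    intro h
    apply hne
    have : j % P i = t % P i := h
    rw [this, Nat.mod_eq_of_lt ht]
  · intro h; exact absurd (Finset.mem_range.2 (Nat.mod_lt _ (hP i))) h

lemma del_avg1 (hP : ∀ i, 0 < P i) (i j : ℕ) : ∑ t ∈ Finset.range (P i), del P i t j = P i := by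
  simpa using del_avg hP i j (fun _ => 1) (fun _ => rfl)

lemma del_avg2 (hP : ∀ i, 0 < P i) (i j j' : ℕ) :
    (∑ t ∈ Finset.range (P i), (del P i t j - 1) * (del P i t j' - 1)) / P i = del P i j j' - 1 := by
  have h1 := del_avg hP i j (fun t => del P i t j' - 1) (fun t => by
    rw [del_congr i (t % P i) t j' (Nat.mod_modEq _ _)])
  have h2 := del_avg1 hP i j'
  have h3 : (P i : ℝ) ≠ 0 := by exact_mod_cast (hP i).ne'
  simp only [sub_mul, one_mul, Finset.sum_sub_distrib] at h1 ⊢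
  rw [h1, h2]
  simp only [Finset.sum_const, Finset.card_range, nsmul_eq_mul]
  field_simp
  ring

lemma avL_prod (l : List ℕ) (hnd : l.Nodup) (S : Finset ℕ) (κ : ℕ → ℕ → ℝ) (x : ℕ → ℕ) :
    avL P l (fun x => ∏ i ∈ S, κ i (x i)) x =
      (∏ i ∈ S, if i ∈ l then (∑ t ∈ Finset.range (P i), κ i t) / P i else κ i (x i)) * ∏ i ∈ l.toFinset \ S, ((P i : ℝ) / P i) := by
  induction l generalizing x with
  | nil => simp [avL]
  | cons j l ih =>
    obtain ⟨h1, h2⟩ := List.nodup_cons.1 hnd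
    simp only [avL, av]
    simp only [ih h2]
    rw [← Finset.sum_mul]
    have hj : j ∉ l.toFinset := by simpa using h1
    by_cases hjS : j ∈ S
    · have e1 : (j :: l).toFinset \ S = l.toFinset \ S := by
        ext i; simp only [List.toFinset_cons, Finset.mem_sdiff, Finset.mem_insert]
        constructor
        · rintro ⟨rfl | h, h'⟩
          · exact absurd hjS h'
          · exact ⟨h, h'⟩
        · tauto
      rw [e1, mul_div_right_comm]
      congr 1
      rw [← Finset.mul_prod_erase _ _ hjS, if_pos (by simp)]
      have : ∀ t, (∏ i ∈ S, if i ∈ l then (∑ t ∈ Finset.range (P i), κ i t) / (P i : ℝ) else κ i (Function.update x j t i)) =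
          κ j t * ∏ i ∈ S.erase j, if i ∈ j :: l then (∑ t ∈ Finset.range (P i), κ i t) / (P i : ℝ) else κ i (x i) := by
        intro t
        rw [← Finset.mul_prod_erase _ _ hjS, if_neg h1, Function.update_self]
        congr 1
        refine Finset.prod_congr rfl fun i hi => ?_
        have hne := Finset.ne_of_mem_erase hi
        simp [hne]
      simp only [this]
      rw [← Finset.sum_mul, mul_div_right_comm]
    · have e1 : (j :: l).toFinset \ S = insert j (l.toFinset \ S) := by
        ext i; simp only [List.toFinset_cons, Finset.mem_sdiff, Finset.mem_insert]
        constructor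
        · rintro ⟨rfl | h, h'⟩
          · left; rfl
          · exact Or.inr ⟨h, h'⟩
        · rintro (rfl | h)
          · exact ⟨Or.inl rfl, hjS⟩
          · exact ⟨Or.inr h.1, h.2⟩
      rw [e1, Finset.prod_insert (by simp [hj])]
      have : ∀ t, (∏ i ∈ S, if i ∈ l then (∑ t ∈ Finset.range (P i), κ i t) / (P i : ℝ) else κ i (Function.update x j t i)) =
          ∏ i ∈ S, if i ∈ j :: l then (∑ t ∈ Finset.range (P i), κ i t) / (P i : ℝ) else κ i (x i) := by
        intro t
        refine Finset.prod_congr rfl fun i hi => ?_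
        have hne : i ≠ j := fun h => hjS (h ▸ hi)
        simp [hne]
      simp only [this]
      simp only [Finset.sum_const, Finset.card_range, nsmul_eq_mul]
      ring

lemma avL_prod' (hP : ∀ i, 0 < P i) (l : List ℕ) (hnd : l.Nodup) (S : Finset ℕ) (hS : ∀ i ∈ S, i ∈ l) (κ : ℕ → ℕ → ℝ) (x : ℕ → ℕ) :
    avL P l (fun x => ∏ i ∈ S, κ i (x i)) x = ∏ i ∈ S, (∑ t ∈ Finset.range (P i), κ i t) / P i := by
  rw [avL_prod l hnd S κ x]
  rw [Finset.prod_eq_one (s := l.toFinset \ S), mul_one]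
  · exact Finset.prod_congr rfl fun i hi => if_pos (hS i hi)
  · intro i _
    have h3 : (P i : ℝ) ≠ 0 := by exact_mod_cast (hP i).ne'
    exact div_self h3

variable (n : ℕ) (a : ℕ → ℝ)

lemma ff_dep (V S : Finset ℕ) (y : ℕ → ℕ) : Dep P S (ff P n a V S y) := by
  intro x x' h
  unfold ff
  congr 1
  refine Finset.sum_congr rfl fun j _ => ?_
  congr 1
  refine Finset.prod_congr rfl fun i hi => ?_
  rw [del_congr i _ _ j (h i hi)]

lemma ff_ind (V S : Finset ℕ) (y : ℕ → ℕ) (i : ℕ) (hi : i ∉ S) : Ind i (ff P n a V S y) := (ff_dep n a V S y).ind i hi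

lemma ff_av (hP : ∀ i, 0 < P i) (V S : Finset ℕ) (y : ℕ → ℕ) (i : ℕ) (hi : i ∈ S) : av P i (ff P n a V S y) = fun _ => 0 := by
  funext x
  unfold ff av
  rw [← Finset.sum_div, Finset.sum_comm]
  rw [Finset.sum_eq_zero, zero_div, zero_div]
  intro j _
  rw [← Finset.mul_sum]
  have : ∀ t, ∏ i' ∈ S, (del P i' (Function.update x i t i') j - 1) = (del P i t j - 1) * ∏ i' ∈ S.erase i, (del P i' (x i') j - 1) := by
    intro t
    rw [← Finset.mul_prod_erase _ _ hi, Function.update_self]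
    congr 1
    refine Finset.prod_congr rfl fun i' hi' => ?_
    rw [Function.update_of_ne (Finset.ne_of_mem_erase hi')]
  simp only [this]
  rw [← Finset.sum_mul, Finset.sum_sub_distrib, del_avg1 hP]
  simp

/-- value of `avL f²` -/
lemma ff_sq (hP : ∀ i, 0 < P i) (V S : Finset ℕ) (y x : ℕ → ℕ) (l : List ℕ) (hnd : l.Nodup) (hS : ∀ i ∈ S, i ∈ l) :
    avL P l (fun x => ff P n a V S y x ^ 2) x =
      (∑ j ∈ Finset.range n, a j * (∏ i ∈ V, del P i (y i) j) * ff P n a V S y (fun _ => j)) / n := by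
  have e1 : (fun x => ff P n a V S y x ^ 2) = fun x => ∑ j ∈ Finset.range n, ∑ j' ∈ Finset.range n,
      ((a j * (∏ i ∈ V, del P i (y i) j)) * (a j' * (∏ i ∈ V, del P i (y i) j')) / n / n) *
        ∏ i ∈ S, ((del P i (x i) j - 1) * (del P i (x i) j' - 1)) := by
    funext x
    unfold ff
    rw [div_pow, sq, Finset.sum_mul_sum, Finset.sum_div]
    refine Finset.sum_congr rfl fun j _ => ?_
    rw [Finset.sum_div]
    refine Finset.sum_congr rfl fun j' _ => ?_
    rw [Finset.prod_mul_distrib]; ring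
  rw [e1, avL_sum, Finset.sum_div]
  refine Finset.sum_congr rfl fun j _ => ?_
  rw [avL_sum]
  unfold ff
  rw [mul_div_assoc', Finset.mul_sum, Finset.sum_div, Finset.sum_div]
  refine Finset.sum_congr rfl fun j' _ => ?_
  rw [avL_const_mul]
  beta_reduce
  rw [avL_prod' hP l hnd S hS (fun i t => (del P i t j - 1) * (del P i t j' - 1)) x]
  simp only [del_avg2 hP]
  ring

lemma ff_expand (V S T : Finset ℕ) (y x : ℕ → ℕ) (hT : T ⊆ S) (hV : Disjoint V T) :
    ff P n a V S y x = ∑ V' ∈ T.powerset, (-1) ^ (T \ V').card * ff P n a (V ∪ V') (S \ T) (fun i => if i ∈ V then y i else x i) x := by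
  unfold ff
  simp only [← mul_div_assoc, Finset.mul_sum]
  rw [← Finset.sum_div, Finset.sum_comm]
  congr 1
  refine Finset.sum_congr rfl fun j _ => ?_
  rw [← Finset.prod_sdiff hT]
  have e1 : ∏ i ∈ T, (del P i (x i) j - 1) = ∑ V' ∈ T.powerset, (∏ i ∈ V', del P i (x i) j) * (-1) ^ (T \ V').card := by
    simp only [sub_eq_add_neg]
    rw [Finset.prod_add]
    simp
  rw [e1, Finset.mul_sum, Finset.mul_sum]
  refine Finset.sum_congr rfl fun V' hV' => ?_
  rw [Finset.mem_powerset] at hV'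
  have hd : Disjoint V V' := Finset.disjoint_of_subset_right hV' hV
  rw [Finset.prod_union hd]
  have e2 : ∏ i ∈ V, del P i (if i ∈ V then y i else x i) j = ∏ i ∈ V, del P i (y i) j :=
    Finset.prod_congr rfl fun i hi => by rw [if_pos hi]
  have e3 : ∏ i ∈ V', del P i (if i ∈ V then y i else x i) j = ∏ i ∈ V', del P i (x i) j :=
    Finset.prod_congr rfl fun i hi => by rw [if_neg (fun h => Finset.disjoint_left.1 hd h hi)]
  rw [e2, e3]
  ring

lemma ff_y_congr (V S : Finset ℕ) (y y' x : ℕ → ℕ) (h : ∀ i ∈ V, y i = y' i) : ff P n a V S y x = ff P n a V S y' x := by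
  unfold ff
  congr 1
  refine Finset.sum_congr rfl fun j _ => ?_
  congr 2
  exact Finset.prod_congr rfl fun i hi => by rw [h i hi]

lemma ff_bound (hP : ∀ i, 0 < P i) (ha0 : ∀ j, 0 ≤ a j) (ha1 : ∀ j, a j ≤ 1) (V S : Finset ℕ) (y x : ℕ → ℕ) :
    |ff P n a V S y x| ≤ (∏ i ∈ V, (P i : ℝ)) * ∏ i ∈ S, (P i : ℝ) := by
  unfold ff
  have h0 : 0 ≤ (∏ i ∈ V, (P i : ℝ)) * ∏ i ∈ S, (P i : ℝ) := by positivity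
  rw [abs_div, Nat.abs_cast]
  refine div_le_of_le_mul₀ (by positivity) h0 ?_
  refine (Finset.abs_sum_le_sum_abs _ _).trans ?_
  refine (Finset.sum_le_sum (g := fun _ => (∏ i ∈ V, (P i : ℝ)) * ∏ i ∈ S, (P i : ℝ)) fun j _ => ?_).trans ?_
  · rw [abs_mul, abs_mul, Finset.abs_prod, Finset.abs_prod]
    refine mul_le_mul ?_ (Finset.prod_le_prod (fun _ _ => abs_nonneg _) fun i _ => del_sub_abs hP _ _ _) (by positivity) (by positivity)
    rw [← one_mul (∏ i ∈ V, (P i : ℝ))]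
    refine mul_le_mul (by rw [abs_of_nonneg (ha0 j)]; exact ha1 j) (Finset.prod_le_prod (fun _ _ => abs_nonneg _) fun i _ => ?_) (by positivity) (by positivity)
    rw [abs_of_nonneg (del_nonneg _ _ _)]; exact del_le _ _ _
  · simp [mul_comm]

end

lemma holder_even (n s : ℕ) (hs : 1 ≤ s) (u g : ℕ → ℝ) (hu : ∀ j, 0 ≤ u j) :
    (∑ j ∈ Finset.range n, u j * g j) ^ (2 * s) ≤
      (∑ j ∈ Finset.range n, u j) ^ (2 * s - 1) * ∑ j ∈ Finset.range n, u j * g j ^ (2 * s) := by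
  set U := ∑ j ∈ Finset.range n, u j with hU
  have hU0 : 0 ≤ U := Finset.sum_nonneg fun j _ => hu j
  rcases hU0.eq_or_lt with h | h
  · have : ∀ j ∈ Finset.range n, u j = 0 := (Finset.sum_eq_zero_iff_of_nonneg fun j _ => hu j).1 h.symm
    rw [Finset.sum_eq_zero (fun j hj => by rw [this j hj, zero_mul]), zero_pow (by omega)]
    refine mul_nonneg (by positivity) (Finset.sum_nonneg fun j _ => mul_nonneg (hu j) (Even.pow_nonneg (by simp) _))
  · have := Real.pow_arith_mean_le_arith_mean_pow_of_even (Finset.range n) (fun j => u j / U) g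
      (fun j _ => div_nonneg (hu j) hU0) (by rw [← Finset.sum_div, ← hU, div_self h.ne']) (n := 2 * s) (by simp)
    simp only [div_mul_eq_mul_div] at this
    rw [← Finset.sum_div, ← Finset.sum_div, div_pow, div_le_div_iff₀ (by positivity) h] at this
    have e : U ^ (2 * s) = U ^ (2 * s - 1) * U := by rw [← pow_succ]; congr 1; omega
    rw [e] at this
    nlinarith

lemma level_arith (W α : ℝ) (hα : 0 < α) (s d : ℕ) (hs : 1 ≤ s) (h3 : 1 ≤ 3 ^ s * α)
    (hW : 12 * α ^ 2 * (128 * s ^ 2) ^ d < W)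
    (h : W ^ (2 * s) ≤ (2 * α) ^ (2 * s - 1) * ((8 * s : ℝ) ^ (2 * d * s) * 2 ^ d * W ^ s + α ^ (2 * s))) : False := by
  have hs' : (1:ℝ) ≤ s := by exact_mod_cast hs
  set b : ℝ := 12 ^ s * α ^ (2 * s) * (128 * s ^ 2) ^ (d * s) with hb
  have hb0 : 0 < b := by positivity
  have hbx : b < W ^ s := by
    have := pow_lt_pow_left₀ hW (by positivity) (show s ≠ 0 by omega)
    calc b = (12 * α ^ 2 * (128 * s ^ 2) ^ d) ^ s := by rw [hb, mul_pow (12 * α ^ 2), mul_pow 12, ← pow_mul, ← pow_mul]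
      _ < _ := this
  have e0 : (2 * α) ^ (2 * s - 1) * (2 * α) = 4 ^ s * α ^ (2 * s) := by
    rw [← pow_succ, show 2 * s - 1 + 1 = 2 * s by omega, mul_pow, pow_mul]; norm_num
  have hc : (2 * α) ^ (2 * s - 1) * ((8 * s : ℝ) ^ (2 * d * s) * 2 ^ d) ≤ b / 2 := by
    have h1 : (8 * s : ℝ) ^ (2 * d * s) * 2 ^ d ≤ (128 * s ^ 2) ^ (d * s) := by
      have : (128 * (s:ℝ) ^ 2) ^ (d * s) = (8 * s : ℝ) ^ (2 * d * s) * 2 ^ (d * s) := by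
        rw [show 2 * d * s = 2 * (d * s) by ring, pow_mul (8 * (s:ℝ)) 2, ← mul_pow]; congr 1; ring
      rw [this]
      gcongr
      · norm_num
      · nlinarith
    have h2 : 4 ^ s * α ^ (2 * s) * ((8 * s : ℝ) ^ (2 * d * s) * 2 ^ d) ≤ b * α := by
      have e12 : (12:ℝ) ^ s = 4 ^ s * 3 ^ s := by rw [← mul_pow]; norm_num
      calc _ ≤ 4 ^ s * α ^ (2 * s) * (128 * s ^ 2) ^ (d * s) := by gcongr
        _ ≤ 4 ^ s * α ^ (2 * s) * (128 * s ^ 2) ^ (d * s) * (3 ^ s * α) := le_mul_of_one_le_right (by positivity) h3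
        _ = b * α := by rw [hb, e12]; ring
    rw [← e0] at h2
    have : 0 < 2 * α := by positivity
    refine le_of_mul_le_mul_right ?_ this
    linarith
  have he : (2 * α) ^ (2 * s - 1) * α ^ (2 * s) ≤ b ^ 2 / 2 := by
    have h1 : 12 ^ s * α ^ (2 * s) ≤ b := by
      rw [hb]; refine le_mul_of_one_le_right (by positivity) (one_le_pow₀ ?_); nlinarith
    have h2 : 4 ^ s * α ^ (2 * s) * α ^ (2 * s) ≤ b ^ 2 * α := by
      calc _ ≤ 4 ^ s * α ^ (2 * s) * α ^ (2 * s) * (3 ^ s * α) := le_mul_of_one_le_right (by positivity) h3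
        _ = 12 ^ s * α ^ (2 * s) * α ^ (2 * s) * α := by rw [show (12:ℝ) = 4 * 3 by norm_num, mul_pow]; ring
        _ ≤ 12 ^ s * α ^ (2 * s) * (12 ^ s * α ^ (2 * s)) * α := by
          gcongr; exact le_mul_of_one_le_left (by positivity) (one_le_pow₀ (by norm_num))
        _ ≤ b * b * α := by gcongr
        _ = _ := by ring
    rw [← e0] at h2
    have : 0 < 2 * α := by positivity
    refine le_of_mul_le_mul_right ?_ this
    linarith
  have hx : W ^ (2 * s) = (W ^ s) ^ 2 := by rw [← pow_mul]; congr 1; ring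
  rw [hx] at h
  nlinarith

section
variable {P : ℕ → ℕ}

lemma del_symm (i t j : ℕ) : del P i t j = del P i j t := by
  unfold del
  have : (j ≡ t [MOD P i]) ↔ (t ≡ j [MOD P i]) := ⟨fun h => h.symm, fun h => h.symm⟩
  simp only [this]

lemma wt_powersetCard (c : ℝ) (l : List ℕ) (hnd : l.Nodup) (S : Finset ℕ) (hS : S ⊆ l.toFinset) : wt c l S = c ^ S.card := by
  unfold wt
  rw [← List.prod_toFinset _ hnd, Finset.prod_ite, Finset.prod_const_one, mul_one, Finset.prod_const]
  congr 2
  ext i; simp only [Finset.mem_filter]; exact ⟨fun h => h.2, fun h => ⟨hS h, h⟩⟩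

lemma prod_le_Y (Y : ℝ) (hY : 1 ≤ Y) (V : Finset ℕ) (h : ∀ i ∈ V, (P i : ℝ) ≤ Y) (m : ℕ) (hm : V.card ≤ m) :
    ∏ i ∈ V, (P i : ℝ) ≤ Y ^ m := by
  calc _ ≤ ∏ i ∈ V, Y := Finset.prod_le_prod (fun _ _ => by positivity) h
    _ = Y ^ V.card := by simp
    _ ≤ _ := pow_le_pow_right₀ hY hm

/-- transfer of the `2s`-th moment -/
lemma moment_transfer (hP : ∀ i, 0 < P i) (I : Finset ℕ) (hcop : ∀ i ∈ I, ∀ j ∈ I, i ≠ j → Nat.Coprime (P i) (P j))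
    (Y : ℝ) (hY : 1 ≤ Y) (hPY : ∀ i ∈ I, (P i : ℝ) ≤ Y) (hIY : (I.card : ℝ) ≤ Y) (n : ℕ) (hn : 0 < n)
    (a : ℕ → ℝ) (ha0 : ∀ j, 0 ≤ a j) (ha1 : ∀ j, a j ≤ 1) (D s d : ℕ) (hs : 1 ≤ s)
    (B : List ℕ) (hnd : B.Nodup) (hBI : ∀ i ∈ B, i ∈ I) (V : Finset ℕ) (hVI : V ⊆ I) (hVB : ∀ i ∈ B, i ∉ V)
    (hVD : V.card + d ≤ D) (y x : ℕ → ℕ) (Θ : ℝ)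
    (hΘ : ∀ x, avL P B (fun x => (∑ S ∈ B.toFinset.powersetCard d, ff P n a V S y x) ^ (2 * s)) x ≤ Θ) :
    (∑ j ∈ Finset.range n, (∏ i ∈ V, del P i (y i) j) * (∑ S ∈ B.toFinset.powersetCard d, ff P n a V S y (fun _ => j)) ^ (2 * s)) / n
      ≤ Θ + 2 * Y ^ (8 * s * D) / n := by
  classical
  set 𝒮 := B.toFinset.powersetCard d with h𝒮
  set L := V.toList ++ B with hL
  have hmS : ∀ S ∈ 𝒮, S ⊆ B.toFinset ∧ S.card = d := fun S hS => Finset.mem_powersetCard.1 hS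
  have hBI' : B.toFinset ⊆ I := fun i hi => hBI i (by simpa using hi)
  have hLnd : L.Nodup := by
    rw [hL, List.nodup_append']
    refine ⟨V.nodup_toList, hnd, ?_⟩
    intro i hi hi'
    exact hVB i hi' (by simpa using hi)
  have hLI : ∀ i ∈ L, i ∈ I := by
    intro i hi
    rw [hL, List.mem_append, Finset.mem_toList] at hi
    rcases hi with h | h
    · exact hVI h
    · exact hBI i h
  set T := Fintype.piFinset (fun _ : Fin (2 * s) => 𝒮) with hT
  set ψ : (Fin (2 * s) → Finset ℕ) → (ℕ → ℕ) → ℝ := fun p x => (∏ i ∈ V, del P i (y i) (x i)) * ∏ r, ff P n a V (p r) y x with hψ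
  have hexp : ∀ x, (∏ i ∈ V, del P i (y i) (x i)) * (∑ S ∈ 𝒮, ff P n a V S y x) ^ (2 * s) = ∑ p ∈ T, ψ p x := by
    intro x
    simp only [hψ]
    rw [← Finset.mul_sum, hT, Finset.sum_prod_piFinset 𝒮 (fun _ S => ff P n a V S y x)]
    simp
  have hY0 : 0 ≤ Y := by linarith
  have htr : ∀ p ∈ T, |(∑ j ∈ Finset.range n, ψ p (fun _ => j)) / n - avL P L (ψ p) x| ≤ 2 * Y ^ (D + 2 * s * D) * Y ^ (D + 2 * s * D) / n := by
    intro p hp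
    have hp' : ∀ r, p r ∈ 𝒮 := by simpa [hT] using hp
    set U := V ∪ Finset.univ.biUnion p with hU
    have hUmem : ∀ i ∈ U, i ∈ I := by
      intro i hi
      simp only [hU, Finset.mem_union, Finset.mem_biUnion, Finset.mem_univ, true_and] at hi
      rcases hi with h | ⟨r, h⟩
      · exact hVI h
      · exact hBI' ((hmS _ (hp' r)).1 h)
    have hUcard : U.card ≤ D + 2 * s * D := by
      refine (Finset.card_union_le _ _).trans ?_
      refine add_le_add (by omega) ?_
      refine Finset.card_biUnion_le.trans ?_
      calc ∑ r, (p r).card = ∑ r : Fin (2 * s), d := Finset.sum_congr rfl fun r _ => (hmS _ (hp' r)).2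
        _ = 2 * s * d := by simp
        _ ≤ _ := by gcongr; omega
    refine (transfer hP L hLnd (fun i hi j hj => hcop i (hLI i hi) j (hLI j hj)) U (ψ p) x ?_ ?_ (Y ^ (D + 2 * s * D)) ?_ n hn).trans ?_
    · intro i hi
      rw [hL, List.mem_append, Finset.mem_toList]
      simp only [hU, Finset.mem_union, Finset.mem_biUnion, Finset.mem_univ, true_and] at hi
      rcases hi with h | ⟨r, h⟩
      · exact Or.inl h
      · exact Or.inr (by simpa using (hmS _ (hp' r)).1 h)
    · intro x x' hxx
      simp only [hψ]
      congr 1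
      · refine Finset.prod_congr rfl fun i hi => ?_
        rw [del_symm, del_symm i (y i), del_congr i _ _ _ (hxx i (by simp [hU, hi]))]
      · refine Finset.prod_congr rfl fun r _ => ff_dep n a V (p r) y _ _ fun i hi => hxx i ?_
        simp only [hU, Finset.mem_union, Finset.mem_biUnion, Finset.mem_univ, true_and]
        exact Or.inr ⟨r, hi⟩
    · intro x
      simp only [hψ]
      rw [abs_mul, Finset.abs_prod, Finset.abs_prod, pow_add]
      refine mul_le_mul ?_ ?_ (by positivity) (by positivity)
      · refine le_trans (Finset.prod_le_prod (fun _ _ => abs_nonneg _) fun i _ => ?_) (prod_le_Y Y hY V (fun i hi => hPY i (hVI hi)) D (by omega))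
        rw [abs_of_nonneg (del_nonneg _ _ _)]; exact del_le _ _ _
      · refine (Finset.prod_le_prod (g := fun _ => Y ^ D) (fun _ _ => abs_nonneg _) fun r _ => ?_).trans (le_of_eq ?_)
        · refine (ff_bound n a hP ha0 ha1 V (p r) y x).trans ?_
          calc _ ≤ Y ^ V.card * Y ^ d := by
                refine mul_le_mul (prod_le_Y Y hY V (fun i hi => hPY i (hVI hi)) _ le_rfl)
                  (prod_le_Y Y hY (p r) (fun i hi => hPY i (hBI' ((hmS _ (hp' r)).1 hi))) _ (hmS _ (hp' r)).2.le) (by positivity) (by positivity)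
            _ = Y ^ (V.card + d) := (pow_add _ _ _).symm
            _ ≤ Y ^ D := pow_le_pow_right₀ hY hVD
        · simp only [Finset.prod_const, Finset.card_univ, Fintype.card_fin, ← pow_mul]; congr 1; ring
    · gcongr
      push_cast
      exact prod_le_Y Y hY U (fun i hi => hPY i (hUmem i hi)) _ hUcard
  have hav : avL P L (fun x => ∑ p ∈ T, ψ p x) x ≤ Θ := by
    have : (fun x => ∑ p ∈ T, ψ p x) = fun x => (∏ i ∈ V, del P i (y i) (x i)) * (∑ S ∈ 𝒮, ff P n a V S y x) ^ (2 * s) := by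
      funext x; rw [hexp]
    rw [this, hL, avL_append, avL_mul_ind B]
    · refine (avL_mono (P := P) _ _ (fun x => Θ * ∏ i ∈ V, del P i (y i) (x i)) (fun x => ?_) x).trans ?_
      · rw [mul_comm]
        exact mul_le_mul_of_nonneg_right (hΘ x) (Finset.prod_nonneg fun i _ => del_nonneg _ _ _)
      · rw [avL_const_mul]
        beta_reduce
        rw [avL_prod' hP V.toList V.nodup_toList V (by simp) (fun i t => del P i (y i) t)]
        rw [Finset.prod_eq_one, mul_one]
        intro i _
        simp only [del_symm i (y i)]
        rw [del_avg1 hP, div_self]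
        exact_mod_cast (hP i).ne'
    · intro i hi x t
      refine Finset.prod_congr rfl fun j hj => ?_
      rw [Function.update_of_ne]
      rintro rfl; exact hVB _ hi hj
  have hn' : (0:ℝ) < n := by exact_mod_cast hn
  calc _ = ∑ p ∈ T, (∑ j ∈ Finset.range n, ψ p (fun _ => j)) / n := by
        rw [← Finset.sum_div, Finset.sum_comm]
        congr 1
        exact Finset.sum_congr rfl fun j _ => hexp (fun _ => j)
    _ ≤ ∑ p ∈ T, (avL P L (ψ p) x + 2 * Y ^ (D + 2 * s * D) * Y ^ (D + 2 * s * D) / n) := by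
        refine Finset.sum_le_sum fun p hp => ?_
        have := (abs_le.1 (htr p hp)).2
        linarith
    _ = avL P L (fun x => ∑ p ∈ T, ψ p x) x + T.card * (2 * Y ^ (D + 2 * s * D) * Y ^ (D + 2 * s * D) / n) := by
        rw [Finset.sum_add_distrib, avL_sum]; simp
    _ ≤ Θ + Y ^ (2 * s * D) * (2 * Y ^ (D + 2 * s * D) * Y ^ (D + 2 * s * D) / n) := by
        refine add_le_add hav ?_
        gcongr
        rw [hT, Fintype.card_piFinset_const]
        push_cast
        rw [show 2 * s * D = D * (2 * s) by ring, pow_mul Y]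
        refine pow_le_pow_left₀ (by positivity) ?_ _
        simp only [h𝒮, Finset.card_powersetCard]
        calc ((B.toFinset.card.choose d : ℕ) : ℝ) ≤ (B.toFinset.card : ℝ) ^ d := by exact_mod_cast Nat.choose_le_pow _ _
          _ ≤ (I.card : ℝ) ^ d := by gcongr
          _ ≤ Y ^ d := by gcongr
          _ ≤ Y ^ D := pow_le_pow_right₀ hY (by omega)
    _ = Θ + 2 * Y ^ (2 * s * D + (D + 2 * s * D) + (D + 2 * s * D)) / n := by rw [pow_add, pow_add]; ring
    _ ≤ _ := by
        gcongr
        nlinarith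

end

section
variable {P : ℕ → ℕ}

lemma level (hP : ∀ i, 0 < P i) (I : Finset ℕ) (hcop : ∀ i ∈ I, ∀ j ∈ I, i ≠ j → Nat.Coprime (P i) (P j))
    (Y : ℝ) (hY : 1 ≤ Y) (hPY : ∀ i ∈ I, (P i : ℝ) ≤ Y) (hIY : (I.card : ℝ) ≤ Y) (n : ℕ) (hn : 0 < n)
    (a : ℕ → ℝ) (ha0 : ∀ j, 0 ≤ a j) (ha1 : ∀ j, a j ≤ 1) (D s : ℕ) (hs : 1 ≤ s) (α : ℝ) (hα : 0 < α)
    (hdens : ∀ V ⊆ I, V.card ≤ D → ∀ y : ℕ → ℕ, (∑ j ∈ Finset.range n, a j * ∏ i ∈ V, del P i (y i) j) / n ≤ 2 * α)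
    (h3 : 1 ≤ 3 ^ s * α) (hbig : 2 * Y ^ (8 * s * D) ≤ n * α ^ (2 * s)) (d : ℕ) :
    ∀ (B : List ℕ), B.Nodup → (∀ i ∈ B, i ∈ I) → ∀ V ⊆ I, (∀ i ∈ B, i ∉ V) → V.card + d ≤ D → ∀ y x : ℕ → ℕ,
      ∑ S ∈ B.toFinset.powersetCard d, avL P B (fun x => ff P n a V S y x ^ 2) x ≤ 12 * α ^ 2 * (128 * s ^ 2) ^ d := by
  classical
  have hn' : (0:ℝ) < n := by exact_mod_cast hn
  have hs' : (1:ℝ) ≤ s := by exact_mod_cast hs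
  induction d using Nat.strong_induction_on with
  | _ d ih =>
  intro B hnd hBI V hVI hVB hVD y x
  set 𝒮 := B.toFinset.powersetCard d with h𝒮
  have hmS : ∀ S ∈ 𝒮, S ⊆ B.toFinset ∧ S.card = d := fun S hS => Finset.mem_powersetCard.1 hS
  have hBI' : B.toFinset ⊆ I := fun i hi => hBI i (by simpa using hi)
  set u : ℕ → ℝ := fun j => a j * ∏ i ∈ V, del P i (y i) j with hu
  have hu0 : ∀ j, 0 ≤ u j := fun j => mul_nonneg (ha0 j) (Finset.prod_nonneg fun i _ => del_nonneg _ _ _)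
  set g : (ℕ → ℕ) → ℝ := fun x => ∑ S ∈ 𝒮, ff P n a V S y x with hg
  set W : ℝ := (∑ j ∈ Finset.range n, u j * g (fun _ => j)) / n with hW
  have hWeq : ∀ (B' : List ℕ), B'.Nodup → (∀ i ∈ B, i ∈ B') → ∀ x, ∑ S ∈ 𝒮, avL P B' (fun x => ff P n a V S y x ^ 2) x = W := by
    intro B' hB' hBB x
    rw [hW]
    simp only [hg, Finset.mul_sum]
    rw [Finset.sum_comm, Finset.sum_div]
    refine Finset.sum_congr rfl fun S hS => ?_
    rw [ff_sq n a hP V S y x B' hB' (fun i hi => hBB i (by simpa using (hmS S hS).1 hi))]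
  rw [hWeq B hnd (fun i hi => hi) x]
  by_contra hcon
  push Not at hcon
  have hWpos : 0 < W := lt_of_le_of_lt (by positivity) hcon
  set f : Finset ℕ → (ℕ → ℕ) → ℝ := fun S => ff P n a V S y with hf
  have hf1 : ∀ S i, i ∉ S → Ind i (f S) := fun S i hi => ff_ind n a V S y i hi
  have hf2 : ∀ S i, i ∈ S → av P i (f S) = fun _ => 0 := fun S i hi => ff_av n a hP V S y i hi
  have hleaf : ∀ (T : Finset ℕ) (B' : List ℕ), B'.Nodup → (∀ i ∈ B', i ∉ T ∧ i ∈ B.toFinset) → T ⊆ B.toFinset →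
      (∀ i ∈ B.toFinset, i ∉ T → i ∈ B') → ∀ x, avL P B' (fun x => (∑ S ∈ 𝒮 with T ⊆ S, f S x) ^ 2) x ≤ W := by
    intro T B' hnd' hB' hT hI' x₀
    by_cases hTe : T = ∅
    · subst hTe
      have hBB : ∀ i ∈ B, i ∈ B' := fun i hi => hI' i (by simpa using hi) (by simp)
      rw [Finset.filter_true_of_mem (fun S _ => Finset.empty_subset S)]
      rw [diag f hf1 hf2 𝒮 B' (fun S hS S' _ i hi _ => hBB i (by simpa using (hmS S hS).1 hi)) x₀]
      exact (hWeq B' hnd' hBB x₀).le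
    · refine le_trans ?_ hcon.le
      have hTpos : 1 ≤ T.card := Finset.card_pos.2 (Finset.nonempty_iff_ne_empty.2 hTe)
      by_cases hTd : d < T.card
      · rw [Finset.filter_false_of_mem]
        · simp only [Finset.sum_empty]
          rw [avL_const hP]; norm_num; positivity
        · intro S hS hTS
          have := Finset.card_le_card hTS
          rw [(hmS S hS).2] at this; omega
      · push Not at hTd
        have hB'f : B'.toFinset = B.toFinset \ T := by
          ext i; rw [List.mem_toFinset, Finset.mem_sdiff]
          exact ⟨fun h => ⟨(hB' i h).2, (hB' i h).1⟩, fun h => hI' i h.1 h.2⟩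
        have hVT : Disjoint V T := by
          rw [Finset.disjoint_left]; intro i hi hi'
          exact hVB i (by simpa using hT hi') hi
        set yy : (ℕ → ℕ) → ℕ → ℕ := fun x i => if i ∈ V then y i else x i with hyy
        set G : Finset ℕ → (ℕ → ℕ) → ℝ := fun V' x => ∑ S' ∈ B'.toFinset.powersetCard (d - T.card), ff P n a (V ∪ V') S' (yy x₀) x with hG
        have e1 : ∀ x, (∀ i, i ∉ B' → x i = x₀ i) → (∑ S ∈ 𝒮 with T ⊆ S, f S x) = ∑ V' ∈ T.powerset, (-1) ^ (T \ V').card * G V' x := by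
          intro x hx
          simp only [hG, Finset.mul_sum]
          rw [Finset.sum_comm]
          refine Finset.sum_nbij' (fun S => S \ T) (fun S' => S' ∪ T) ?_ ?_ ?_ ?_ ?_
          · intro S hS
            obtain ⟨hS1, hS2⟩ := Finset.mem_filter.1 hS
            rw [Finset.mem_powersetCard, hB'f, Finset.card_sdiff_of_subset hS2, (hmS S hS1).2]
            exact ⟨Finset.sdiff_subset_sdiff (hmS S hS1).1 le_rfl, rfl⟩
          · intro S' hS'
            rw [Finset.mem_powersetCard, hB'f] at hS'
            have hd' : Disjoint S' T := Finset.disjoint_of_subset_left hS'.1 Finset.sdiff_disjoint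
            rw [Finset.mem_filter, h𝒮, Finset.mem_powersetCard, Finset.card_union_of_disjoint hd', hS'.2]
            exact ⟨⟨Finset.union_subset (hS'.1.trans Finset.sdiff_subset) hT, by omega⟩, Finset.subset_union_right⟩
          · intro S hS
            exact Finset.sdiff_union_of_subset (Finset.mem_filter.1 hS).2
          · intro S' hS'
            rw [Finset.mem_powersetCard, hB'f] at hS'
            have hd' : Disjoint S' T := Finset.disjoint_of_subset_left hS'.1 Finset.sdiff_disjoint
            exact Finset.union_sdiff_cancel_right hd'
          · intro S hS
            simp only [hf]
            rw [ff_expand n a V S T y x (Finset.mem_filter.1 hS).2 hVT]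
            refine Finset.sum_congr rfl fun V' hV' => ?_
            rw [Finset.mem_powerset] at hV'
            congr 1
            refine ff_y_congr n a _ _ _ _ _ fun i hi => ?_
            simp only [hyy]
            by_cases hiV : i ∈ V
            · rw [if_pos hiV, if_pos hiV]
            · rw [if_neg hiV, if_neg hiV]
              refine hx i fun hi' => (hB' i hi').1 (hV' ?_)
              exact (Finset.mem_union.1 hi).resolve_left hiV
        rw [avL_congr B' _ (fun x => (∑ V' ∈ T.powerset, (-1) ^ (T \ V').card * G V' x) ^ 2) x₀ (fun x hx => by rw [e1 x hx])]
        have e2 : ∀ x, (∑ V' ∈ T.powerset, (-1) ^ (T \ V').card * G V' x) ^ 2 ≤ 2 ^ T.card * ∑ V' ∈ T.powerset, G V' x ^ 2 := by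
          intro x
          refine (sq_sum_le_card_mul_sum_sq).trans (le_of_eq ?_)
          rw [Finset.card_powerset]
          push_cast
          congr 1
          refine Finset.sum_congr rfl fun V' _ => ?_
          rw [mul_pow, ← pow_mul, mul_comm _ 2, pow_mul]; norm_num
        refine (avL_mono B' _ _ e2 x₀).trans ?_
        rw [avL_const_mul, avL_sum]
        have e3 : ∀ V' ∈ T.powerset, avL P B' (fun x => G V' x ^ 2) x₀ ≤ 12 * α ^ 2 * (128 * s ^ 2) ^ (d - T.card) := by
          intro V' hV'
          rw [Finset.mem_powerset] at hV'
          simp only [hG]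
          rw [diag (fun S' => ff P n a (V ∪ V') S' (yy x₀)) (fun S i hi => ff_ind n a _ S _ i hi) (fun S i hi => ff_av n a hP _ S _ i hi)
            _ B' (fun S hS S' _ i hi _ => by simpa using (Finset.mem_powersetCard.1 hS).1 hi) x₀]
          refine ih (d - T.card) (by omega) B' hnd' (fun i hi => hBI' (hB' i hi).2) (V ∪ V') ?_ ?_ ?_ _ _
          · exact Finset.union_subset hVI ((hV'.trans hT).trans hBI')
          · intro i hi hi'
            rcases Finset.mem_union.1 hi' with h | h
            · exact hVB i (by simpa using (hB' i hi).2) h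
            · exact (hB' i hi).1 (hV' h)
          · have := Finset.card_union_le V V'
            have := Finset.card_le_card hV'
            omega
        calc _ ≤ 2 ^ T.card * ∑ V' ∈ T.powerset, 12 * α ^ 2 * (128 * (s:ℝ) ^ 2) ^ (d - T.card) := by
              exact mul_le_mul_of_nonneg_left (Finset.sum_le_sum e3) (by positivity)
          _ = 12 * α ^ 2 * (4 ^ T.card * (128 * (s:ℝ) ^ 2) ^ (d - T.card)) := by
              rw [Finset.sum_const, Finset.card_powerset, nsmul_eq_mul, show (4:ℝ) ^ T.card = 2 ^ T.card * 2 ^ T.card by rw [← mul_pow]; norm_num]; push_cast; ring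
          _ ≤ 12 * α ^ 2 * ((128 * (s:ℝ) ^ 2) ^ T.card * (128 * (s:ℝ) ^ 2) ^ (d - T.card)) := by
              gcongr; nlinarith
          _ = _ := by rw [← pow_add]; congr 2; omega
  have hΘ : ∀ x, avL P B (fun x => g x ^ (2 * s)) x ≤ (8 * s : ℝ) ^ (2 * d * s) * 2 ^ d * W ^ s := by
    intro x
    have h := hyper hP s hs f hf1 hf2 B.toFinset 𝒮 (fun S hS => (hmS S hS).1) W hleaf B ∅ [] (by simpa using hnd)
      (by intro i hi; simpa using hi) (by simp) (by intro i hi _; simpa using hi) x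
    simp only [avL] at h
    rw [Finset.filter_true_of_mem (fun S _ => Finset.empty_subset S)] at h
    have e1 : ∀ x, ∑ S ∈ 𝒮, wt (1 / (8 * s)) B S * f S x = (1 / (8 * s)) ^ d * g x := by
      intro x
      rw [hg, Finset.mul_sum]
      refine Finset.sum_congr rfl fun S hS => ?_
      rw [wt_powersetCard _ B hnd S (hmS S hS).1, (hmS S hS).2]
    have e2 : ∑ S ∈ 𝒮, wt 2 B S * avL P B (fun x => f S x ^ 2) x = 2 ^ d * W := by
      rw [← hWeq B hnd (fun i hi => hi) x, Finset.mul_sum]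
      refine Finset.sum_congr rfl fun S hS => ?_
      rw [wt_powersetCard _ B hnd S (hmS S hS).1, (hmS S hS).2]
    rw [e2] at h
    have e3 : (fun x => ((∑ S ∈ 𝒮, wt (1 / (8 * s)) B S * f S x) ^ 2) ^ s) = fun x => (1 / (8 * s : ℝ)) ^ (2 * d * s) * g x ^ (2 * s) := by
      funext x
      rw [e1, ← pow_mul, mul_pow, ← pow_mul]; congr 2; ring
    rw [e3, avL_const_mul] at h
    have e4 : W ^ (s - 1) * (2 ^ d * W) = 2 ^ d * W ^ s := by
      rw [show s = s - 1 + 1 by omega, pow_succ]; simp; ring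
    rw [e4, one_div, inv_pow, inv_mul_le_iff₀ (by positivity)] at h
    linarith
  have hmt := moment_transfer hP I hcop Y hY hPY hIY n hn a ha0 ha1 D s d hs B hnd hBI V hVI hVB hVD y x _ hΘ
  have hh := holder_even n s hs u (fun j => g (fun _ => j)) hu0
  have hdV := hdens V hVI (by omega) y
  have hfin : W ^ (2 * s) ≤ (2 * α) ^ (2 * s - 1) * ((8 * s : ℝ) ^ (2 * d * s) * 2 ^ d * W ^ s + α ^ (2 * s)) := by
    have hQ0 : 0 ≤ (∑ j ∈ Finset.range n, u j * g (fun _ => j) ^ (2 * s)) / n :=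
      div_nonneg (Finset.sum_nonneg fun j _ => mul_nonneg (hu0 j) (Even.pow_nonneg (by simp) _)) hn'.le
    calc W ^ (2 * s) ≤ ((∑ j ∈ Finset.range n, u j) / n) ^ (2 * s - 1) * ((∑ j ∈ Finset.range n, u j * g (fun _ => j) ^ (2 * s)) / n) := by
          rw [hW, div_pow, div_pow, div_mul_div_comm, ← pow_succ, show 2 * s - 1 + 1 = 2 * s by omega]
          gcongr
      _ ≤ (2 * α) ^ (2 * s - 1) * ((∑ j ∈ Finset.range n, u j * g (fun _ => j) ^ (2 * s)) / n) := by
          refine mul_le_mul_of_nonneg_right (pow_le_pow_left₀ (div_nonneg (Finset.sum_nonneg fun j _ => hu0 j) hn'.le) hdV _) hQ0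
      _ ≤ _ := by
          refine mul_le_mul_of_nonneg_left ?_ (by positivity)
          refine le_trans ?_ (hmt.trans ?_)
          · gcongr with j hj
            · exact Even.pow_nonneg (by simp) _
            · simp only [hu]
              exact mul_le_of_le_one_left (Finset.prod_nonneg fun i _ => del_nonneg _ _ _) (ha1 j)
          · gcongr
            rw [div_le_iff₀ hn']; linarith
  exact level_arith W α hα s d hs h3 hcon hfin

end

lemma e_orth (Z : ℕ) (hZ : 0 < Z) (m : ℤ) (hm : |m| < Z) :
    ∑ ξ ∈ Finset.range Z, e (m * ((ξ:ℝ) / Z)) = if m = 0 then (Z:ℂ) else 0 := by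
  have hZ' : (Z:ℝ) ≠ 0 := by exact_mod_cast hZ.ne'
  split_ifs with h
  · subst h; simp [e_zero]
  · have h1 : ∀ ξ : ℕ, e (m * ((ξ:ℝ) / Z)) = e (m / Z) ^ ξ := by
      intro ξ
      rw [← e_nat_mul]; congr 1; ring
    simp only [h1]
    have hne : e ((m:ℝ) / Z) ≠ 1 := by
      intro h2
      have h3 := four_torusNorm_le ((m:ℝ) / Z)
      rw [h2, sub_self, norm_zero] at h3
      have h4 : torusNorm ((m:ℝ) / Z) = 0 := le_antisymm (by linarith) (torusNorm_nonneg _)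
      unfold torusNorm at h4
      rw [abs_eq_zero, sub_eq_zero, div_eq_iff hZ'] at h4
      have h5 : m = round ((m:ℝ) / Z) * Z := by exact_mod_cast h4
      have h6 : (Z:ℤ) ∣ m := ⟨_, by rw [mul_comm]; exact h5⟩
      exact h (Int.eq_zero_of_abs_lt_dvd h6 hm)
    rw [geom_sum_eq hne, ← e_nat_mul]
    have : (Z:ℝ) * (m / Z) = (m:ℤ) := by field_simp
    rw [this, e_int, sub_self, zero_div]

lemma e_conj (x : ℝ) : (starRingEnd ℂ) (e x) = e (-x) := (e_neg x).symm

lemma corr (s : Finset ℤ) (F : ℤ → ℝ) (Z : ℕ) (hZ : 0 < Z) (h : ℤ) (hs : ∀ x ∈ s, ∀ x' ∈ s, |x - x'| + |h| < Z) :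
    ∑ ξ ∈ Finset.range Z, ((‖∑ x ∈ s, (F x : ℂ) * e (x * ((ξ:ℝ) / Z))‖ ^ 2 : ℝ) : ℂ) * e (h * ((ξ:ℝ) / Z)) =
      Z * ∑ x ∈ s, ∑ x' ∈ s, if x' = x + h then ((F x * F x' : ℝ) : ℂ) else 0 := by
  have e1 : ∀ ξ : ℕ, ((‖∑ x ∈ s, (F x : ℂ) * e (x * ((ξ:ℝ) / Z))‖ ^ 2 : ℝ) : ℂ) * e (h * ((ξ:ℝ) / Z)) =
      ∑ x ∈ s, ∑ x' ∈ s, ((F x * F x' : ℝ) : ℂ) * e (((x + h - x' : ℤ) : ℝ) * ((ξ:ℝ) / Z)) := by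
    intro ξ
    rw [← Complex.normSq_eq_norm_sq, Complex.normSq_eq_conj_mul_self, mul_comm ((starRingEnd ℂ) _), map_sum, Finset.sum_mul_sum, Finset.sum_mul]
    refine Finset.sum_congr rfl fun x _ => ?_
    rw [Finset.sum_mul]
    refine Finset.sum_congr rfl fun x' _ => ?_
    rw [map_mul, e_conj, Complex.conj_ofReal]
    have : e (((x + h - x' : ℤ) : ℝ) * ((ξ:ℝ) / Z)) = e (x * ((ξ:ℝ) / Z)) * e (-(x' * ((ξ:ℝ) / Z))) * e (h * ((ξ:ℝ) / Z)) := by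
      rw [← e_add, ← e_add]; congr 1; push_cast; ring
    rw [this]; push_cast; ring
  simp only [e1]
  rw [Finset.sum_comm, Finset.mul_sum]
  refine Finset.sum_congr rfl fun x hx => ?_
  rw [Finset.sum_comm, Finset.mul_sum]
  refine Finset.sum_congr rfl fun x' hx' => ?_
  rw [← Finset.mul_sum, e_orth Z hZ]
  · by_cases h0 : x' = x + h
    · rw [if_pos h0, if_pos (by omega), mul_comm]
    · rw [if_neg h0, if_neg (by omega), mul_zero, mul_zero]
  · have := hs x hx x' hx'
    refine lt_of_le_of_lt ?_ this
    rw [show x + h - x' = (x - x') + h by ring]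
    exact abs_add_le _ _

lemma parseval (s : Finset ℤ) (F : ℤ → ℝ) (Z : ℕ) (hZ : 0 < Z) (hs : ∀ x ∈ s, ∀ x' ∈ s, |x - x'| < Z) :
    ∑ ξ ∈ Finset.range Z, ‖∑ x ∈ s, (F x : ℂ) * e (x * ((ξ:ℝ) / Z))‖ ^ 2 = Z * ∑ x ∈ s, F x ^ 2 := by
  have := corr s F Z hZ 0 (by simpa using hs)
  simp only [Int.cast_zero, zero_mul, e_zero, mul_one, add_zero, Finset.sum_ite_eq', ] at this
  have h2 : ∑ x ∈ s, (if x ∈ s then ((F x * F x : ℝ) : ℂ) else 0) = ((∑ x ∈ s, F x ^ 2 : ℝ) : ℂ) := by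
    push_cast
    refine Finset.sum_congr rfl fun x hx => ?_
    rw [if_pos hx]; push_cast; ring
  rw [h2] at this
  exact_mod_cast this

lemma shift_sumZ {β : Type*} [AddCommMonoid β] (Ω A : Finset ℤ) (c : ℤ) (hΩ : ∀ x ∈ A, x - c ∈ Ω) (φ : ℤ → β) :
    ∑ X ∈ Ω, (if X + c ∈ A then φ X else 0) = ∑ x ∈ A, φ (x - c) := by
  rw [← Finset.sum_filter]
  refine Finset.sum_nbij' (fun X => X + c) (fun x => x - c) ?_ ?_ ?_ ?_ ?_
  · intro X hX; exact (Finset.mem_filter.1 hX).2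
  · intro x hx; rw [Finset.mem_filter]; exact ⟨hΩ x hx, by simpa using hx⟩
  · intro X _; ring
  · intro x _; ring
  · intro X _; simp

/-- weighted window averages -/
noncomputable def Fw (A : Finset ℤ) (n : ℕ) (q0 : ℕ) (κ : ℕ → ℝ) (X : ℤ) : ℝ :=
  (∑ j ∈ Finset.range n, κ j * (if X + q0 * j ∈ A then 1 else 0)) / n

noncomputable def muw (n : ℕ) (q0 : ℕ) (κ : ℕ → ℝ) (γ : ℝ) : ℂ :=
  (∑ j ∈ Finset.range n, (κ j : ℂ) * e (-(q0 * j * γ))) / n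

lemma Fw_hat (A Ω : Finset ℤ) (n q0 : ℕ) (κ : ℕ → ℝ) (γ : ℝ) (hΩ : ∀ x ∈ A, ∀ j < n, x - q0 * j ∈ Ω) :
    ∑ X ∈ Ω, (Fw A n q0 κ X : ℂ) * e (X * γ) = (∑ x ∈ A, e (x * γ)) * muw n q0 κ γ := by
  unfold Fw muw
  have e1 : ∀ X : ℤ, (((∑ j ∈ Finset.range n, κ j * (if X + q0 * j ∈ A then 1 else 0)) / n : ℝ) : ℂ) * e (X * γ) =
      ∑ j ∈ Finset.range n, ((κ j : ℂ) / n) * (if X + (q0 * j : ℤ) ∈ A then e (X * γ) else 0) := by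
    intro X
    push_cast
    rw [Finset.sum_div, Finset.sum_mul]
    refine Finset.sum_congr rfl fun j _ => ?_
    split_ifs with hc
    · push_cast; ring
    · push_cast; ring
  simp only [e1]
  rw [Finset.sum_comm, mul_div_assoc', Finset.mul_sum, Finset.sum_div]
  refine Finset.sum_congr rfl fun j hj => ?_
  rw [← Finset.mul_sum, shift_sumZ Ω A (q0 * j : ℤ) (fun x hx => hΩ x hx j (Finset.mem_range.1 hj))]
  have : ∀ x : ℤ, e (((x - q0 * j : ℤ) : ℝ) * γ) = e (x * γ) * e (-(q0 * j * γ)) := by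
    intro x; rw [← e_add]; congr 1; push_cast; ring
  simp only [this]
  rw [← Finset.sum_mul]; ring

lemma Fw_sum (A Ω : Finset ℤ) (n q0 : ℕ) (hn : 0 < n) (c : ℤ) (hΩ : ∀ x ∈ A, ∀ j < n, x - q0 * j - c ∈ Ω) :
    ∑ X ∈ Ω, Fw A n q0 (fun _ => 1) (X + c) = A.card := by
  unfold Fw
  rw [← Finset.sum_div, Finset.sum_comm]
  have : ∀ j ∈ Finset.range n, ∑ X ∈ Ω, (1:ℝ) * (if X + c + q0 * j ∈ A then 1 else 0) = A.card := by
    intro j hj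
    simp only [one_mul]
    have h := shift_sumZ (β := ℝ) Ω A (c + q0 * j) (fun x hx => by
      have := hΩ x hx j (Finset.mem_range.1 hj)
      rwa [show x - (c + q0 * j) = x - q0 * j - c by ring]) (fun _ => 1)
    simp only [← add_assoc] at h
    rw [h]; simp
  rw [Finset.sum_congr rfl this]
  have hn' : (n:ℝ) ≠ 0 := by exact_mod_cast hn.ne'
  simp; field_simp

lemma Fw_nonneg (A : Finset ℤ) (n q0 : ℕ) (X : ℤ) : 0 ≤ Fw A n q0 (fun _ => 1) X := by
  unfold Fw
  refine div_nonneg (Finset.sum_nonneg fun j _ => ?_) (by positivity)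
  split_ifs <;> simp

lemma Fw_zero (A Ω : Finset ℤ) (n q0 : ℕ) (hΩ : ∀ x ∈ A, ∀ j < n, x - q0 * j ∈ Ω) (X : ℤ) (hX : X ∉ Ω) (κ : ℕ → ℝ) : Fw A n q0 κ X = 0 := by
  unfold Fw
  rw [Finset.sum_eq_zero, zero_div]
  intro j hj
  rw [if_neg, mul_zero]
  intro h
  have := hΩ _ h j (Finset.mem_range.1 hj)
  rw [add_sub_cancel_right] at this
  exact hX this

lemma muw_one_le (n q0 : ℕ) (γ : ℝ) : ‖muw n q0 (fun _ => 1) γ‖ ≤ 1 := by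
  unfold muw
  rw [norm_div, Complex.norm_natCast]
  refine div_le_one_of_le₀ ?_ (by positivity)
  refine (norm_sum_le _ _).trans ?_
  simp [norm_e]

lemma Cg_lower (A Ω : Finset ℤ) (n q0 : ℕ) (hn : 0 < n) (h : ℤ) (b : ℝ)
    (hΩ0 : ∀ x ∈ A, ∀ j < n, x - q0 * j ∈ Ω) (hΩ : ∀ x ∈ A, ∀ j < n, x - q0 * j - h ∈ Ω)
    (hg : ∀ X, Fw A n q0 (fun _ => 1) X ≤ b) :
    2 * b * A.card - b ^ 2 * Ω.card ≤ ∑ X ∈ Ω, ∑ X' ∈ Ω, if X' = X + h then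
      Fw A n q0 (fun _ => 1) X * Fw A n q0 (fun _ => 1) X' else 0 := by
  have e1 : ∀ X ∈ Ω, (∑ X' ∈ Ω, if X' = X + h then
      Fw A n q0 (fun _ => 1) X * Fw A n q0 (fun _ => 1) X' else 0) =
      Fw A n q0 (fun _ => 1) X * Fw A n q0 (fun _ => 1) (X + h) := by
    intro X _
    rw [Finset.sum_ite_eq']
    split_ifs with h1
    · rfl
    · rw [Fw_zero A Ω n q0 hΩ0 (X + h) h1, mul_zero]
  rw [Finset.sum_congr rfl e1]
  have s1 := Fw_sum A Ω n q0 hn 0 (by simpa using hΩ0)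
  have s2 := Fw_sum A Ω n q0 hn h hΩ
  simp only [add_zero] at s1
  have : ∑ X ∈ Ω, (b * Fw A n q0 (fun _ => 1) X + b * Fw A n q0 (fun _ => 1) (X + h) - b ^ 2) ≤
      ∑ X ∈ Ω, Fw A n q0 (fun _ => 1) X * Fw A n q0 (fun _ => 1) (X + h) := by
    refine Finset.sum_le_sum fun X _ => ?_
    nlinarith [mul_nonneg (sub_nonneg.2 (hg X)) (sub_nonneg.2 (hg (X + h)))]
  refine le_trans (le_of_eq ?_) this
  rw [Finset.sum_sub_distrib, Finset.sum_add_distrib, ← Finset.mul_sum, ← Finset.mul_sum, s1, s2]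
  simp; ring

lemma ite_cast0 (p : Prop) [Decidable p] (a : ℝ) : (if p then (a:ℂ) else 0) = ((if p then a else 0 : ℝ) : ℂ) := by
  split_ifs <;> simp

lemma bad_count (H : Polynomial ℤ) (k M : ℕ) (hk : H.natDegree = k) (h0 : H ≠ 0) :
    (((Finset.range M).filter (fun n : ℕ => H.eval (n:ℤ) = 0)).card : ℝ) ≤ k := by
  have : ((Finset.range M).filter (fun n : ℕ => H.eval (n:ℤ) = 0)).card ≤ H.roots.toFinset.card := by
    refine Finset.card_le_card_of_injOn (fun n : ℕ => (n:ℤ)) ?_ (fun a _ b _ h => by simpa using h)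
    intro n hn
    simp only [Finset.coe_filter, Set.mem_ofPred_eq] at hn
    simp [h0, hn.2]
  have h2 := (this.trans (Multiset.toFinset_card_le _)).trans (Polynomial.card_roots' H)
  rw [hk] at h2
  exact_mod_cast h2

lemma tn_lower (A : Finset ℤ) (N n q0 L Z : ℕ) (hA : A ⊆ Finset.Icc 1 (N:ℤ)) (h : ℤ) (α : ℝ) (hα : 0 < α) (hN : 0 < N)
    (hcard : (A.card:ℝ) = α * N) (hn : 0 < n) (hL : q0 * n + |h| ≤ L) (hLN : 50 * L ≤ N) (hZ : Z = 2 * N)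
    (hg : ∀ X, Fw A n q0 (fun _ => 1) X ≤ 21 / 20 * α) :
    Z * (0.95 * α ^ 2 * N - ∑ x ∈ A, ∑ x' ∈ A, if x' = x + h then (1:ℝ) else 0) ≤
    ∑ ξ ∈ Finset.range Z, ‖∑ x ∈ A, e (x * ((ξ:ℝ) / Z))‖ ^ 2 * (‖muw n q0 (fun _ => 1) ((ξ:ℝ) / Z)‖ ^ 2 - 1) * (e (h * ((ξ:ℝ) / Z))).re := by
  set Ω : Finset ℤ := Finset.Ico (1 - (L:ℤ)) (N + 1 + L) with hΩd
  have hh := abs_nonneg h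
  have hΩ0 : ∀ x ∈ A, ∀ j < n, x - q0 * j ∈ Ω := by
    intro x hx j hj
    have := Finset.mem_Icc.1 (hA hx)
    have h1 : (q0:ℤ) * j ≤ q0 * n := by
      have : q0 * j ≤ q0 * n := Nat.mul_le_mul_left _ hj.le
      exact_mod_cast this
    have h2 : (0:ℤ) ≤ q0 * j := by positivity
    rw [hΩd, Finset.mem_Ico]; constructor <;> linarith
  have hΩ : ∀ x ∈ A, ∀ j < n, x - q0 * j - h ∈ Ω := by
    intro x hx j hj
    have := Finset.mem_Icc.1 (hA hx)
    have h1 : (q0:ℤ) * j ≤ q0 * n := by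
      have : q0 * j ≤ q0 * n := Nat.mul_le_mul_left _ hj.le
      exact_mod_cast this
    have h2 : (0:ℤ) ≤ q0 * j := by positivity
    have h3 := abs_le.1 (le_refl |h|)
    rw [hΩd, Finset.mem_Ico]; constructor <;> linarith
  have hLh : |h| ≤ L := by
    have : (0:ℤ) ≤ q0 * n := by positivity
    linarith
  have hZ0 : 0 < Z := by omega
  have hcardΩ : (Ω.card : ℝ) ≤ 1.04 * N := by
    have : Ω.card ≤ N + 2 * L := by rw [hΩd, Int.card_Ico]; omega
    have h1 : (Ω.card : ℝ) ≤ N + 2 * L := by exact_mod_cast this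
    have h2 : (50:ℝ) * L ≤ N := by exact_mod_cast hLN
    linarith
  have hlow := Cg_lower A Ω n q0 hn h _ hΩ0 hΩ hg
  have c1 := corr Ω (Fw A n q0 (fun _ => 1)) Z hZ0 h (by
    intro x hx x' hx'
    rw [hΩd, Finset.mem_Ico] at hx hx'
    have : |x - x'| ≤ N + 2 * L := by rw [abs_le]; constructor <;> omega
    have : 50 * (L:ℤ) ≤ N := by exact_mod_cast hLN
    rw [hZ]; push_cast
    omega)
  have c2 := corr A (fun _ => 1) Z hZ0 h (by
    intro x hx x' hx'
    have := Finset.mem_Icc.1 (hA hx)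
    have := Finset.mem_Icc.1 (hA hx')
    have : |x - x'| ≤ N := by rw [abs_le]; constructor <;> omega
    have : 50 * (L:ℤ) ≤ N := by exact_mod_cast hLN
    rw [hZ]; push_cast
    omega)
  have r1 := congrArg Complex.re c1
  have r2 := congrArg Complex.re c2
  have z1 : (Z * ∑ x ∈ Ω, ∑ x' ∈ Ω, if x' = x + h then ((Fw A n q0 (fun _ => 1) x * Fw A n q0 (fun _ => 1) x' : ℝ) : ℂ) else 0) =
     ((Z * ∑ x ∈ Ω, ∑ x' ∈ Ω, if x' = x + h then (Fw A n q0 (fun _ => 1) x * Fw A n q0 (fun _ => 1) x' : ℝ) else 0 : ℝ) : ℂ) := by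
    simp only [ite_cast0]; push_cast; rfl
  have z2 : (Z * ∑ x ∈ A, ∑ x' ∈ A, if x' = x + h then (((1:ℝ) * 1 : ℝ) : ℂ) else 0) =
     ((Z * ∑ x ∈ A, ∑ x' ∈ A, if x' = x + h then (1:ℝ) else 0 : ℝ) : ℂ) := by
    simp only [ite_cast0]; push_cast; simp
  rw [z1, Complex.ofReal_re, Complex.re_sum] at r1
  rw [z2, Complex.ofReal_re, Complex.re_sum] at r2
  simp only [Complex.re_ofReal_mul, Fw_hat A Ω n q0 _ _ hΩ0, norm_mul, mul_pow] at r1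
  simp only [Complex.re_ofReal_mul, Complex.ofReal_one, one_mul] at r2
  have e3 : ∑ ξ ∈ Finset.range Z, ‖∑ x ∈ A, e (x * ((ξ:ℝ) / Z))‖ ^ 2 * (‖muw n q0 (fun _ => 1) ((ξ:ℝ) / Z)‖ ^ 2 - 1) * (e (h * ((ξ:ℝ) / Z))).re =
    Z * (∑ x ∈ Ω, ∑ x' ∈ Ω, if x' = x + h then (Fw A n q0 (fun _ => 1) x * Fw A n q0 (fun _ => 1) x' : ℝ) else 0) - Z * ∑ x ∈ A, ∑ x' ∈ A, if x' = x + h then (1:ℝ) else 0 := by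
    rw [← r1, ← r2, ← Finset.sum_sub_distrib]
    refine Finset.sum_congr rfl fun ξ _ => ?_
    ring
  rw [e3, ← mul_sub]
  refine mul_le_mul_of_nonneg_left ?_ (by positivity)
  refine sub_le_sub_right (le_trans ?_ hlow) _
  rw [hcard]
  have : α ^ 2 * Ω.card ≤ α ^ 2 * (1.04 * N) := mul_le_mul_of_nonneg_left hcardΩ (by positivity)
  nlinarith [mul_pos (pow_pos hα 2) (Nat.cast_pos (α := ℝ).2 hN)]

lemma fourier_main (A : Finset ℤ) (N n q0 L k M : ℕ) (hA : A ⊆ Finset.Icc 1 (N:ℤ)) (H : Polynomial ℤ) (α : ℝ) (hα : 0 < α) (hα1 : α ≤ 1) (hN : 0 < N)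
    (hcard : (A.card:ℝ) = α * N) (hdeg : H.natDegree = k) (hH0 : H ≠ 0)
    (hfree : ∀ a ∈ A, ∀ b ∈ A, a ≠ b → ∀ n : ℕ, 0 < n → a - b ≠ H.eval (n:ℤ))
    (hM : 100 * (k + 2) ≤ M * α) (hn : 0 < n) (hL : ∀ n' : ℕ, 0 < n' → n' < M → q0 * n + |H.eval (n':ℤ)| ≤ L) (hLN : 50 * L ≤ N)
    (hg : ∀ X, Fw A n q0 (fun _ => 1) X ≤ 21 / 20 * α)
    (Ψ : ℝ → ℝ)
    (hpt : ∀ γ, ‖∑ n' ∈ Finset.range M, e (γ * (H.eval (n':ℤ) : ℤ))‖ * (1 - ‖muw n q0 (fun _ => 1) γ‖ ^ 2) ≤ M * (α / 8 + Ψ γ))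
    (hΨ : ∑ ξ ∈ Finset.range (2 * N), ‖∑ x ∈ A, e (x * ((ξ:ℝ) / (2 * N : ℕ)))‖ ^ 2 * Ψ ((ξ:ℝ) / (2 * N : ℕ)) ≤ (2 * N : ℕ) * (α ^ 2 * N / 4)) : False := by
  set Z : ℕ := 2 * N with hZ
  have hZ0 : 0 < Z := by omega
  have hpar : ∑ ξ ∈ Finset.range Z, ‖∑ x ∈ A, e (x * ((ξ:ℝ) / Z))‖ ^ 2 = Z * A.card := by
    have := parseval A (fun _ => 1) Z hZ0 (by
      intro x hx x' hx'
      have := Finset.mem_Icc.1 (hA hx)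
      have := Finset.mem_Icc.1 (hA hx')
      have : |x - x'| ≤ N := by rw [abs_le]; constructor <;> omega
      rw [hZ]; push_cast
      omega)
    simpa using this
  set t : ℕ → ℝ := fun n' => ∑ ξ ∈ Finset.range Z, ‖∑ x ∈ A, e (x * ((ξ:ℝ) / Z))‖ ^ 2 * (‖muw n q0 (fun _ => 1) ((ξ:ℝ) / Z)‖ ^ 2 - 1) * (e ((H.eval (n':ℤ) : ℤ) * ((ξ:ℝ) / Z))).re with ht
  have hNα : 0 < α * N := by positivity
  have hmu : ∀ γ, ‖muw n q0 (fun _ => 1) γ‖ ^ 2 ≤ 1 := fun γ => pow_le_one₀ (norm_nonneg _) (muw_one_le n q0 γ)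
  have hlow : ∀ n' ∈ Finset.range M, (Z:ℝ) * (0.95 * α ^ 2 * N - (if n' = 0 then 2 * (α * N) else 0) - (if H.eval (n':ℤ) = 0 then α * N else 0)) ≤ t n' := by
    intro n' hn'
    rw [Finset.mem_range] at hn'
    rcases Nat.eq_zero_or_pos n' with h0 | h0
    · rw [if_pos h0]
      have h1 : -((Z:ℝ) * (α * N)) ≤ t n' := by
        rw [← hcard, ← hpar, ht, ← Finset.sum_neg_distrib]
        refine Finset.sum_le_sum fun ξ _ => ?_
        have a1 := hmu ((ξ:ℝ) / Z)
        have a2 : |(e ((H.eval (n':ℤ) : ℤ) * ((ξ:ℝ) / Z))).re| ≤ 1 := (Complex.abs_re_le_norm _).trans (norm_e _).le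
        have a3 := abs_le.1 a2
        have a4 : 0 ≤ ‖∑ x ∈ A, e (x * ((ξ:ℝ) / Z))‖ ^ 2 := by positivity
        have a5 : -1 ≤ (‖muw n q0 (fun _ => 1) ((ξ:ℝ) / Z)‖ ^ 2 - 1) * (e ((H.eval (n':ℤ) : ℤ) * ((ξ:ℝ) / Z))).re := by
          have : 0 ≤ ‖muw n q0 (fun _ => 1) ((ξ:ℝ) / Z)‖ ^ 2 := by positivity
          nlinarith
        rw [mul_assoc]
        nlinarith
      refine le_trans ?_ h1
      rw [← mul_neg]
      refine mul_le_mul_of_nonneg_left ?_ (by positivity)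
      have : 0 ≤ (if H.eval (n':ℤ) = 0 then α * N else 0) := by split_ifs <;> positivity
      nlinarith
    · rw [if_neg h0.ne']
      have := tn_lower A N n q0 L Z hA (H.eval (n':ℤ)) α hα hN hcard hn (hL n' h0 hn') hLN hZ hg
      refine le_trans ?_ this
      refine mul_le_mul_of_nonneg_left ?_ (by positivity)
      rw [sub_zero]
      refine sub_le_sub_left ?_ _
      split_ifs with h1
      · rw [h1, ← hcard]
        refine le_of_eq ?_
        simp only [add_zero, Finset.sum_ite_eq']
        simp
      · refine le_of_eq (Finset.sum_eq_zero fun x hx => Finset.sum_eq_zero fun x' hx' => ?_)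
        rw [if_neg]
        intro h2
        refine hfree x' hx' x hx ?_ n' h0 (by omega)
        omega
  have hsum := Finset.sum_le_sum hlow
  have hup : ∑ n' ∈ Finset.range M, t n' ≤ Z * (M * (α / 8 * (α * N) + α ^ 2 * N / 4)) := by
    have e1 : ∑ n' ∈ Finset.range M, t n' = ∑ ξ ∈ Finset.range Z, ‖∑ x ∈ A, e (x * ((ξ:ℝ) / Z))‖ ^ 2 * (‖muw n q0 (fun _ => 1) ((ξ:ℝ) / Z)‖ ^ 2 - 1) *
        (∑ n' ∈ Finset.range M, e (((ξ:ℝ) / Z) * (H.eval (n':ℤ) : ℤ))).re := by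
      rw [ht, Finset.sum_comm]
      refine Finset.sum_congr rfl fun ξ _ => ?_
      rw [Complex.re_sum, Finset.mul_sum]
      refine Finset.sum_congr rfl fun n' _ => ?_
      rw [mul_comm ((ξ:ℝ) / Z)]
    have e2 : ∀ ξ ∈ Finset.range Z, ‖∑ x ∈ A, e (x * ((ξ:ℝ) / Z))‖ ^ 2 * (‖muw n q0 (fun _ => 1) ((ξ:ℝ) / Z)‖ ^ 2 - 1) *
        (∑ n' ∈ Finset.range M, e (((ξ:ℝ) / Z) * (H.eval (n':ℤ) : ℤ))).re ≤
        M * (α / 8 * ‖∑ x ∈ A, e (x * ((ξ:ℝ) / Z))‖ ^ 2 + ‖∑ x ∈ A, e (x * ((ξ:ℝ) / Z))‖ ^ 2 * Ψ ((ξ:ℝ) / Z)) := by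
      intro ξ _
      have a0 : 0 ≤ ‖∑ x ∈ A, e (x * ((ξ:ℝ) / Z))‖ ^ 2 := by positivity
      have a1 := hpt ((ξ:ℝ) / Z)
      have a2 := (abs_le.1 (Complex.abs_re_le_norm (∑ n' ∈ Finset.range M, e (((ξ:ℝ) / Z) * (H.eval (n':ℤ) : ℤ))))).1
      have a3 := hmu ((ξ:ℝ) / Z)
      have a4 : (‖muw n q0 (fun _ => 1) ((ξ:ℝ) / Z)‖ ^ 2 - 1) * (∑ n' ∈ Finset.range M, e (((ξ:ℝ) / Z) * (H.eval (n':ℤ) : ℤ))).re ≤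
        M * (α / 8 + Ψ ((ξ:ℝ) / Z)) := by nlinarith
      rw [mul_assoc]
      have := mul_le_mul_of_nonneg_left a4 a0
      linarith
    rw [e1]
    refine (Finset.sum_le_sum e2).trans ?_
    rw [← Finset.mul_sum, Finset.sum_add_distrib, ← Finset.mul_sum, hpar, hcard]
    have : (M:ℝ) * (α / 8 * (Z * (α * N)) + ∑ ξ ∈ Finset.range Z, ‖∑ x ∈ A, e (x * ((ξ:ℝ) / Z))‖ ^ 2 * Ψ ((ξ:ℝ) / Z)) ≤
      M * (α / 8 * (Z * (α * N)) + Z * (α ^ 2 * N / 4)) := mul_le_mul_of_nonneg_left (by linarith) (by positivity)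
    linarith
  have hlow2 : (Z:ℝ) * (M * (0.95 * α ^ 2 * N) - (k + 2) * (α * N)) ≤ ∑ n' ∈ Finset.range M, t n' := by
    refine le_trans ?_ hsum
    rw [← Finset.mul_sum]
    refine mul_le_mul_of_nonneg_left ?_ (by positivity)
    rw [Finset.sum_sub_distrib, Finset.sum_sub_distrib]
    have b1 : ∑ n' ∈ Finset.range M, (if n' = 0 then 2 * (α * N) else 0) ≤ 2 * (α * N) := by
      rw [Finset.sum_ite_eq']; split_ifs <;> linarith
    have b2 : ∑ n' ∈ Finset.range M, (if H.eval (n':ℤ) = 0 then α * N else 0) ≤ k * (α * N) := by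
      rw [← Finset.sum_filter, Finset.sum_const, nsmul_eq_mul]
      exact mul_le_mul_of_nonneg_right (bad_count H k M hdeg hH0) hNα.le
    simp only [Finset.sum_const, Finset.card_range, nsmul_eq_mul]
    linarith
  have hfin := hlow2.trans hup
  have hfin2 := le_of_mul_le_mul_left hfin (by exact_mod_cast hZ0)
  have : (k + 2) * (α * N) ≤ 0.01 * M * α * (α * N) := mul_le_mul_of_nonneg_right (by linarith) hNα.le
  have hMpos : 0 < (M:ℝ) * α := by
    have : (0:ℝ) ≤ k := by positivity
    linarith
  have : 0 < (M:ℝ) * α * (α * N) := by positivity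
  linarith

noncomputable def kap (P : ℕ → ℕ) (S : Finset ℕ) (y : ℕ → ℕ) (j : ℕ) : ℝ := ∏ i ∈ S, (del P i (y i) j - 1)

noncomputable def aX (A : Finset ℤ) (q0 : ℕ) (X : ℤ) (j : ℕ) : ℝ := if X + q0 * j ∈ A then 1 else 0

lemma Fw_kap (P : ℕ → ℕ) (A : Finset ℤ) (n q0 : ℕ) (S : Finset ℕ) (y y' : ℕ → ℕ) (X : ℤ) :
    Fw A n q0 (kap P S y) X = ff P n (aX A q0 X) ∅ S y' y := by
  unfold Fw ff kap aX
  congr 1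
  refine Finset.sum_congr rfl fun j _ => ?_
  simp [mul_comm]

noncomputable def Psi (P : ℕ → ℕ) (I : Finset ℕ) (n q0 D : ℕ) (w : ℝ) (γ : ℝ) : ℝ :=
  ∑ r ∈ Finset.Icc 1 D, ∑ S ∈ I.powersetCard r, 8 / w ^ r * avL P I.toList (fun y => ‖muw n q0 (kap P S y) γ‖ ^ 2) (fun _ => 0)

lemma geo_aux (D : ℕ) : ∑ r ∈ Finset.Icc 1 D, ((1:ℝ) / 2048) ^ r ≤ 1 / 2047 := by
  have : ∀ D : ℕ, ∑ r ∈ Finset.Icc 1 D, ((1:ℝ) / 2048) ^ r ≤ 1 / 2047 - 1 / 2047 * (1 / 2048) ^ D := by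
    intro D
    induction D with
    | zero => simp
    | succ m ih =>
      rw [Finset.sum_Icc_succ_top (by omega), pow_succ]
      linarith
  refine (this D).trans ?_
  have : (0:ℝ) < (1 / 2048) ^ D := by positivity
  linarith

lemma Psi_bound (P : ℕ → ℕ) (I : Finset ℕ) (A : Finset ℤ) (N n q0 L D s : ℕ) (w α : ℝ) (hs : 1 ≤ s) (hw : 2 ^ 18 * (s:ℝ) ^ 2 ≤ w)
    (hA : A ⊆ Finset.Icc 1 (N:ℤ)) (hN : 0 < N) (hL : q0 * n ≤ L) (hLN : 50 * L ≤ N)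
    (hlev : ∀ X r, 1 ≤ r → r ≤ D → ∑ S ∈ I.powersetCard r, avL P I.toList (fun y => ff P n (aX A q0 X) ∅ S (fun _ => 0) y ^ 2) (fun _ => 0) ≤
      12 * α ^ 2 * (128 * (s:ℝ) ^ 2) ^ r) :
    ∑ ξ ∈ Finset.range (2 * N), ‖∑ x ∈ A, e (x * ((ξ:ℝ) / (2 * N : ℕ)))‖ ^ 2 * Psi P I n q0 D w ((ξ:ℝ) / (2 * N : ℕ)) ≤ (2 * N : ℕ) * (α ^ 2 * N / 4) := by
  set Z : ℕ := 2 * N with hZ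
  have hZ0 : 0 < Z := by omega
  set Ω : Finset ℤ := Finset.Ico (1 - (L:ℤ)) (N + 1) with hΩd
  have hs' : (1:ℝ) ≤ s := by exact_mod_cast hs
  have hw0 : 0 < w := lt_of_lt_of_le (by positivity) hw
  have hΩ0 : ∀ x ∈ A, ∀ j < n, x - q0 * j ∈ Ω := by
    intro x hx j hj
    have := Finset.mem_Icc.1 (hA hx)
    have h1 : (q0:ℤ) * j ≤ q0 * n := by
      have : q0 * j ≤ q0 * n := Nat.mul_le_mul_left _ hj.le
      exact_mod_cast this
    have h2 : (0:ℤ) ≤ q0 * j := by positivity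
    have h3 : (q0 * n : ℤ) ≤ L := by exact_mod_cast hL
    rw [hΩd, Finset.mem_Ico]; constructor <;> linarith
  have hcardΩ : (Ω.card : ℝ) ≤ 2 * N := by
    have : Ω.card ≤ N + L := by rw [hΩd, Int.card_Ico]; omega
    have : Ω.card ≤ 2 * N := by omega
    exact_mod_cast this
  have hpar : ∀ S y, ∑ ξ ∈ Finset.range Z, ‖∑ x ∈ A, e (x * ((ξ:ℝ) / Z))‖ ^ 2 * ‖muw n q0 (kap P S y) ((ξ:ℝ) / Z)‖ ^ 2 =
      Z * ∑ X ∈ Ω, ff P n (aX A q0 X) ∅ S (fun _ => 0) y ^ 2 := by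
    intro S y
    have := parseval Ω (Fw A n q0 (kap P S y)) Z hZ0 (by
      intro x hx x' hx'
      rw [hΩd, Finset.mem_Ico] at hx hx'
      have : |x - x'| ≤ N + L := by rw [abs_le]; constructor <;> omega
      rw [hZ]; push_cast
      omega)
    simp only [Fw_hat A Ω n q0 _ _ hΩ0, norm_mul, mul_pow] at this
    simp only [Fw_kap P A n q0 S y (fun _ => 0)] at this
    exact this
  unfold Psi
  simp only [Finset.mul_sum]
  rw [Finset.sum_comm]
  have hr : ∀ r ∈ Finset.Icc 1 D, ∑ ξ ∈ Finset.range Z, ∑ S ∈ I.powersetCard r, ‖∑ x ∈ A, e (x * ((ξ:ℝ) / Z))‖ ^ 2 *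
      (8 / w ^ r * avL P I.toList (fun y => ‖muw n q0 (kap P S y) ((ξ:ℝ) / Z)‖ ^ 2) (fun _ => 0)) ≤
      Z * (2 * N * (96 * α ^ 2)) * (1 / 2048) ^ r := by
    intro r hr
    rw [Finset.mem_Icc] at hr
    have e1 : ∑ ξ ∈ Finset.range Z, ∑ S ∈ I.powersetCard r, ‖∑ x ∈ A, e (x * ((ξ:ℝ) / Z))‖ ^ 2 *
      (8 / w ^ r * avL P I.toList (fun y => ‖muw n q0 (kap P S y) ((ξ:ℝ) / Z)‖ ^ 2) (fun _ => 0)) =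
      8 / w ^ r * (Z * ∑ X ∈ Ω, ∑ S ∈ I.powersetCard r, avL P I.toList (fun y => ff P n (aX A q0 X) ∅ S (fun _ => 0) y ^ 2) (fun _ => 0)) := by
      rw [Finset.sum_comm, Finset.sum_comm (s := Ω), Finset.mul_sum, Finset.mul_sum]
      refine Finset.sum_congr rfl fun S _ => ?_
      have h1 := congrFun (avL_sum (P := P) Ω I.toList (fun X y => ff P n (aX A q0 X) ∅ S (fun _ => 0) y ^ 2)) (fun _ => 0)
      have h2 := congrFun (avL_sum (P := P) (Finset.range Z) I.toList (fun ξ y => ‖∑ x ∈ A, e (x * ((ξ:ℝ) / Z))‖ ^ 2 * ‖muw n q0 (kap P S y) ((ξ:ℝ) / Z)‖ ^ 2)) (fun _ => 0)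
      simp only [avL_const_mul, hpar] at h2
      rw [← h1, h2, Finset.mul_sum]
      refine Finset.sum_congr rfl fun ξ _ => ?_
      ring
    rw [e1]
    have h3 : ∑ X ∈ Ω, ∑ S ∈ I.powersetCard r, avL P I.toList (fun y => ff P n (aX A q0 X) ∅ S (fun _ => 0) y ^ 2) (fun _ => 0) ≤
        2 * N * (12 * α ^ 2 * (128 * (s:ℝ) ^ 2) ^ r) := by
      refine (Finset.sum_le_sum fun X _ => hlev X r hr.1 hr.2).trans ?_
      rw [Finset.sum_const, nsmul_eq_mul]
      exact mul_le_mul_of_nonneg_right hcardΩ (by positivity)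
    have h4 : 8 / w ^ r * (128 * (s:ℝ) ^ 2) ^ r ≤ 8 * (1 / 2048) ^ r := by
      rw [div_mul_eq_mul_div, mul_div_assoc, ← div_pow]
      refine mul_le_mul_of_nonneg_left ?_ (by norm_num)
      refine pow_le_pow_left₀ (by positivity) ?_ _
      rw [div_le_iff₀ hw0]; linarith
    calc _ ≤ 8 / w ^ r * (Z * (2 * N * (12 * α ^ 2 * (128 * (s:ℝ) ^ 2) ^ r))) := by
          refine mul_le_mul_of_nonneg_left (mul_le_mul_of_nonneg_left h3 (by positivity)) (by positivity)
      _ = Z * (2 * N * (12 * α ^ 2)) * (8 / w ^ r * (128 * (s:ℝ) ^ 2) ^ r) := by ring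
      _ ≤ Z * (2 * N * (12 * α ^ 2)) * (8 * (1 / 2048) ^ r) := mul_le_mul_of_nonneg_left h4 (by positivity)
      _ = _ := by ring
  refine (Finset.sum_le_sum hr).trans ?_
  rw [← Finset.mul_sum]
  refine (mul_le_mul_of_nonneg_left (geo_aux D) (by positivity)).trans ?_
  have : 0 ≤ (Z:ℝ) * (N * α ^ 2) := by positivity
  linarith

lemma prog_sum {β : Type*} [AddCommMonoid β] (n P r : ℕ) (hP : 0 < P) (f : ℕ → β) :
    ∑ j ∈ Finset.range n, (if j ≡ r [MOD P] then f j else 0) =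
      ∑ m ∈ Finset.range ((n - r % P + (P - 1)) / P), f (r % P + P * m) := by
  rw [← Finset.sum_filter]
  have key : ∀ m, m < (n - r % P + (P - 1)) / P ↔ m * P < n - r % P := by
    intro m
    rw [← Nat.succ_le_iff, Nat.le_div_iff_mul_le hP, Nat.succ_mul]
    omega
  refine Finset.sum_nbij' (fun j => j / P) (fun m => r % P + P * m) ?_ ?_ ?_ ?_ ?_
  · intro j hj
    rw [Finset.mem_filter, Finset.mem_range] at hj
    have h1 : j % P = r % P := hj.2
    have h2 := Nat.mod_add_div j P
    rw [Finset.mem_range, key]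
    rw [h1] at h2
    rw [mul_comm]; omega
  · intro m hm
    rw [Finset.mem_range, key, mul_comm] at hm
    rw [Finset.mem_filter, Finset.mem_range]
    refine ⟨by omega, ?_⟩
    unfold Nat.ModEq
    rw [Nat.add_mul_mod_self_left, Nat.mod_mod]
  · intro j hj
    rw [Finset.mem_filter, Finset.mem_range] at hj
    have h1 : j % P = r % P := hj.2
    have h2 := Nat.mod_add_div j P
    simp only [← h1]; exact h2
  · intro m _
    rw [Nat.add_mul_div_left _ _ hP, Nat.div_eq_of_lt (Nat.mod_lt _ hP), zero_add]
  · intro j hj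
    rw [Finset.mem_filter, Finset.mem_range] at hj
    have h1 : j % P = r % P := hj.2
    have h2 := Nat.mod_add_div j P
    simp only [← h1, h2]

lemma del_crt (P : ℕ → ℕ) (y : ℕ → ℕ) (T : Finset ℕ) (hcop : ∀ i ∈ T, ∀ j ∈ T, i ≠ j → Nat.Coprime (P i) (P j)) :
    ∃ r : ℕ, ∀ j, ∏ i ∈ T, del P i (y i) j = if j ≡ r [MOD ∏ i ∈ T, P i] then ((∏ i ∈ T, P i : ℕ) : ℝ) else 0 := by
  classical
  induction T using Finset.induction_on with
  | empty => exact ⟨0, fun j => by simp [Nat.modEq_one]⟩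
  | insert a T ha ih =>
    obtain ⟨r, hr⟩ := ih (fun i hi j hj => hcop i (Finset.mem_insert_of_mem hi) j (Finset.mem_insert_of_mem hj))
    have hc : Nat.Coprime (P a) (∏ i ∈ T, P i) := Nat.Coprime.prod_right fun i hi =>
      hcop a (Finset.mem_insert_self _ _) i (Finset.mem_insert_of_mem hi) (fun h => ha (h ▸ hi))
    refine ⟨Nat.chineseRemainder hc (y a) r, fun j => ?_⟩
    have hx := (Nat.chineseRemainder hc (y a) r).2
    rw [Finset.prod_insert ha, Finset.prod_insert ha, hr]
    unfold del
    have : (j ≡ (Nat.chineseRemainder hc (y a) r : ℕ) [MOD P a * ∏ i ∈ T, P i]) ↔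
      (j ≡ y a [MOD P a] ∧ j ≡ r [MOD ∏ i ∈ T, P i]) := by
      rw [← Nat.modEq_and_modEq_iff_modEq_mul hc]
      exact ⟨fun h => ⟨h.1.trans hx.1, h.2.trans hx.2⟩, fun h => ⟨h.1.trans hx.1.symm, h.2.trans hx.2.symm⟩⟩
    rw [if_congr this rfl rfl]
    by_cases h1 : j ≡ y a [MOD P a]
    · by_cases h2 : j ≡ r [MOD ∏ i ∈ T, P i]
      · rw [if_pos h1, if_pos h2, if_pos ⟨h1, h2⟩]; push_cast; rfl
      · rw [if_neg h2, if_neg (c := _ ∧ _) (fun h => h2 h.2), mul_zero]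
    · rw [if_neg h1, if_neg (c := _ ∧ _) (fun h => h1 h.1), zero_mul]

lemma mu_lower (P : ℕ → ℕ) (hP : ∀ i, 0 < P i) (S : Finset ℕ) (hcop : ∀ i ∈ S, ∀ j ∈ S, i ≠ j → Nat.Coprime (P i) (P j))
    (n q0 : ℕ) (hn : 0 < n) (y : ℕ → ℕ) (γ θ Qm : ℝ) (a : ℤ) (q' : ℕ) (hq' : 0 < q') (hγ : γ = a / q' + θ)
    (hdvd : q' ∣ q0 * ∏ i ∈ S, P i) (hθ : 2 * Real.pi * (q0 * n * |θ|) ≤ 1 / 8) (hQ : 1 ≤ Qm)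
    (hT : ∀ T, T ⊂ S → 1 ≤ 2 * Qm * torusNorm (q0 * (∏ i ∈ T, P i : ℕ) * γ))
    (hbig : 8 * 2 ^ S.card * (∏ i ∈ S, P i : ℕ) * Qm ≤ n) :
    1 / 2 ≤ ‖muw n q0 (kap P S y) γ‖ := by
  classical
  have hn' : (0:ℝ) < n := by exact_mod_cast hn
  set G : Finset ℕ → ℂ := fun T => ∑ j ∈ Finset.range n, ((∏ i ∈ T, del P i (y i) j : ℝ) : ℂ) * e (-(q0 * j * γ)) with hG
  set PP : Finset ℕ → ℕ := fun T => ∏ i ∈ T, P i with hPP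
  have hPPpos : ∀ T, 0 < PP T := fun T => Finset.prod_pos fun i _ => hP i
  have e1 : ∑ j ∈ Finset.range n, ((kap P S y j : ℝ) : ℂ) * e (-(q0 * j * γ)) =
      ∑ T ∈ S.powerset, ((∏ i ∈ S \ T, (-1:ℝ) : ℝ) : ℂ) * G T := by
    simp only [hG, Finset.mul_sum]
    rw [Finset.sum_comm]
    refine Finset.sum_congr rfl fun j _ => ?_
    unfold kap
    simp only [sub_eq_add_neg]
    rw [Finset.prod_add, Complex.ofReal_sum, Finset.sum_mul]
    refine Finset.sum_congr rfl fun T _ => ?_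
    rw [Complex.ofReal_mul]; ring
  have hGT : ∀ T ⊆ S, ∃ r : ℕ, r < PP T ∧ G T = PP T * ∑ m ∈ Finset.range ((n - r + (PP T - 1)) / PP T), e (-(q0 * ((r + PP T * m : ℕ):ℝ) * γ)) := by
    intro T hTS
    obtain ⟨r, hr⟩ := del_crt P y T (fun i hi j hj => hcop i (hTS hi) j (hTS hj))
    refine ⟨r % PP T, Nat.mod_lt _ (hPPpos T), ?_⟩
    rw [← prog_sum n (PP T) r (hPPpos T) (fun j => e (-(q0 * j * γ))), hG, Finset.mul_sum]
    refine Finset.sum_congr rfl fun j _ => ?_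
    rw [hr]
    by_cases h : j ≡ r [MOD PP T]
    · rw [if_pos h, if_pos h]; simp [hPP]
    · rw [if_neg h, if_neg h]; simp
  have hsmall : ∀ T ∈ S.powerset.erase S, ‖((∏ i ∈ S \ T, (-1:ℝ) : ℝ) : ℂ) * G T‖ ≤ PP S * Qm := by
    intro T hTm
    rw [Finset.mem_erase, Finset.mem_powerset] at hTm
    have hss : T ⊂ S := Finset.ssubset_iff_subset_ne.2 ⟨hTm.2, hTm.1⟩
    obtain ⟨r, _, hr⟩ := hGT T hTm.2
    have hle : (PP T : ℝ) ≤ PP S := by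
      have : PP T ∣ PP S := Finset.prod_dvd_prod_of_subset _ _ _ hTm.2
      exact_mod_cast Nat.le_of_dvd (hPPpos S) this
    rw [norm_mul, Complex.norm_real, norm_prod]
    simp only [norm_neg, norm_one, Finset.prod_const_one, one_mul]
    rw [hr, norm_mul, Complex.norm_natCast]
    refine mul_le_mul hle ?_ (norm_nonneg _) (by positivity)
    set J := (n - r + (PP T - 1)) / PP T
    have e2 : ∑ m ∈ Finset.range J, e (-(q0 * ((r + PP T * m : ℕ):ℝ) * γ)) = e (-(q0 * r * γ)) * ∑ m ∈ Finset.range J, e (m * (-(q0 * PP T * γ))) := by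
      rw [Finset.mul_sum]
      refine Finset.sum_congr rfl fun m _ => ?_
      rw [← e_add]; congr 1; push_cast; ring
    rw [e2, norm_mul, norm_e, one_mul]
    have h1 := norm_geom_e J (-(q0 * PP T * γ))
    rw [torusNorm_neg] at h1
    have h2 := hT T hss
    have h3 : 0 ≤ ‖∑ m ∈ Finset.range J, e (m * (-(q0 * PP T * γ)))‖ := norm_nonneg _
    have h4 := mul_le_mul_of_nonneg_left h2 h3
    have h5 := mul_le_mul_of_nonneg_left h1 (by linarith : 0 ≤ Qm)
    have : (((∏ i ∈ T, P i : ℕ) : ℕ) : ℝ) = PP T := rfl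
    rw [this] at h4
    nlinarith
  have hmain : (n - PP S) * (7 / 8) ≤ ‖G S‖ := by
    obtain ⟨r, hrP, hr⟩ := hGT S subset_rfl
    rw [hr]
    set J := (n - r + (PP S - 1)) / PP S with hJ
    have hJn : (n:ℝ) - PP S ≤ PP S * J := by
      have h1 : n - r ≤ PP S * J := by
        have := Nat.lt_mul_div_succ (n - r + (PP S - 1)) (hPPpos S)
        rw [← hJ, Nat.mul_succ] at this
        have := hPPpos S
        omega
      have h2 : n ≤ PP S * J + PP S := by omega
      have : (n:ℝ) ≤ PP S * J + PP S := by exact_mod_cast h2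
      linarith
    obtain ⟨b, hb⟩ := hdvd
    have hq'' : (q':ℝ) ≠ 0 := by exact_mod_cast hq'.ne'
    have e2 : ∀ m ∈ Finset.range J, ‖e (-(q0 * ((r + PP S * m : ℕ):ℝ) * γ)) - e (-(q0 * r * (a / q')))‖ ≤ 1 / 8 := by
      intro m hm
      have hlt : r + PP S * m < n := by
        rw [Finset.mem_range, hJ, ← Nat.succ_le_iff, Nat.le_div_iff_mul_le (hPPpos S), Nat.succ_mul, mul_comm] at hm
        have := hPPpos S
        omega
      have : e (-(q0 * ((r + PP S * m : ℕ):ℝ) * γ)) = e (-(q0 * ((r + PP S * m : ℕ):ℝ) * θ) + -(q0 * r * (a / q'))) := by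
        rw [← e_sub_int (-(q0 * ((r + PP S * m : ℕ):ℝ) * θ) + -(q0 * r * (a / q'))) (b * a * m)]
        congr 1
        have hb' : (q0:ℝ) * PP S = q' * b := by exact_mod_cast hb
        rw [hγ]; push_cast
        field_simp
        linear_combination (-(a * m) : ℝ) * hb'
      rw [this]
      refine (norm_e_sub_e_le _ _).trans ?_
      rw [add_sub_cancel_right, abs_neg, abs_mul, abs_mul, Nat.abs_cast, Nat.abs_cast]
      refine le_trans ?_ hθ
      have : ((r + PP S * m : ℕ):ℝ) ≤ n := by exact_mod_cast hlt.le
      have := Real.pi_pos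
      gcongr
    have e3 : ‖∑ m ∈ Finset.range J, e (-(q0 * ((r + PP S * m : ℕ):ℝ) * γ)) - J * e (-(q0 * r * (a / q')))‖ ≤ J * (1 / 8) := by
      have : (J:ℂ) * e (-(q0 * r * (a / q'))) = ∑ m ∈ Finset.range J, e (-(q0 * r * (a / q'))) := by simp
      rw [this, ← Finset.sum_sub_distrib]
      refine (norm_sum_le_of_le _ e2).trans ?_
      simp
    have e4 : ‖(J:ℂ) * e (-(q0 * r * (a / q')))‖ = J := by rw [norm_mul, norm_e, Complex.norm_natCast, mul_one]
    have e5 := norm_sub_norm_le ((J:ℂ) * e (-(q0 * r * (a / q')))) (∑ m ∈ Finset.range J, e (-(q0 * ((r + PP S * m : ℕ):ℝ) * γ)))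
    rw [norm_sub_rev] at e3
    rw [norm_mul, Complex.norm_natCast]
    have e6 : (J:ℝ) * (7 / 8) ≤ ‖∑ m ∈ Finset.range J, e (-(q0 * ((r + PP S * m : ℕ):ℝ) * γ))‖ := by linarith
    have e7 := mul_le_mul_of_nonneg_left e6 (by positivity : (0:ℝ) ≤ PP S)
    nlinarith
  unfold muw
  rw [e1, norm_div, Complex.norm_natCast, le_div_iff₀ hn', ← Finset.add_sum_erase _ _ (Finset.mem_powerset_self S)]
  have hs := norm_sum_le_of_le _ hsmall
  rw [Finset.sum_const, nsmul_eq_mul] at hs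
  have hcard : ((S.powerset.erase S).card : ℝ) ≤ 2 ^ S.card := by
    have : (S.powerset.erase S).card ≤ 2 ^ S.card := by
      rw [← Finset.card_powerset]; exact Finset.card_erase_le
    exact_mod_cast this
  have hs2 : ‖∑ T ∈ S.powerset.erase S, ((∏ i ∈ S \ T, (-1:ℝ) : ℝ) : ℂ) * G T‖ ≤ n / 8 := by
    refine hs.trans ?_
    have h1 : (0:ℝ) ≤ PP S * Qm := by positivity
    have h2 := mul_le_mul_of_nonneg_right hcard h1
    have : (((∏ i ∈ S, P i : ℕ) : ℕ) : ℝ) = PP S := rfl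
    rw [this] at hbig
    linarith
  have hPn : (PP S : ℝ) ≤ n / 8 := by
    have h1 : (1:ℝ) ≤ 2 ^ S.card := one_le_pow₀ (by norm_num)
    have h2 : (0:ℝ) < PP S := by exact_mod_cast hPPpos S
    have h3 : (PP S : ℝ) * 1 ≤ (PP S : ℝ) * (2 ^ S.card * Qm) := mul_le_mul_of_nonneg_left (by nlinarith) h2.le
    have : (((∏ i ∈ S, P i : ℕ) : ℕ) : ℝ) = PP S := rfl
    rw [this] at hbig
    linarith
  have h0 : ((∏ i ∈ S \ S, (-1:ℝ) : ℝ) : ℂ) * G S = G S := by simp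
  rw [h0]
  have := norm_sub_norm_le (G S) (-(∑ T ∈ S.powerset.erase S, ((∏ i ∈ S \ T, (-1:ℝ) : ℝ) : ℂ) * G T))
  rw [norm_neg, sub_neg_eq_add] at this
  linarith

lemma torus_frac (x : ℤ) (q : ℕ) (hq : 0 < q) (h : ¬ (q:ℤ) ∣ x) : 1 / (q:ℝ) ≤ torusNorm (x / q) := by
  unfold torusNorm
  have hq' : (0:ℝ) < q := by exact_mod_cast hq
  set b := round ((x:ℝ) / q)
  have e1 : (x:ℝ) / q - b = ((x - q * b : ℤ) : ℝ) / q := by push_cast; field_simp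
  rw [e1, abs_div, abs_of_pos hq']
  refine div_le_div_of_nonneg_right ?_ hq'.le
  have : x - q * b ≠ 0 := fun h0 => h ⟨b, by omega⟩
  have := Int.one_le_abs this
  exact_mod_cast this

lemma muw_one_near (n q0 : ℕ) (hn : 0 < n) (γ θ : ℝ) (a : ℤ) (q' : ℕ) (hq' : 0 < q') (hγ : γ = a / q' + θ) (hd : q' ∣ q0) :
    1 - 2 * Real.pi * (q0 * n * |θ|) ≤ ‖muw n q0 (fun _ => 1) γ‖ := by
  have hn' : (0:ℝ) < n := by exact_mod_cast hn
  obtain ⟨b, hb⟩ := hd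
  have hq'' : (q':ℝ) ≠ 0 := by exact_mod_cast hq'.ne'
  have h1 : ∀ j ∈ Finset.range n, ‖e (-(q0 * j * γ)) - 1‖ ≤ 2 * Real.pi * (q0 * n * |θ|) := by
    intro j hj
    have : e (-(q0 * j * γ)) = e (-(q0 * j * θ)) := by
      rw [← e_sub_int (-(q0 * j * θ)) (b * a * j)]
      congr 1
      have hb' : (q0:ℝ) = q' * b := by exact_mod_cast hb
      rw [hγ, hb']; push_cast; field_simp; ring
    rw [this]
    refine (norm_e_sub_one_le _).trans ?_
    rw [abs_neg, abs_mul, abs_mul, Nat.abs_cast, Nat.abs_cast]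
    have : (j:ℝ) ≤ n := by exact_mod_cast (Finset.mem_range.1 hj).le
    have := Real.pi_pos
    gcongr
  have h2 := norm_sum_le_of_le _ h1
  rw [Finset.sum_sub_distrib] at h2
  simp only [Finset.sum_const, Finset.card_range, nsmul_eq_mul, mul_one] at h2
  unfold muw
  simp only [Complex.ofReal_one, one_mul]
  rw [norm_div, Complex.norm_natCast, le_div_iff₀ hn']
  have h3 := norm_sub_norm_le (n:ℂ) (∑ j ∈ Finset.range n, e (-(q0 * j * γ)))
  rw [Complex.norm_natCast] at h3
  rw [norm_sub_rev] at h2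
  linarith

set_option maxHeartbeats 1000000 in
lemma pointwise (M K C D E q0 n Q y0 k : ℕ) (H : Polynomial ℤ) (I : Finset ℕ) (P : ℕ → ℕ) (w α Y ck : ℝ)
    (hM : 0 < M) (hK : 0 < K) (hC : 1 ≤ C) (hn : 0 < n) (hα : 0 < α) (hα1 : α ≤ 1) (hck : 0 < ck) (hw : 1 < w) (hY : 1 ≤ Y)
    (hWI : ∀ (R γ : ℝ), 2 ≤ R → R ≤ 32 / α → (M:ℝ) ≤ ‖∑ n ∈ Finset.range M, e (γ * (H.eval (n:ℤ) : ℤ))‖ * R →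
      ∃ (q : ℕ) (a : ℤ), 1 ≤ q ∧ (q:ℝ) ≤ K * R ^ C ∧ |γ - a / q| * (ck * M ^ k) ≤ R ^ C)
    (hQ : K * (32 / α) ^ C ≤ Q) (hE : Q < 2 ^ E)
    (hI : ∀ p, p ∈ I ↔ p.Prime ∧ y0 < p ∧ p ≤ Q)
    (hP : ∀ i, 0 < P i) (hPd : ∀ i ∈ I, i ^ E ∣ P i) (hPc : ∀ i ∈ I, ∀ p, p.Prime → p ∣ P i → p = i) (hPY : ∀ i ∈ I, (P i : ℝ) ≤ Y)
    (hq0 : ∀ p, p.Prime → p ≤ y0 → p ^ E ∣ q0) (hq0c : ∀ p, p.Prime → p ∣ q0 → p ≤ y0)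
    (hy0 : K * w ^ C ≤ y0) (hD : 32 / α < w ^ (D + 1)) (hbig : 8 * 2 ^ D * Y ^ D * Q ≤ n)
    (hθ : 2 * Real.pi * (q0 * n * (32 / α) ^ C) ≤ α / 32 * (ck * M ^ k)) (γ : ℝ) :
    ‖∑ n' ∈ Finset.range M, e (γ * (H.eval (n':ℤ) : ℤ))‖ * (1 - ‖muw n q0 (fun _ => 1) γ‖ ^ 2) ≤ M * (α / 8 + Psi P I n q0 D w γ) := by
  classical
  have hM' : (0:ℝ) < M := by exact_mod_cast hM
  have hn' : (0:ℝ) < n := by exact_mod_cast hn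
  have hK' : (1:ℝ) ≤ K := by exact_mod_cast hK
  have hterm : ∀ r ∈ Finset.Icc 1 D, ∀ S ∈ I.powersetCard r, 0 ≤ 8 / w ^ r * avL P I.toList (fun y => ‖muw n q0 (kap P S y) γ‖ ^ 2) (fun _ => 0) := by
    intro r _ S _
    have : 0 ≤ avL P I.toList (fun y => ‖muw n q0 (kap P S y) γ‖ ^ 2) (fun _ => 0) := avL_nonneg _ _ (fun _ => by positivity) _
    positivity
  have hΨ0 : 0 ≤ Psi P I n q0 D w γ := Finset.sum_nonneg fun r hr => Finset.sum_nonneg (hterm r hr)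
  set s := ‖∑ n' ∈ Finset.range M, e (γ * (H.eval (n':ℤ) : ℤ))‖ with hs
  have hs0 : 0 ≤ s := norm_nonneg _
  have hsM : s ≤ M := by
    refine (norm_sum_le _ _).trans ?_
    simp [norm_e]
  have hmu := muw_one_le n q0 γ
  have hmu0 : 0 ≤ ‖muw n q0 (fun _ => 1) γ‖ := norm_nonneg _
  have hmu1 : 1 - ‖muw n q0 (fun _ => 1) γ‖ ^ 2 ≤ 1 := by nlinarith
  have hmu2 : 0 ≤ 1 - ‖muw n q0 (fun _ => 1) γ‖ ^ 2 := by nlinarith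
  rcases le_or_gt s (M * (α / 16)) with hc | hc
  · have : s * (1 - ‖muw n q0 (fun _ => 1) γ‖ ^ 2) ≤ s * 1 := mul_le_mul_of_nonneg_left hmu1 hs0
    have : 0 ≤ M * Psi P I n q0 D w γ := by positivity
    have : 0 < M * α := by positivity
    linarith
  have hspos : 0 < s := lt_of_le_of_lt (by positivity) hc
  set R := 2 * M / s with hR
  have hR2 : 2 ≤ R := by rw [hR, le_div_iff₀ hspos]; linarith
  have hR0 : R ≤ 32 / α := by
    rw [hR, div_le_div_iff₀ hspos hα]; linarith
  obtain ⟨q, a, hq1, hqR, hqθ⟩ := hWI R γ hR2 hR0 (by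
    rw [← hs, hR, mul_div_assoc', mul_div_cancel_left₀ _ hspos.ne']; linarith)
  set ρ : ℚ := (a:ℚ) / (q:ℤ) with hρ
  have hq'dvd : ρ.den ∣ q := by
    have := Rat.den_dvd a q
    rw [Rat.divInt_eq_div, ← hρ] at this
    exact_mod_cast this
  set q' := ρ.den with hq'
  have hq'pos : 0 < q' := ρ.den_pos
  have hq'0 : (0:ℝ) < q' := by exact_mod_cast hq'pos
  have hq'q : q' ≤ q := Nat.le_of_dvd hq1 hq'dvd
  have hρr : ((a:ℝ) / q) = (ρ.num : ℝ) / q' := by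
    have h1 : (ρ : ℝ) = (a:ℝ) / q := by rw [hρ]; push_cast; rfl
    rw [← h1, hq']; exact Rat.cast_def ρ
  set θ := γ - a / q with hθd
  have hγ : γ = ρ.num / q' + θ := by rw [hθd, hρr]; ring
  have hRC : R ^ C ≤ (32 / α) ^ C := pow_le_pow_left₀ (by linarith) hR0 _
  have hq'K : (q':ℝ) ≤ K * R ^ C := le_trans (by exact_mod_cast hq'q) hqR
  have hq'Q : q' ≤ Q := by
    have : (q':ℝ) ≤ Q := hq'K.trans ((mul_le_mul_of_nonneg_left hRC (by positivity)).trans hQ)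
    exact_mod_cast this
  have hQ1 : 1 ≤ Q := le_trans hq'pos hq'Q
  have hQ1' : (1:ℝ) ≤ Q := by exact_mod_cast hQ1
  have hpi := Real.pi_pos
  have hθ' : 2 * Real.pi * (q0 * n * |θ|) ≤ α / 32 := by
    have hX : 0 < ck * (M:ℝ) ^ k := by positivity
    have h1 : |θ| * (ck * M ^ k) ≤ (32 / α) ^ C := hqθ.trans hRC
    have h2 : 2 * Real.pi * (q0 * n) * (|θ| * (ck * M ^ k)) ≤ 2 * Real.pi * (q0 * n) * (32 / α) ^ C := mul_le_mul_of_nonneg_left h1 (by positivity)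
    refine le_of_mul_le_mul_right ?_ hX
    linarith
  set S := I.filter (fun p => p ∣ q') with hS
  have hSI : S ⊆ I := Finset.filter_subset _ _
  have hcopI : ∀ i ∈ I, ∀ j ∈ I, i ≠ j → Nat.Coprime (P i) (P j) := by
    intro i hi j hj hij
    refine Nat.Coprime.symm (Nat.coprime_of_dvd ?_)
    intro p hp h1 h2
    exact hij ((hPc i hi p hp h2).symm.trans (hPc j hj p hp h1))
  have hdvd : q' ∣ q0 * ∏ i ∈ S, P i := by
    rw [Nat.dvd_iff_prime_pow_dvd_dvd]
    intro p v hp hpv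
    rcases Nat.eq_zero_or_pos v with h0 | h0
    · rw [h0, pow_zero]; exact one_dvd _
    have hvE : v ≤ E := by
      by_contra hcon
      push Not at hcon
      have h1 := Nat.le_of_dvd hq'pos hpv
      have h2 : 2 ^ E ≤ p ^ v := (Nat.pow_le_pow_right (by norm_num) hcon.le).trans (Nat.pow_le_pow_left hp.two_le _)
      omega
    have hpq : p ∣ q' := (dvd_pow_self p h0.ne').trans hpv
    rcases le_or_gt p y0 with h1 | h1
    · exact ((pow_dvd_pow p hvE).trans (hq0 p hp h1)).mul_right _
    · have hpI : p ∈ I := (hI p).2 ⟨hp, h1, (Nat.le_of_dvd hq'pos hpq).trans hq'Q⟩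
      have hpS : p ∈ S := Finset.mem_filter.2 ⟨hpI, hpq⟩
      exact (((pow_dvd_pow p hvE).trans (hPd p hpI)).trans (Finset.dvd_prod_of_mem _ hpS)).mul_left _
  rcases Finset.eq_empty_or_nonempty S with hSe | hSne
  · rw [hSe, Finset.prod_empty, mul_one] at hdvd
    have h1 := muw_one_near n q0 hn γ θ ρ.num q' hq'pos hγ hdvd
    have h2 : 1 - ‖muw n q0 (fun _ => 1) γ‖ ^ 2 ≤ α / 16 := by nlinarith
    have h3 : s * (1 - ‖muw n q0 (fun _ => 1) γ‖ ^ 2) ≤ M * (α / 16) := mul_le_mul hsM h2 hmu2 hM'.le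
    have : 0 ≤ M * Psi P I n q0 D w γ := by positivity
    have : 0 < M * α := by positivity
    linarith
  have hc1 : 1 ≤ S.card := hSne.card_pos
  have hprodS : (y0:ℝ) ^ S.card ≤ q' := by
    have h1 : ∏ p ∈ S, p ∣ q' := by
      refine Finset.prod_primes_dvd q' (fun p hp => ?_) (fun p hp => (Finset.mem_filter.1 hp).2)
      exact Nat.Prime.prime ((hI p).1 (hSI hp)).1
    have h2 : y0 ^ S.card ≤ ∏ p ∈ S, p := by
      rw [← Finset.prod_const]
      exact Finset.prod_le_prod' fun p hp => ((hI p).1 (hSI hp)).2.1.le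
    exact_mod_cast h2.trans (Nat.le_of_dvd hq'pos h1)
  have hwS : w ^ S.card ≤ R := by
    have h1 : (K * w ^ C) ^ S.card ≤ K * R ^ C := (pow_le_pow_left₀ (by positivity) hy0 _).trans (hprodS.trans hq'K)
    rw [mul_pow] at h1
    have h2 : (K:ℝ) ≤ K ^ S.card := le_self_pow₀ hK' (by omega)
    have h3 : (w ^ S.card) ^ C ≤ R ^ C := by
      rw [← pow_mul, mul_comm S.card C, pow_mul]
      have h4 : K * (w ^ C) ^ S.card ≤ K * R ^ C := (mul_le_mul_of_nonneg_right h2 (by positivity)).trans h1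
      exact le_of_mul_le_mul_left h4 (by linarith)
    exact le_of_pow_le_pow_left₀ (by omega) (by linarith) h3
  have hSD : S.card ≤ D := by
    by_contra hcon
    push Not at hcon
    have : w ^ (D + 1) ≤ w ^ S.card := pow_le_pow_right₀ hw.le hcon
    linarith
  have hPSY : ((∏ i ∈ S, P i : ℕ) : ℝ) ≤ Y ^ D := by
    rw [Nat.cast_prod]
    exact prod_le_Y Y hY S (fun i hi => hPY i (hSI hi)) D hSD
  have hbig' : 8 * 2 ^ S.card * ((∏ i ∈ S, P i : ℕ) : ℝ) * Q ≤ n := by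
    refine le_trans ?_ hbig
    have : (2:ℝ) ^ S.card ≤ 2 ^ D := pow_le_pow_right₀ (by norm_num) hSD
    gcongr
  have hlow : ∀ y, 1 / 2 ≤ ‖muw n q0 (kap P S y) γ‖ := by
    intro y
    refine mu_lower P hP S (fun i hi j hj => hcopI i (hSI hi) j (hSI hj)) n q0 hn y γ θ Q ρ.num q' hq'pos hγ hdvd (by linarith) hQ1' ?_ hbig'
    intro T hTS
    obtain ⟨p, hpS, hpT⟩ := Finset.exists_of_ssubset hTS
    have hpI := hSI hpS
    have hpp := ((hI p).1 hpI).1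
    have hnd : ¬ (q':ℤ) ∣ ((q0 * ∏ i ∈ T, P i : ℕ) : ℤ) * ρ.num := by
      intro hd
      have hd1 : (q':ℤ) ∣ ((q0 * ∏ i ∈ T, P i : ℕ) : ℤ) := by
        refine Int.dvd_of_dvd_mul_left_of_gcd_one hd ?_
        have := ρ.reduced
        rw [Int.gcd_comm]
        exact this
      have hd2 : q' ∣ q0 * ∏ i ∈ T, P i := by exact_mod_cast hd1
      have hd3 : p ∣ q0 * ∏ i ∈ T, P i := (Finset.mem_filter.1 hpS).2.trans hd2
      rcases (Nat.Prime.dvd_mul hpp).1 hd3 with h1 | h1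
      · have := hq0c p hpp h1
        have := ((hI p).1 hpI).2.1
        omega
      · obtain ⟨i, hi, hpi'⟩ := (Prime.dvd_finsetProd_iff hpp.prime _).1 h1
        have := hPc i (hSI (hTS.1 hi)) p hpp hpi'
        exact hpT (this ▸ hi)
    have h1 := torus_frac _ q' hq'pos hnd
    set B : ℕ := ∏ i ∈ T, P i with hB
    have h2 : ((((q0 * B : ℕ) : ℤ) * ρ.num : ℤ) : ℝ) / q' = q0 * B * γ - q0 * B * θ := by
      rw [hγ]; push_cast; ring
    rw [h2] at h1
    have h3 := torusNorm_sub_le (q0 * B * γ) (q0 * B * θ)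
    have h4 := torusNorm_le_abs_sub (q0 * B * θ) 0
    rw [Int.cast_zero, sub_zero, abs_mul, abs_mul, Nat.abs_cast, Nat.abs_cast] at h4
    have h5 : 1 / (Q:ℝ) ≤ 1 / q' := one_div_le_one_div_of_le hq'0 (by exact_mod_cast hq'Q)
    have hBS : (B:ℝ) ≤ ((∏ i ∈ S, P i : ℕ) : ℝ) := by
      have : B ∣ ∏ i ∈ S, P i := Finset.prod_dvd_prod_of_subset _ _ _ hTS.1
      exact_mod_cast Nat.le_of_dvd (Finset.prod_pos fun i _ => hP i) this
    have h6 : (B:ℝ) * Q ≤ n := by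
      have h7 : (1:ℝ) ≤ 2 ^ S.card := one_le_pow₀ (by norm_num)
      have h8 : (B:ℝ) * Q ≤ ((∏ i ∈ S, P i : ℕ) : ℝ) * Q := mul_le_mul_of_nonneg_right hBS (by positivity)
      have h9 : 1 * (((∏ i ∈ S, P i : ℕ) : ℝ) * Q) ≤ 8 * 2 ^ S.card * (((∏ i ∈ S, P i : ℕ) : ℝ) * Q) :=
        mul_le_mul_of_nonneg_right (by linarith) (by positivity)
      linarith
    have h10 : (q0 * B * |θ|) * Q ≤ 1 / 2 := by
      have : (q0:ℝ) * |θ| * (B * Q) ≤ q0 * |θ| * n := mul_le_mul_of_nonneg_left h6 (by positivity)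
      have h11 := Real.pi_gt_three
      have h12 : 0 ≤ (q0:ℝ) * n * |θ| := by positivity
      nlinarith
    have h13 : 1 / (Q:ℝ) ≤ torusNorm (q0 * B * γ) + q0 * B * |θ| := by linarith
    rw [div_le_iff₀ (by linarith)] at h13
    nlinarith
  have hav : 1 / 4 ≤ avL P I.toList (fun y => ‖muw n q0 (kap P S y) γ‖ ^ 2) (fun _ => 0) := by
    have := avL_mono (P := P) I.toList (fun _ => (1/4 : ℝ)) (fun y => ‖muw n q0 (kap P S y) γ‖ ^ 2) (fun y => by
      have := hlow y; nlinarith) (fun _ => 0)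
    rwa [avL_const hP] at this
  have hwpos : 0 < w ^ S.card := by positivity
  have hΨ : 2 / w ^ S.card ≤ Psi P I n q0 D w γ := by
    have hmem : S.card ∈ Finset.Icc 1 D := Finset.mem_Icc.2 ⟨hc1, hSD⟩
    have h1 := Finset.single_le_sum (f := fun r => ∑ S ∈ I.powersetCard r, 8 / w ^ r * avL P I.toList (fun y => ‖muw n q0 (kap P S y) γ‖ ^ 2) (fun _ => 0))
      (fun r hr => Finset.sum_nonneg (hterm r hr)) hmem
    have h2 := Finset.single_le_sum (f := fun S' => 8 / w ^ S.card * avL P I.toList (fun y => ‖muw n q0 (kap P S' y) γ‖ ^ 2) (fun _ => 0))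
      (hterm _ hmem) (Finset.mem_powersetCard.2 ⟨hSI, rfl⟩)
    refine le_trans ?_ (h2.trans h1)
    have : 8 / w ^ S.card * (1 / 4) ≤ 8 / w ^ S.card * avL P I.toList (fun y => ‖muw n q0 (kap P S y) γ‖ ^ 2) (fun _ => 0) :=
      mul_le_mul_of_nonneg_left hav (by positivity)
    refine le_trans (le_of_eq ?_) this
    ring
  have hsR : s ≤ M * (2 / w ^ S.card) := by
    rw [hR, le_div_iff₀ hspos] at hwS
    rw [mul_div_assoc', le_div_iff₀ hwpos]
    linarith
  have h1 : s * (1 - ‖muw n q0 (fun _ => 1) γ‖ ^ 2) ≤ s * 1 := mul_le_mul_of_nonneg_left hmu1 hs0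
  have h2 := mul_le_mul_of_nonneg_left hΨ hM'.le
  have : 0 < M * (α / 8) := by positivity
  linarith

lemma exM (B k N : ℕ) (hB : 0 < B) (hk : 0 < k) (hBN : B ≤ N) : ∃ M, 0 < M ∧ B * M ^ k ≤ N ∧ N < B * (2 * M) ^ k := by
  have hex : ∃ m, N < B * (m + 1) ^ k := ⟨N, by
    calc N < N + 1 := by omega
      _ ≤ (N + 1) ^ k := Nat.le_self_pow hk.ne' _
      _ ≤ _ := Nat.le_mul_of_pos_left _ hB⟩
  classical
  have h1 := Nat.find_spec hex
  have h2 : 0 < Nat.find hex := by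
    rw [Nat.find_pos]; simpa using hBN
  refine ⟨Nat.find hex, h2, ?_, h1.trans_le ?_⟩
  · have := Nat.find_min hex (m := Nat.find hex - 1) (by omega)
    rw [Nat.sub_add_cancel h2] at this
    omega
  · gcongr; omega

lemma Sys.increment {k : ℕ} (S : Sys k) (q d : ℕ) (hq : 0 < q) (hd : 0 < d) (A : Finset ℤ)
    (hfree : ∀ a ∈ A, ∀ b ∈ A, a ≠ b → ∀ n : ℕ, 0 < n → a - b ≠ (S.H d).eval (n:ℤ)) (b : ℤ) (J : ℕ) :
    ∃ A' : Finset ℤ, A' ⊆ Finset.Icc 1 (J:ℤ) ∧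
      (∀ a ∈ A', ∀ b ∈ A', a ≠ b → ∀ n : ℕ, 0 < n → a - b ≠ (S.H (q * d)).eval (n:ℤ)) ∧
      A'.card = ((Finset.range J).filter (fun m : ℕ => b + (S.lam q : ℤ) * (m:ℤ) ∈ A)).card := by
  refine ⟨((Finset.range J).filter (fun m : ℕ => b + (S.lam q : ℤ) * (m:ℤ) ∈ A)).image (fun m : ℕ => (m:ℤ) + 1), ?_, ?_, ?_⟩
  · intro x hx
    simp only [Finset.mem_image, Finset.mem_filter, Finset.mem_range] at hx
    obtain ⟨m, ⟨hm, _⟩, rfl⟩ := hx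
    rw [Finset.mem_Icc]; constructor <;> omega
  · intro x hx y hy hxy n hn heq
    simp only [Finset.mem_image, Finset.mem_filter, Finset.mem_range] at hx hy
    obtain ⟨m, ⟨_, hm⟩, rfl⟩ := hx
    obtain ⟨m', ⟨_, hm'⟩, rfl⟩ := hy
    obtain ⟨n', hn', h1⟩ := S.H_sub d q hd hq n hn
    have hl : (S.lam q : ℤ) ≠ 0 := by have := (S.lam_facts q hq).2.1; omega
    refine hfree _ hm _ hm' ?_ n' hn' ?_
    · intro h
      apply hxy
      have := mul_left_cancel₀ hl (add_left_cancel h)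
      rw [this]
    · rw [← h1, ← heq]; ring
  · apply Finset.card_image_of_injective
    intro x y h
    simpa using h

lemma dens_of_glob (P : ℕ → ℕ) (hP : ∀ i, 0 < P i) (V : Finset ℕ) (hcop : ∀ i ∈ V, ∀ j ∈ V, i ≠ j → Nat.Coprime (P i) (P j)) (y : ℕ → ℕ) (A : Finset ℤ)
    (q0 n : ℕ) (X : ℤ) (α : ℝ) (hα : 0 ≤ α) (hn : 0 < n) (hPn : 4 * ∏ i ∈ V, P i ≤ n)
    (hg : ∀ (b : ℤ) (J : ℕ), n ≤ 2 * (∏ i ∈ V, P i) * J →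
      (((Finset.range J).filter (fun m : ℕ => b + ((q0 * ∏ i ∈ V, P i : ℕ) : ℤ) * (m:ℤ) ∈ A)).card : ℝ) ≤ 21 / 20 * α * J) :
    (∑ j ∈ Finset.range n, aX A q0 X j * ∏ i ∈ V, del P i (y i) j) / n ≤ 2 * α := by
  obtain ⟨r, hr⟩ := del_crt P y V hcop
  have hp : 0 < ∏ i ∈ V, P i := Finset.prod_pos fun i _ => hP i
  set p := ∏ i ∈ V, P i with hpd
  have hrp : r % p < p := Nat.mod_lt _ hp
  set J := (n - r % p + (p - 1)) / p with hJ
  have hJ1 : p * J ≤ n + p := (Nat.mul_div_le _ _).trans (by omega)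
  have hJ2 : n ≤ p * J + p := by
    have := Nat.lt_mul_div_succ (n - r % p + (p - 1)) hp
    rw [← hJ, mul_add, mul_one] at this
    omega
  have hs : ∑ j ∈ Finset.range n, aX A q0 X j * ∏ i ∈ V, del P i (y i) j =
      p * (((Finset.range J).filter (fun m : ℕ => (X + q0 * ((r % p : ℕ):ℤ)) + ((q0 * p : ℕ) : ℤ) * (m:ℤ) ∈ A)).card : ℝ) := by
    have h1 : ∀ j, aX A q0 X j * ∏ i ∈ V, del P i (y i) j = p * (if j ≡ r [MOD p] then aX A q0 X j else 0) := by
      intro j; rw [hr]; split_ifs <;> ring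
    simp_rw [h1]
    rw [← Finset.mul_sum, prog_sum n p r hp, Finset.card_filter]
    push_cast
    congr 1
    refine Finset.sum_congr rfl fun m _ => ?_
    unfold aX
    push_cast
    rw [mul_add, ← add_assoc, mul_assoc]
  rw [hs, div_le_iff₀ (by exact_mod_cast hn)]
  have h3 := hg (X + q0 * ((r % p : ℕ):ℤ)) J (by nlinarith)
  have h4 : (p:ℝ) * J ≤ n + p := by exact_mod_cast hJ1
  have h5 : 4 * (p:ℝ) ≤ n := by exact_mod_cast hPn
  calc (p:ℝ) * _ ≤ p * (21 / 20 * α * J) := by gcongr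
    _ = 21 / 20 * α * (p * J) := by ring
    _ ≤ 21 / 20 * α * (n + p) := by gcongr
    _ ≤ _ := by nlinarith [mul_nonneg hα (Nat.cast_nonneg (α := ℝ) n)]

lemma core (M K C t E q0 n Q y0 k N L : ℕ) (H : Polynomial ℤ) (I : Finset ℕ) (P : ℕ → ℕ) (α Y ck : ℝ) (A : Finset ℤ)
    (hA : A ⊆ Finset.Icc 1 (N:ℤ)) (hN : 0 < N) (hcard : (A.card:ℝ) = α * N) (hdeg : H.natDegree = k) (hH0 : H ≠ 0)
    (hfree : ∀ a ∈ A, ∀ b ∈ A, a ≠ b → ∀ n : ℕ, 0 < n → a - b ≠ H.eval (n:ℤ))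
    (hMα : 100 * (k + 2) ≤ M * α) (ht : 1 ≤ t)
    (hL : ∀ n' : ℕ, 0 < n' → n' < M → (q0 * n : ℤ) + |H.eval (n':ℤ)| ≤ L) (hLq : q0 * n ≤ L) (hLN : 50 * L ≤ N)
    (hPn : ∀ V ⊆ I, V.card ≤ t → 4 * ∏ i ∈ V, P i ≤ n)
    (hg : ∀ V ⊆ I, V.card ≤ t → ∀ (b : ℤ) (J : ℕ), n ≤ 2 * (∏ i ∈ V, P i) * J →
      (((Finset.range J).filter (fun m : ℕ => b + ((q0 * ∏ i ∈ V, P i : ℕ) : ℤ) * (m:ℤ) ∈ A)).card : ℝ) ≤ 21 / 20 * α * J)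
    (hIY : (I.card : ℝ) ≤ Y) (h3 : 1 ≤ 3 ^ t * α) (hbig2 : 2 * Y ^ (8 * t * t) ≤ n * α ^ (2 * t))
    (hM : 0 < M) (hK : 0 < K) (hC : 1 ≤ C) (hn : 0 < n) (hα : 0 < α) (hα1 : α ≤ 1) (hck : 0 < ck) (hY : 1 ≤ Y)
    (hWI : ∀ (R γ : ℝ), 2 ≤ R → R ≤ 32 / α → (M:ℝ) ≤ ‖∑ n ∈ Finset.range M, e (γ * (H.eval (n:ℤ) : ℤ))‖ * R →
      ∃ (q : ℕ) (a : ℤ), 1 ≤ q ∧ (q:ℝ) ≤ K * R ^ C ∧ |γ - a / q| * (ck * M ^ k) ≤ R ^ C)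
    (hQ : K * (32 / α) ^ C ≤ Q) (hE : Q < 2 ^ E)
    (hI : ∀ p, p ∈ I ↔ p.Prime ∧ y0 < p ∧ p ≤ Q)
    (hP : ∀ i, 0 < P i) (hPd : ∀ i ∈ I, i ^ E ∣ P i) (hPc : ∀ i ∈ I, ∀ p, p.Prime → p ∣ P i → p = i) (hPY : ∀ i ∈ I, (P i : ℝ) ≤ Y)
    (hq0 : ∀ p, p.Prime → p ≤ y0 → p ^ E ∣ q0) (hq0c : ∀ p, p.Prime → p ∣ q0 → p ≤ y0)
    (hy0 : K * (2 ^ 18 * (t:ℝ) ^ 2) ^ C ≤ y0) (hD : 32 / α < (2 ^ 18 * (t:ℝ) ^ 2) ^ (t + 1)) (hbig : 8 * 2 ^ t * Y ^ t * Q ≤ n)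
    (hθ : 2 * Real.pi * (q0 * n * (32 / α) ^ C) ≤ α / 32 * (ck * M ^ k)) : False := by
  have ht' : (1:ℝ) ≤ t := by exact_mod_cast ht
  have hcop : ∀ i ∈ I, ∀ j ∈ I, i ≠ j → Nat.Coprime (P i) (P j) := by
    intro i hi j hj hij
    by_contra hc
    obtain ⟨p, hp, h1, h2⟩ := Nat.Prime.not_coprime_iff_dvd.1 hc
    exact hij ((hPc i hi p hp h1).symm.trans (hPc j hj p hp h2))
  have hdens : ∀ X, ∀ V ⊆ I, V.card ≤ t → ∀ y : ℕ → ℕ, (∑ j ∈ Finset.range n, aX A q0 X j * ∏ i ∈ V, del P i (y i) j) / n ≤ 2 * α :=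
    fun X V hV hVt y => dens_of_glob P hP V (fun i hi j hj => hcop i (hV hi) j (hV hj)) y A q0 n X α hα.le hn (hPn V hV hVt) (hg V hV hVt)
  have hlev : ∀ X r, 1 ≤ r → r ≤ t → ∑ S ∈ I.powersetCard r, avL P I.toList (fun y => ff P n (aX A q0 X) ∅ S (fun _ => 0) y ^ 2) (fun _ => 0) ≤
      12 * α ^ 2 * (128 * (t:ℝ) ^ 2) ^ r := by
    intro X r _ hr
    have := level hP I hcop Y hY hPY hIY n hn (aX A q0 X) (fun j => by unfold aX; split_ifs <;> norm_num)
      (fun j => by unfold aX; split_ifs <;> norm_num) t t ht α hα (hdens X) h3 hbig2 r I.toList (Finset.nodup_toList I)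
      (fun i hi => Finset.mem_toList.1 hi) ∅ (by simp) (by simp) (by simpa using hr) (fun _ => 0) (fun _ => 0)
    rwa [Finset.toList_toFinset] at this
  refine fourier_main A N n q0 L k M hA H α hα hα1 hN hcard hdeg hH0 hfree hMα hn hL hLN ?_ (Psi P I n q0 t (2 ^ 18 * (t:ℝ) ^ 2)) ?_ ?_
  · intro X
    have := hg ∅ (by simp) (by simp) X n (by simp; omega)
    unfold Fw
    rw [div_le_iff₀ (by exact_mod_cast hn)]
    rw [Finset.card_filter] at this
    simpa using this
  · intro γ
    exact pointwise M K C t E q0 n Q y0 k H I P _ α Y ck hM hK hC hn hα hα1 hck (by nlinarith) hY hWI hQ hE hI hP hPd hPc hPY hq0 hq0c hy0 hD hbig hθ γ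
  · exact Psi_bound P I A N n q0 L t t _ α ht le_rfl hA hN hLq hLN hlev

lemma Sys.prime_dvd_lam {k : ℕ} (S : Sys k) (i E p : ℕ) (hi : i.Prime) (hp : p.Prime) (h : p ∣ S.lam (i ^ E)) : p = i := by
  have : Fact i.Prime := ⟨hi⟩
  rw [S.lam_pow, S.lam_prime] at h
  exact (Nat.prime_dvd_prime_iff_eq hp hi).1 (hp.dvd_of_dvd_pow (hp.dvd_of_dvd_pow h))

set_option maxHeartbeats 2000000 in
lemma Sys.step {k : ℕ} (S : Sys k) (C K : ℕ) (hC : 1 ≤ C) (hK : 0 < K)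
    (hWI : ∀ (M : ℕ) (R : ℝ) (H : Polynomial ℤ) (K : ℕ) (γ : ℝ), 1 ≤ M → 2 ≤ R → H.natDegree = k → 0 < H.coeff k → 0 < K →
      (∀ b : ℤ, (∀ j, 1 ≤ j → j ≤ k → H.coeff k ∣ H.coeff j * b) → H.coeff k ∣ K * b) →
      (∀ j, 1 ≤ j → j ≤ k → R ^ C * (H.coeff k + |H.coeff j| : ℤ) < M) →
      (M:ℝ) ≤ ‖∑ n ∈ Finset.range M, e (γ * (H.eval (n:ℤ) : ℤ))‖ * R →
      ∃ (q : ℕ) (a : ℤ), 1 ≤ q ∧ (q:ℝ) ≤ K * R ^ C ∧ |γ - a / q| * (H.coeff k * M ^ k) ≤ R ^ C)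
    (hcont : ∀ d, 0 < d → ∀ b : ℤ, (∀ j, 1 ≤ j → j ≤ k → (S.H d).coeff k ∣ (S.H d).coeff j * b) → (S.H d).coeff k ∣ K * b)
    (t y0 E b G : ℕ) (ht : 1 ≤ t) (hy0 : y0 = K * (2 ^ 18 * t ^ 2) ^ C) (hE : E = K + (t + 5) * C) (hb : (b:ℤ) = S.Ch)
    (hG : G = y0 + E + t + k + C + b + 20) (N d : ℕ) (hN : 2 ^ G ^ 8 ≤ N) (hd : 0 < d) (hdN : d ^ (2 * (k * (k + 1))) ≤ N)
    (A : Finset ℤ) (hA : A ⊆ Finset.Icc 1 (N:ℤ)) (hfree : ∀ a ∈ A, ∀ b ∈ A, a ≠ b → ∀ n : ℕ, 0 < n → a - b ≠ (S.H d).eval (n:ℤ))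
    (α : ℝ) (hcard : (A.card : ℝ) = α * N) (hαt : 1 / 2 ^ t ≤ α) :
    ∃ (q N' : ℕ) (A' : Finset ℤ), 0 < q ∧ q ≤ 2 ^ G ^ 7 ∧ 0 < N' ∧ N ≤ 2 ^ G ^ 7 * N' ∧ A' ⊆ Finset.Icc 1 (N':ℤ) ∧
      (∀ a ∈ A', ∀ b ∈ A', a ≠ b → ∀ n : ℕ, 0 < n → a - b ≠ (S.H (q * d)).eval (n:ℤ)) ∧ 21 / 20 * α * N' < A'.card := by
  classical
  by_contra hno
  have hk := S.hk
  have hG20 : 20 ≤ G := by omega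
  have hyG : y0 ≤ G := by omega
  have hEG : E ≤ G := by omega
  have htG : t ≤ G := by omega
  have hkG : k ≤ G := by omega
  have hbG : b ≤ G := by omega
  have g2 : 20 * G ≤ G ^ 2 := by nlinarith
  have g3 : 20 * G ^ 2 ≤ G ^ 3 := by rw [pow_succ G 2]; nlinarith
  have g4 : 20 * G ^ 3 ≤ G ^ 4 := by rw [pow_succ G 3]; nlinarith
  have g5 : 20 * G ^ 4 ≤ G ^ 5 := by rw [pow_succ G 4]; nlinarith
  have g6 : 20 * G ^ 5 ≤ G ^ 6 := by rw [pow_succ G 5]; nlinarith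
  have g7 : 20 * G ^ 6 ≤ G ^ 7 := by rw [pow_succ G 6]; nlinarith
  have g8 : 20 * G ^ 7 ≤ G ^ 8 := by rw [pow_succ G 7]; nlinarith
  have hp2 : ∀ {a b : ℕ}, a ≤ b → 2 ^ a ≤ 2 ^ b := fun h => Nat.pow_le_pow_right (by norm_num) h
  have hN0 : 0 < N := lt_of_lt_of_le (by positivity) hN
  have hN0' : (0:ℝ) < N := by exact_mod_cast hN0
  have hα : 0 < α := lt_of_lt_of_le (by positivity) hαt
  have hα1 : α ≤ 1 := by
    have h1 : A.card ≤ N := by have := Finset.card_le_card hA; simpa using this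
    have h2 : (A.card:ℝ) ≤ N := by exact_mod_cast h1
    rw [hcard] at h2
    nlinarith
  have h32 : 32 / α ≤ 2 ^ (t + 5) := by
    rw [div_le_iff₀ hα]
    have : (2:ℝ) ^ (t + 5) * (1 / 2 ^ t) ≤ 2 ^ (t + 5) * α := by gcongr
    refine le_trans (le_of_eq ?_) this
    rw [pow_add]; field_simp; norm_num
  have h32C : (32 / α) ^ C ≤ 2 ^ ((t + 5) * C) := by
    rw [pow_mul]; gcongr
  have hb1 : 1 ≤ b := by
    have := S.lead_le_Ch; have := S.hlead; omega
  have hb2 : b ≤ 2 ^ b := Nat.lt_two_pow_self.le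
  -- Q, I, P, q0
  set Q := K * 2 ^ ((t + 5) * C) with hQ
  have hQE : Q < 2 ^ E := by
    rw [hE, pow_add, hQ]
    exact Nat.mul_lt_mul_of_pos_right Nat.lt_two_pow_self (by positivity)
  set I := (Finset.Icc 1 Q).filter (fun p => p.Prime ∧ y0 < p) with hI
  have hIm : ∀ p, p ∈ I ↔ p.Prime ∧ y0 < p ∧ p ≤ Q := by
    intro p
    rw [hI, Finset.mem_filter, Finset.mem_Icc]
    constructor
    · rintro ⟨⟨_, h1⟩, h2, h3⟩; exact ⟨h2, h3, h1⟩
    · rintro ⟨h1, h2, h3⟩; exact ⟨⟨h1.one_le, h3⟩, h1, h2⟩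
  set P : ℕ → ℕ := fun i => if i.Prime then S.lam (i ^ E) else 1 with hPdef
  have hPp : ∀ i, i.Prime → P i = S.lam (i ^ E) := fun i hi => by simp only [hPdef, hi, if_true]
  have hP0 : ∀ i, 0 < P i := by
    intro i
    simp only [hPdef]
    split_ifs with hi
    · exact (S.lam_facts _ (pow_pos hi.pos _)).2.1
    · norm_num
  have hiE : ∀ i ∈ I, i ^ E ≤ 2 ^ (E * E) := by
    intro i hi
    rw [pow_mul]
    exact Nat.pow_le_pow_left (((hIm i).1 hi).2.2.trans hQE.le) _
  have hPY : ∀ i ∈ I, P i ≤ 2 ^ G ^ 3 := by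
    intro i hi
    have hip := ((hIm i).1 hi).1
    rw [hPp i hip]
    calc S.lam (i ^ E) ≤ (i ^ E) ^ k := (S.lam_facts _ (pow_pos hip.pos _)).2.2
      _ ≤ (2 ^ (E * E)) ^ k := Nat.pow_le_pow_left (hiE i hi) _
      _ = 2 ^ (E * E * k) := by rw [← pow_mul]
      _ ≤ 2 ^ (G * G * G) := hp2 (by gcongr)
      _ = _ := by ring_nf
  have hIc : I.card ≤ 2 ^ G ^ 3 := by
    have h1 : I.card ≤ Q := (Finset.card_filter_le _ _).trans (by simp)
    exact (h1.trans hQE.le).trans (hp2 (by nlinarith))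
  set S0 := (Finset.Icc 1 y0).filter Nat.Prime with hS0
  have hS0m : ∀ p, p ∈ S0 ↔ p.Prime ∧ p ≤ y0 := by
    intro p
    rw [hS0, Finset.mem_filter, Finset.mem_Icc]
    exact ⟨fun h => ⟨h.2, h.1.2⟩, fun h => ⟨⟨h.1.one_le, h.2⟩, h.1⟩⟩
  set qh := ∏ p ∈ S0, p ^ E with hqh
  have hqh0 : 0 < qh := Finset.prod_pos fun p hp => pow_pos ((hS0m p).1 hp).1.pos _
  have hqhb : qh ≤ 2 ^ (G ^ 3) := by
    have h1 : qh ≤ (2 ^ (y0 * E)) ^ S0.card := by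
      refine Finset.prod_le_pow_card _ _ _ fun p hp => ?_
      rw [pow_mul]
      exact Nat.pow_le_pow_left (((hS0m p).1 hp).2.trans Nat.lt_two_pow_self.le) _
    refine h1.trans ?_
    rw [← pow_mul]
    have h2 : S0.card ≤ G := ((Finset.card_filter_le _ _).trans (by simp)).trans hyG
    refine hp2 ?_
    calc y0 * E * S0.card ≤ G * G * G := by gcongr
      _ = _ := by ring
  set q0 := S.lam qh with hq0d
  have hq00 : 0 < q0 := (S.lam_facts _ hqh0).2.1
  have hq0b : q0 ≤ 2 ^ G ^ 4 := by
    calc q0 ≤ qh ^ k := (S.lam_facts _ hqh0).2.2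
      _ ≤ (2 ^ G ^ 3) ^ k := Nat.pow_le_pow_left hqhb _
      _ = 2 ^ (G ^ 3 * k) := by rw [← pow_mul]
      _ ≤ 2 ^ (G ^ 3 * G) := hp2 (by gcongr)
      _ = _ := by ring_nf
  -- n
  set n := N / 2 ^ G ^ 5 with hn
  have hn1 : 2 ^ G ^ 5 * n ≤ N := Nat.mul_div_le _ _
  have hn6 : 2 ^ G ^ 6 ≤ n := by
    rw [hn, Nat.le_div_iff_mul_le (by positivity), ← pow_add]
    exact (hp2 (by omega)).trans hN
  have hn0 : 0 < n := lt_of_lt_of_le (by positivity) hn6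
  have hn2 : N ≤ 2 ^ (G ^ 5 + 1) * n := by
    have := Nat.lt_mul_div_succ N (show 0 < 2 ^ G ^ 5 by positivity)
    rw [← hn] at this
    rw [pow_succ]
    nlinarith [Nat.pos_of_ne_zero (pow_ne_zero (G ^ 5) (two_ne_zero (α := ℕ)))]
  have hPV : ∀ V ⊆ I, V.card ≤ t → ∏ i ∈ V, P i ≤ 2 ^ G ^ 4 := by
    intro V hV hVt
    calc ∏ i ∈ V, P i ≤ (2 ^ G ^ 3) ^ V.card := Finset.prod_le_pow_card _ _ _ fun i hi => hPY i (hV hi)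
      _ = 2 ^ (G ^ 3 * V.card) := by rw [← pow_mul]
      _ ≤ 2 ^ (G ^ 3 * G) := hp2 (by gcongr; omega)
      _ = _ := by ring_nf
  -- M
  set ck := (S.H d).coeff k with hck
  have hck0 : 0 < ck := S.H_coeff_k_pos d hd
  obtain ⟨cn, hcn⟩ : ∃ cn : ℕ, (cn:ℤ) = ck := ⟨ck.toNat, Int.toNat_of_nonneg hck0.le⟩
  have hcn0 : 0 < cn := by omega
  have hcj : ∀ j, |(S.H d).coeff j| ≤ ((2 ^ (b + k) * d ^ k : ℕ) : ℤ) := by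
    intro j
    refine (S.H_coeff_le d hd j).trans ?_
    rw [← hb]
    have : b * 2 ^ k * d ^ k ≤ 2 ^ (b + k) * d ^ k := by rw [pow_add]; gcongr
    exact_mod_cast this
  have hcnb : cn ≤ 2 ^ (b + k) * d ^ k := by
    have := hcj k
    rw [← hck, abs_of_pos hck0, ← hcn] at this
    exact_mod_cast this
  have hBb : 200 * b * cn ≤ 2 ^ G ^ 2 * d ^ k := by
    calc 200 * b * cn ≤ 2 ^ 8 * 2 ^ b * (2 ^ (b + k) * d ^ k) := by gcongr; norm_num
      _ = 2 ^ (8 + b + (b + k)) * d ^ k := by rw [pow_add 2 (8 + b), pow_add 2 8]; ring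
      _ ≤ _ := by gcongr 2 ^ ?_ * d ^ k; · norm_num
                  · omega
  have hdk2 : d ^ (2 * k) ≤ N := (Nat.pow_le_pow_right hd (by nlinarith)).trans hdN
  have hBN : 200 * b * cn ≤ N := by
    refine hBb.trans ?_
    refine (Nat.pow_le_pow_iff_left (n := 2) (by norm_num)).1 ?_
    calc (2 ^ G ^ 2 * d ^ k) ^ 2 = 2 ^ (G ^ 2 * 2) * d ^ (2 * k) := by rw [mul_pow, ← pow_mul, ← pow_mul]; ring_nf
      _ ≤ 2 ^ G ^ 8 * N := by gcongr 2 ^ ?_ * ?_; · norm_num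
                              · omega
      _ ≤ N ^ 2 := by rw [sq]; gcongr
  obtain ⟨M, hM0, hM1, hM2⟩ := exM (200 * b * cn) k N (by positivity) hk hBN
  have hMbig : 2 ^ G ^ 2 * d ^ k < M := by
    by_contra hlt
    push Not at hlt
    have h1 : N < 2 ^ G ^ 4 * d ^ (k * (k + 1)) := by
      calc N < 200 * b * cn * (2 * M) ^ k := hM2
        _ ≤ 2 ^ G ^ 2 * d ^ k * (2 * (2 ^ G ^ 2 * d ^ k)) ^ k := by gcongr
        _ = 2 ^ (G ^ 2 + (1 + G ^ 2) * k) * d ^ (k * (k + 1)) := by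
          rw [mul_pow, mul_pow, ← pow_mul, ← pow_mul, mul_add k k 1, mul_one, pow_add d, pow_add 2, add_mul, pow_add 2 (1 * k), one_mul]; ring
        _ ≤ _ := by
          gcongr 2 ^ ?_ * d ^ _
          · norm_num
          · calc G ^ 2 + (1 + G ^ 2) * k ≤ G ^ 2 + (1 + G ^ 2) * G := by gcongr
              _ = G ^ 2 + G + G ^ 3 := by ring
              _ ≤ _ := by omega
    have h2 : N ^ 2 < N ^ 2 := by
      calc N ^ 2 < (2 ^ G ^ 4 * d ^ (k * (k + 1))) ^ 2 := Nat.pow_lt_pow_left h1 (by norm_num)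
        _ = 2 ^ (G ^ 4 * 2) * d ^ (2 * (k * (k + 1))) := by rw [mul_pow, ← pow_mul, ← pow_mul]; ring_nf
        _ ≤ 2 ^ G ^ 8 * N := by gcongr 2 ^ ?_ * ?_; · norm_num
                                · omega
        _ ≤ N ^ 2 := by rw [sq]; gcongr
    exact lt_irrefl _ h2
  have hdk1 : 1 ≤ d ^ k := Nat.one_le_pow _ _ hd
  have hM' : (2:ℝ) ^ G ^ 2 * d ^ k < M := by exact_mod_cast hMbig
  have hdk1' : (1:ℝ) ≤ d ^ k := by exact_mod_cast hdk1
  have hp2' : ∀ {a b : ℕ}, a ≤ b → (2:ℝ) ^ a ≤ 2 ^ b := fun h => pow_le_pow_right₀ (by norm_num) h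
  have hE32 : (32 / α) ^ C ≤ 2 ^ E := h32C.trans (hp2' (by omega))
  have ht' : (1:ℝ) ≤ t := by exact_mod_cast ht
  have hckcast : ((ck:ℤ):ℝ) = cn := by rw [← hcn]; simp
  have hq0n : q0 * n * 200 ≤ N := by
    calc q0 * n * 200 ≤ 2 ^ G ^ 4 * n * 2 ^ 8 := by gcongr; norm_num
      _ = 2 ^ (G ^ 4 + 8) * n := by rw [pow_add]; ring
      _ ≤ 2 ^ G ^ 5 * n := by gcongr 2 ^ ?_ * n; · norm_num
                              · omega
      _ ≤ N := hn1
  have hN200 : 200 ≤ N := le_trans (le_trans (by norm_num) (hp2 (show 8 ≤ G ^ 8 by omega))) hN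
  have hdm := Nat.div_add_mod N 50
  have hmod := Nat.mod_lt N (show 0 < 50 by norm_num)
  refine core M K C t E q0 n Q y0 k N (N / 50) (S.H d) I P α (2 ^ G ^ 3) ck A hA hN0 hcard (S.H_natDegree d hd) ?_ hfree ?_ ht
    ?_ ?_ ?_ ?_ ?_ ?_ ?_ ?_ hM0 hK hC hn0 hα hα1 (by exact_mod_cast hck0) (one_le_pow₀ (by norm_num)) ?_ ?_ hQE hIm hP0 ?_ ?_ ?_ ?_ ?_ ?_ ?_ ?_ ?_
  · intro h0
    rw [hck, h0] at hck0; simp at hck0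
  · -- hMα
    have h1 : (2:ℝ) ^ (k + 8) ≤ M * α := by
      calc (2:ℝ) ^ (k + 8) = 2 ^ (k + 8 + t) * (1 / 2 ^ t) := by rw [pow_add _ (k + 8)]; field_simp
        _ ≤ M * α := by
          gcongr
          calc (2:ℝ) ^ (k + 8 + t) ≤ 2 ^ G ^ 2 := hp2' (by omega)
            _ ≤ 2 ^ G ^ 2 * d ^ k := le_mul_of_one_le_right (by positivity) hdk1'
            _ ≤ M := hM'.le
    refine le_trans ?_ h1
    have : k + 1 ≤ 2 ^ k := Nat.lt_two_pow_self
    have : ((k:ℝ) + 1) ≤ 2 ^ k := by exact_mod_cast this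
    rw [pow_add]; nlinarith
  · intro n' hn' hn'M
    have h1 := S.H_eval_le d hd n' hn'
    rw [← hck, ← hb, ← hcn] at h1
    have h2 : b * cn * n' ^ k ≤ b * cn * M ^ k := by gcongr
    have h3 : (b * cn * n' ^ k : ℤ) ≤ ((b * cn * M ^ k : ℕ) : ℤ) := by exact_mod_cast h2
    have h4 : 200 * (b * cn * M ^ k) ≤ N := by rw [← mul_assoc, ← mul_assoc]; exact hM1
    have h5 : (q0 * n : ℤ) * 200 ≤ N := by exact_mod_cast hq0n
    generalize b * cn * M ^ k = W at h3 h4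
    push_cast at *
    omega
  · omega
  · omega
  · intro V hV hVt
    calc 4 * ∏ i ∈ V, P i ≤ 2 ^ 2 * 2 ^ G ^ 4 := by have := hPV V hV hVt; omega
      _ = 2 ^ (2 + G ^ 4) := by rw [pow_add]
      _ ≤ 2 ^ G ^ 6 := hp2 (by omega)
      _ ≤ n := hn6
  · -- glob
    intro V hV hVt b' J hJ
    by_contra hlt
    push Not at hlt
    set qV := ∏ i ∈ V, i ^ E with hqV
    have hqV0 : 0 < qV := Finset.prod_pos fun i hi => pow_pos ((hIm i).1 (hV hi)).1.pos _
    have hlam : S.lam (qh * qV) = q0 * ∏ i ∈ V, P i := by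
      rw [S.hlamMul, hqV, S.lam_prod V, ← hq0d]
      congr 1
      exact Finset.prod_congr rfl fun i hi => (hPp i ((hIm i).1 (hV hi)).1).symm
    obtain ⟨A', h1, h2, h3⟩ := S.increment (qh * qV) d (by positivity) hd A hfree b' J
    have hJ0 : 0 < J := by
      rcases Nat.eq_zero_or_pos J with h | h
      · rw [h] at hJ; omega
      · exact h
    refine hno ⟨qh * qV, J, A', by positivity, ?_, hJ0, ?_, h1, h2, ?_⟩
    · have hqVb : qV ≤ 2 ^ G ^ 4 := by
        calc qV ≤ (2 ^ (E * E)) ^ V.card := Finset.prod_le_pow_card _ _ _ fun i hi => hiE i (hV hi)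
          _ = 2 ^ (E * E * V.card) := by rw [← pow_mul]
          _ ≤ 2 ^ (G * G * G) := hp2 (by gcongr; omega)
          _ ≤ _ := hp2 (by rw [← pow_three']; omega)
      calc qh * qV ≤ 2 ^ G ^ 3 * 2 ^ G ^ 4 := Nat.mul_le_mul hqhb hqVb
        _ = 2 ^ (G ^ 3 + G ^ 4) := by rw [pow_add]
        _ ≤ _ := hp2 (by omega)
    · calc N ≤ 2 ^ (G ^ 5 + 1) * n := hn2
        _ ≤ 2 ^ (G ^ 5 + 1) * (2 * 2 ^ G ^ 4 * J) := by
          gcongr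
          exact hJ.trans (by gcongr; exact hPV V hV hVt)
        _ = 2 ^ (G ^ 5 + 1 + 1 + G ^ 4) * J := by rw [pow_add 2 (G ^ 5 + 1 + 1), pow_succ 2 (G ^ 5 + 1)]; ring
        _ ≤ 2 ^ G ^ 7 * J := by gcongr 2 ^ ?_ * J; · norm_num
                                · omega
    · rw [h3, hlam]; exact hlt
  · exact_mod_cast hIc
  · -- h3
    calc (1:ℝ) = 2 ^ t * (1 / 2 ^ t) := by field_simp
      _ ≤ 3 ^ t * α := by gcongr; norm_num
  · -- hbig2
    have h1 : (2:ℝ) * (2 ^ G ^ 3) ^ (8 * t * t) * (2 ^ t) ^ (2 * t) ≤ n := by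
      have : 2 * (2 ^ G ^ 3) ^ (8 * t * t) * (2 ^ t) ^ (2 * t) ≤ n := by
        calc 2 * (2 ^ G ^ 3) ^ (8 * t * t) * (2 ^ t) ^ (2 * t) = 2 ^ (1 + G ^ 3 * (8 * t * t) + t * (2 * t)) := by
              rw [← pow_mul, ← pow_mul, pow_add, pow_add]; ring
          _ ≤ 2 ^ (1 + G ^ 3 * (8 * G * G) + G * (2 * G)) := hp2 (by gcongr)
          _ ≤ 2 ^ G ^ 6 := hp2 (by
            have : 1 + G ^ 3 * (8 * G * G) + G * (2 * G) = 1 + 8 * G ^ 5 + 2 * G ^ 2 := by ring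
            omega)
          _ ≤ n := hn6
      exact_mod_cast this
    calc (2:ℝ) * (2 ^ G ^ 3) ^ (8 * t * t) = 2 * (2 ^ G ^ 3) ^ (8 * t * t) * (2 ^ t) ^ (2 * t) * (1 / 2 ^ t) ^ (2 * t) := by
          rw [div_pow, one_pow]; field_simp
      _ ≤ n * α ^ (2 * t) := by gcongr
  · -- hWI
    intro R γ hR2 hR hRM
    refine hWI M R (S.H d) K γ hM0 hR2 (S.H_natDegree d hd) hck0 hK (hcont d hd) ?_ hRM
    intro j _ _
    have h1 : (((S.H d).coeff k + |(S.H d).coeff j| : ℤ) : ℝ) ≤ 2 ^ (b + k + 1) * d ^ k := by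
      have h2 := hcj j
      have h3 := hcj k
      rw [← hck, abs_of_pos hck0] at h3
      have : ck + |(S.H d).coeff j| ≤ ((2 ^ (b + k + 1) * d ^ k : ℕ) : ℤ) := by
        rw [pow_succ]; push_cast at *; linarith
      exact_mod_cast this
    have h0 : (0:ℝ) ≤ (((S.H d).coeff k + |(S.H d).coeff j| : ℤ) : ℝ) := by
      have : 0 ≤ ck + |(S.H d).coeff j| := by positivity
      exact_mod_cast this
    calc R ^ C * (((S.H d).coeff k + |(S.H d).coeff j| : ℤ) : ℝ) ≤ 2 ^ E * (2 ^ (b + k + 1) * d ^ k) := by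
          gcongr
          exact le_trans (by gcongr) hE32
      _ = 2 ^ (E + (b + k + 1)) * d ^ k := by rw [pow_add 2 E]; ring
      _ ≤ 2 ^ G ^ 2 * d ^ k := by gcongr 2 ^ ?_ * _; · norm_num
                                  · omega
      _ < M := hM'
  · rw [hQ]; push_cast; gcongr
  · intro i hi
    rw [hPp i ((hIm i).1 hi).1]
    exact (S.lam_facts _ (pow_pos ((hIm i).1 hi).1.pos _)).1
  · intro i hi p hp hpd
    rw [hPp i ((hIm i).1 hi).1] at hpd
    exact S.prime_dvd_lam i E p ((hIm i).1 hi).1 hp hpd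
  · intro i hi; exact_mod_cast hPY i hi
  · intro p hp hpy
    exact (Finset.dvd_prod_of_mem (fun p => p ^ E) ((hS0m p).2 ⟨hp, hpy⟩)).trans (S.lam_facts _ hqh0).1
  · intro p hp hpq
    rw [hq0d, hqh, S.lam_prod] at hpq
    obtain ⟨i, hi, h1⟩ := (Prime.dvd_finsetProd_iff hp.prime _).1 hpq
    rw [S.prime_dvd_lam i E p ((hS0m i).1 hi).1 hp h1]
    exact ((hS0m i).1 hi).2
  · rw [hy0]; push_cast; norm_num
  · calc 32 / α ≤ 2 ^ (t + 5) := h32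
      _ < 2 ^ (18 * (t + 1)) := pow_lt_pow_right₀ (by norm_num) (by omega)
      _ = (2 ^ 18) ^ (t + 1) := by rw [pow_mul]
      _ ≤ _ := by gcongr; nlinarith
  · have : 8 * 2 ^ t * (2 ^ G ^ 3) ^ t * Q ≤ n := by
      calc 8 * 2 ^ t * (2 ^ G ^ 3) ^ t * Q ≤ 8 * 2 ^ t * (2 ^ G ^ 3) ^ t * 2 ^ E := by gcongr
        _ = 2 ^ (3 + t + G ^ 3 * t + E) := by rw [← pow_mul, pow_add, pow_add, pow_add]; norm_num
        _ ≤ 2 ^ (3 + t + G ^ 3 * G + E) := hp2 (by gcongr)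
        _ ≤ 2 ^ G ^ 6 := hp2 (by rw [show G ^ 3 * G = G ^ 4 by ring]; omega)
        _ ≤ n := hn6
    exact_mod_cast this
  · -- hθ
    have hpi : 2 * Real.pi ≤ 8 := by have := Real.pi_le_four; linarith
    set Z : ℝ := ck * M ^ k with hZ
    have hNZ : (N:ℝ) ≤ 2 ^ (8 + b + k) * Z := by
      have : N ≤ 2 ^ (8 + b + k) * (cn * M ^ k) := by
        calc N ≤ 200 * b * cn * (2 * M) ^ k := hM2.le
          _ ≤ 2 ^ 8 * 2 ^ b * cn * (2 * M) ^ k := by gcongr; norm_num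
          _ = _ := by rw [mul_pow, pow_add, pow_add]; ring
      rw [hZ, hckcast]; exact_mod_cast this
    have h1 : (8 * (q0 * n * 2 ^ E) * 2 ^ (t + 5) : ℝ) * 2 ^ (8 + b + k) ≤ N := by
      have : (8 * (q0 * n * 2 ^ E) * 2 ^ (t + 5)) * 2 ^ (8 + b + k) ≤ N := by
        calc (8 * (q0 * n * 2 ^ E) * 2 ^ (t + 5)) * 2 ^ (8 + b + k) ≤ (8 * (2 ^ G ^ 4 * n * 2 ^ E) * 2 ^ (t + 5)) * 2 ^ (8 + b + k) := by gcongr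
          _ = 2 ^ (3 + G ^ 4 + E + (t + 5) + (8 + b + k)) * n := by rw [pow_add 2 _ (8 + b + k), pow_add 2 _ (t + 5), pow_add 2 _ E, pow_add 2 3]; ring
          _ ≤ 2 ^ G ^ 5 * n := by gcongr 2 ^ ?_ * n; · norm_num
                                  · omega
          _ ≤ N := hn1
      exact_mod_cast this
    have h2 : (8 * (q0 * n * 2 ^ E) * 2 ^ (t + 5) : ℝ) ≤ Z := by
      have h0 : (0:ℝ) < 2 ^ (8 + b + k) := by positivity
      nlinarith
    have hZ0 : 0 ≤ Z := le_trans (by positivity) h2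
    calc 2 * Real.pi * (q0 * n * (32 / α) ^ C) ≤ 8 * (q0 * n * 2 ^ E) := by gcongr
      _ = (8 * (q0 * n * 2 ^ E) * 2 ^ (t + 5)) * (1 / 2 ^ t / 32) := by rw [pow_add]; field_simp; norm_num
      _ ≤ Z * (α / 32) := by gcongr
      _ = _ := by ring

lemma iter_abs (Fr : ℕ → Finset ℤ → Prop) (U W m t : ℕ) (hU : 0 < U)
    (hstep : ∀ (N d : ℕ) (A : Finset ℤ) (α : ℝ), W ≤ N → 0 < d → d ^ m ≤ N → A ⊆ Finset.Icc 1 (N:ℤ) → Fr d A → (A.card:ℝ) = α * N → 1 / 2 ^ t ≤ α →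
      ∃ (q N' : ℕ) (A' : Finset ℤ), 0 < q ∧ q ≤ U ∧ 0 < N' ∧ N ≤ U * N' ∧ A' ⊆ Finset.Icc 1 (N':ℤ) ∧ Fr (q * d) A' ∧ 21 / 20 * α * N' < A'.card) (i : ℕ) :
    ∀ (N d : ℕ) (A : Finset ℤ) (α : ℝ), W * U ^ i ≤ N → 0 < d → d ^ m * U ^ ((m + 1) * i) ≤ N → A ⊆ Finset.Icc 1 (N:ℤ) → Fr d A →
      (A.card:ℝ) = α * N → 1 / 2 ^ t ≤ α → (20 / 21) ^ i ≤ α → False := by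
  induction i with
  | zero =>
    intro N d A α hW hd hdN hA hF hc h1 h2
    obtain ⟨q, N', A', _, _, hN', _, hA', _, hlt⟩ := hstep N d A α (by simpa using hW) hd (by simpa using hdN) hA hF hc h1
    have h3 : A'.card ≤ N' := by have := Finset.card_le_card hA'; simpa using this
    have h3' : (A'.card:ℝ) ≤ N' := by exact_mod_cast h3
    have hN'' : (0:ℝ) < N' := by exact_mod_cast hN'
    simp only [pow_zero] at h2
    nlinarith
  | succ i ih =>
    intro N d A α hW hd hdN hA hF hc h1 h2
    have hUi : ∀ j, 1 ≤ U ^ j := fun j => Nat.one_le_pow _ _ hU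
    obtain ⟨q, N', A', hq, hqU, hN', hNN, hA', hF', hlt⟩ := hstep N d A α ((Nat.le_mul_of_pos_right _ (hUi _)).trans hW) hd
      ((Nat.le_mul_of_pos_right _ (hUi _)).trans hdN) hA hF hc h1
    have hN'' : (0:ℝ) < N' := by exact_mod_cast hN'
    have hα : 0 < α := lt_of_lt_of_le (by positivity) h1
    have hα' : 21 / 20 * α ≤ A'.card / N' := by rw [le_div_iff₀ hN'']; exact hlt.le
    refine ih N' (q * d) A' (A'.card / N') ?_ (by positivity) ?_ hA' hF' (by field_simp) (by linarith) ?_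
    · refine Nat.le_of_mul_le_mul_left ?_ hU
      calc U * (W * U ^ i) = W * U ^ (i + 1) := by rw [pow_succ]; ring
        _ ≤ _ := hW.trans hNN
    · refine Nat.le_of_mul_le_mul_left ?_ hU
      calc U * ((q * d) ^ m * U ^ ((m + 1) * i)) ≤ U * ((U * d) ^ m * U ^ ((m + 1) * i)) := by gcongr
        _ = d ^ m * U ^ ((m + 1) * (i + 1)) := by rw [mul_pow, mul_add (m + 1), pow_add U _ ((m + 1) * 1), mul_one, pow_succ]; ring
        _ ≤ _ := hdN.trans hNN
    · rw [pow_succ] at h2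
      linarith

lemma asym (a : ℕ) (ha : 1 ≤ a) (c : ℝ) (hc : 0 ≤ c) : ∀ᶠ N : ℕ in Filter.atTop, ∃ t : ℕ, 1 ≤ t ∧ c * (t:ℝ) ^ a ≤ Real.log N ∧
    (1 / 2 ^ t : ℝ) ≤ Real.log N ^ (-Real.log (Real.log (Real.log N))) := by
  have hT : Filter.Tendsto (fun N : ℕ => Real.log N) Filter.atTop Filter.atTop := Real.tendsto_log_atTop.comp tendsto_natCast_atTop_atTop
  have ha' : (0:ℝ) < a := by exact_mod_cast ha
  set ε : ℝ := 1 / (2 * a) with hε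
  have hε0 : 0 < ε := by positivity
  have hmain : ∀ᶠ x : ℝ in Filter.atTop, ∃ t : ℕ, 1 ≤ t ∧ c * (t:ℝ) ^ a ≤ x ∧ (1 / 2 ^ t : ℝ) ≤ x ^ (-Real.log (Real.log x)) := by
    have h1 := (isLittleO_log_rpow_rpow_atTop 2 hε0).def (show (0:ℝ) < Real.log 2 by positivity)
    have h2 := (tendsto_rpow_atTop (show (0:ℝ) < 1 / 2 by norm_num)).eventually_ge_atTop (c * 2 ^ a)
    filter_upwards [h1, h2, Filter.eventually_ge_atTop (Real.exp 1), Filter.eventually_ge_atTop (1:ℝ)] with x h1 h2 h3 hx1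
    have hx0 : 0 < x := by linarith
    have hxε : 1 ≤ x ^ ε := Real.one_le_rpow hx1 hε0.le
    have hl : 1 ≤ Real.log x := by rw [Real.le_log_iff_exp_le hx0]; exact h3
    refine ⟨⌈x ^ ε⌉₊, Nat.one_le_ceil_iff.2 (by positivity), ?_, ?_⟩
    · have ht : (⌈x ^ ε⌉₊ : ℝ) ≤ 2 * x ^ ε := by have := (Nat.ceil_lt_add_one (show 0 ≤ x ^ ε by positivity)).le; linarith
      calc c * (⌈x ^ ε⌉₊ : ℝ) ^ a ≤ c * (2 * x ^ ε) ^ a := by gcongr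
        _ = c * 2 ^ a * x ^ (1 / 2 : ℝ) := by
          rw [mul_pow, ← Real.rpow_natCast (x ^ ε), ← Real.rpow_mul hx0.le, hε, show (1 / (2 * (a:ℝ)) * a) = 1 / 2 by field_simp]; ring
        _ ≤ x ^ (1 / 2 : ℝ) * x ^ (1 / 2 : ℝ) := by gcongr
        _ = x := by rw [← Real.rpow_add hx0]; norm_num
    · rw [Real.norm_of_nonneg (by positivity), Real.norm_of_nonneg (by positivity)] at h1
      have h4 : Real.log x * Real.log (Real.log x) ≤ ⌈x ^ ε⌉₊ * Real.log 2 := by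
        have h5 : Real.log (Real.log x) ≤ Real.log x := (Real.log_le_sub_one_of_pos (by linarith)).trans (by linarith)
        have h6 : Real.log 2 * x ^ ε ≤ ⌈x ^ ε⌉₊ * Real.log 2 := by
          rw [mul_comm]; gcongr; exact Nat.le_ceil _
        have h7 : Real.log x ^ (2:ℝ) = Real.log x * Real.log x := by
          rw [show (2:ℝ) = (2:ℕ) by norm_num, Real.rpow_natCast, sq]
        rw [h7] at h1
        nlinarith
      rw [Real.rpow_def_of_pos hx0 (-Real.log (Real.log x)), one_div, ← Real.rpow_natCast, Real.rpow_def_of_pos (by norm_num), ← Real.exp_neg]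
      apply Real.exp_le_exp.2
      linarith
  exact hT.eventually hmain

lemma Sys.final {k : ℕ} (S : Sys k) : ∃ N₀ : ℕ, ∀ N : ℕ, N₀ ≤ N → ∀ d : ℕ, 0 < d →
      (d : ℝ) ≤ (N : ℝ) ^ ((1 : ℝ) / ((2 : ℝ) ^ (k + 2) * (k : ℝ) ^ 2)) →
      ∀ A : Finset ℤ, A ⊆ Finset.Icc 1 (N:ℤ) → (∀ a ∈ A, ∀ b ∈ A, a ≠ b → ∀ n : ℕ, 0 < n → a - b ≠ (S.H d).eval (n : ℤ)) →
      ¬ (A.card : ℝ) / N > Real.log N ^ (-Real.log (Real.log (Real.log N))) := by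
  obtain ⟨C0, hWI0⟩ := WI k S.hk
  obtain ⟨K, hK, hcont⟩ := S.content
  obtain ⟨b, hb⟩ : ∃ b : ℕ, (b:ℤ) = S.Ch := ⟨S.Ch.toNat, Int.toNat_of_nonneg (S.hlead.le.trans S.lead_le_Ch)⟩
  set C := C0 + 1 with hCd
  have hC : 1 ≤ C := by omega
  have hk := S.hk
  set c0 : ℕ := K * (2 ^ 18) ^ C + (K + 6 * C) + 1 + k + C + b + 20 with hc0
  have has := asym (2 * C * 13) (by omega) ((c0:ℝ) ^ 13) (by positivity)
  obtain ⟨N₀, hN₀⟩ := Filter.eventually_atTop.1 has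
  refine ⟨N₀ + 1, fun N hN d hd hdN A hA hfree hgt => ?_⟩
  obtain ⟨t, ht, h1, h2⟩ := hN₀ N (by omega)
  have hNpos : (0:ℝ) < N := by exact_mod_cast (by omega : 0 < N)
  obtain ⟨y0, hy0⟩ : ∃ y0, y0 = K * (2 ^ 18 * t ^ 2) ^ C := ⟨_, rfl⟩
  obtain ⟨E, hE⟩ : ∃ E, E = K + (t + 5) * C := ⟨_, rfl⟩
  obtain ⟨G, hG⟩ : ∃ G, G = y0 + E + t + k + C + b + 20 := ⟨_, rfl⟩
  have hy01 : 1 ≤ y0 := by rw [hy0]; exact Nat.one_le_iff_ne_zero.2 (by positivity)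
  have hG20 : 20 ≤ G := by omega
  have htG : t ≤ G := by omega
  have hkG : k ≤ G := by omega
  have hGc : G ≤ c0 * t ^ (2 * C) := by
    set T := t ^ (2 * C) with hT
    have hT1 : t ≤ T := Nat.le_self_pow (by omega) _
    have hy : y0 = K * (2 ^ 18) ^ C * T := by rw [hy0, mul_pow, ← pow_mul, hT]; ring
    have hE' : E ≤ (K + 6 * C) * T := by
      rw [hE]
      have h3 : K ≤ K * T := Nat.le_mul_of_pos_right _ (by omega)
      have h4 : (t + 5) * C ≤ 6 * T * C := by gcongr; omega
      nlinarith
    have hr : k + C + b + 20 ≤ (k + C + b + 20) * T := Nat.le_mul_of_pos_right _ (by omega)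
    calc G = y0 + E + t + (k + C + b + 20) := by rw [hG]; ring
      _ ≤ K * (2 ^ 18) ^ C * T + (K + 6 * C) * T + T + (k + C + b + 20) * T := by gcongr; exact hy.le
      _ = c0 * T := by rw [hc0]; ring
  have hG13 : 2 ^ G ^ 13 ≤ N := by
    have h3 : (G:ℝ) ^ 13 ≤ Real.log N := by
      refine le_trans ?_ h1
      rw [pow_mul, ← mul_pow]
      gcongr
      exact_mod_cast hGc
    have h4 : ((2:ℝ) ^ G ^ 13) ≤ N := by
      rw [Real.le_log_iff_exp_le hNpos] at h3
      refine le_trans ?_ h3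
      have : Real.exp ((G:ℝ) ^ 13) = Real.exp 1 ^ (G ^ 13) := by rw [← Real.exp_nat_mul]; push_cast; ring_nf
      rw [this]
      gcongr
      have := Real.add_one_le_exp (1:ℝ); linarith
    exact_mod_cast h4
  have hp2 : ∀ {a b : ℕ}, a ≤ b → 2 ^ a ≤ 2 ^ b := fun h => Nat.pow_le_pow_right (by norm_num) h
  set m := 2 * (k * (k + 1)) with hm
  have hm1 : m + 1 ≤ G ^ 3 := by
    have : m ≤ 2 * (G * (G + 1)) := by rw [hm]; gcongr
    rw [pow_succ]; nlinarith
  have hGs : ∀ i, 20 * G ^ i ≤ G ^ (i + 1) := fun i => by rw [pow_succ]; nlinarith [Nat.zero_le (G ^ i)]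
  have hd2 : d ^ (m * 2) ≤ N := by
    have h3 : (d:ℝ) ^ (m * 2) ≤ N := by
      calc (d:ℝ) ^ (m * 2) ≤ ((N : ℝ) ^ ((1 : ℝ) / ((2 : ℝ) ^ (k + 2) * (k : ℝ) ^ 2))) ^ (m * 2) := by gcongr
        _ = (N:ℝ) ^ ((1 : ℝ) / ((2 : ℝ) ^ (k + 2) * (k : ℝ) ^ 2) * ((m * 2 : ℕ) : ℝ)) := by rw [← Real.rpow_natCast, ← Real.rpow_mul hNpos.le]
        _ ≤ (N:ℝ) ^ (1:ℝ) := by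
          apply Real.rpow_le_rpow_of_exponent_le (by exact_mod_cast (by omega : 1 ≤ N))
          have hk' : (1:ℝ) ≤ k := by exact_mod_cast hk
          have : k + 1 ≤ 2 ^ k := Nat.lt_two_pow_self
          have h5 : ((k:ℝ) + 1) ≤ 2 ^ k := by exact_mod_cast this
          rw [one_div, inv_mul_le_iff₀ (by positivity), mul_one, hm, pow_add]
          push_cast
          have h6 : (k:ℝ) * (k + 1) ≤ k * 2 ^ k := by gcongr
          have h7 : (k:ℝ) * 2 ^ k * 1 ≤ k * 2 ^ k * k := by gcongr
          nlinarith
        _ = N := Real.rpow_one _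
    exact_mod_cast h3
  have hfin := iter_abs (fun d A => ∀ a ∈ A, ∀ b ∈ A, a ≠ b → ∀ n : ℕ, 0 < n → a - b ≠ (S.H d).eval (n : ℤ)) (2 ^ G ^ 7) (2 ^ G ^ 8) m t (by positivity)
    (fun N d A α hN hd hdN hA hF hc hα => S.step C K hC hK ?_ hcont t y0 E b G ht hy0 hE hb hG N d hN hd hdN A hA hF α hc hα) (20 * t) N d A (A.card / N) ?_ hd ?_ hA hfree
    (by field_simp) (h2.trans hgt.le) ?_
  · exact hfin
  · intro M R H K γ hM hR hdeg hpos hK hco hj hs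
    have hR0 : (1:ℝ) ≤ R := by linarith
    have hRC : R ^ C0 ≤ R ^ C := pow_le_pow_right₀ hR0 (by omega)
    obtain ⟨q, a, h3, h4, h5⟩ := hWI0 M R H K γ hM hR hdeg hpos hK hco (fun j hj1 hj2 => lt_of_le_of_lt (by gcongr) (hj j hj1 hj2)) hs
    exact ⟨q, a, h3, h4.trans (by gcongr), h5.trans hRC⟩
  · refine le_trans ?_ hG13
    rw [← pow_mul, ← pow_add]
    refine hp2 ?_
    calc G ^ 8 + G ^ 7 * (20 * t) ≤ G ^ 8 + G ^ 7 * (20 * G) := by gcongr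
      _ = 21 * G ^ 8 := by ring
      _ ≤ _ := by have := hGs 8; have := hGs 9; have := hGs 10; have := hGs 11; have := hGs 12; simp only [Nat.reduceAdd] at *; omega
  · refine (Nat.pow_le_pow_iff_left (n := 2) (by norm_num)).1 ?_
    rw [mul_pow, ← pow_mul, ← pow_mul, ← pow_mul, sq N]
    refine Nat.mul_le_mul hd2 (le_trans (hp2 ?_) hG13)
    calc G ^ 7 * ((m + 1) * (20 * t) * 2) ≤ G ^ 7 * (G ^ 3 * (20 * G) * 2) := by gcongr
      _ = 40 * G ^ 11 := by ring
      _ ≤ _ := by have := hGs 11; have := hGs 12; simp only [Nat.reduceAdd] at *; omega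
  · refine le_trans ?_ (h2.trans hgt.le)
    rw [pow_mul, one_div, ← inv_pow]
    gcongr
    norm_num

open scoped Classical in
/-- Lemma 5.3: either a density increment (case (i)) or the large-spectrum data of
Lemma 5.2 with the additional property that each denominator `q ≤ Q` occurs at most
`O(ν·B²)` times in `Γ` (case (ii)). -/
theorem stmt16
    (k : ℕ) (hk : 0 < k)
    (h : Polynomial ℤ) (hdeg : h.natDegree = k) (hlead : 0 < h.leadingCoeff)
    (hint : ∀ q : ℕ, 0 < q → ∃ n : ℤ, (q : ℤ) ∣ h.eval n)
    (z : ∀ (p : ℕ) [Fact p.Prime], ℤ_[p])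
    (hz : ∀ (p : ℕ) [Fact p.Prime], Polynomial.aeval (z p) h = 0)
    (lam : ℕ → ℕ) (hlam1 : lam 1 = 1)
    (hlamMul : ∀ a b : ℕ, lam (a * b) = lam a * lam b)
    (hlamP : ∀ (p : ℕ) [Fact p.Prime],
      lam p = p ^ Polynomial.rootMultiplicity (z p) (h.map (algebraMap ℤ ℤ_[p])))
    (r : ℕ → ℤ)
    (hr : ∀ d : ℕ, 0 < d → -(d : ℤ) < r d ∧ r d ≤ 0)
    (hrz : ∀ d : ℕ, 0 < d → ∀ (p : ℕ) [Fact p.Prime], ∀ α : ℕ, p ^ α ∣ d →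
      (p : ℤ_[p]) ^ α ∣ (z p - (r d : ℤ_[p])))
    (H : ℕ → Polynomial ℤ)
    (hH : ∀ d : ℕ, 0 < d →
      Polynomial.C (lam d : ℤ) * H d =
        h.comp (Polynomial.C (r d) + Polynomial.C (d : ℤ) * Polynomial.X))
    :
    ∃ κ C c : ℝ, 0 < κ ∧ 1 ≤ C ∧ 0 < c ∧ ∃ N₀ : ℕ, ∀ N : ℕ, N₀ ≤ N → ∀ d : ℕ, 0 < d →
      (d : ℝ) ≤ (N : ℝ) ^ ((1 : ℝ) / ((2 : ℝ) ^ (k + 2) * (k : ℝ) ^ 2)) →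
      ∀ A : Finset ℕ, A ⊆ Finset.Icc 1 N →
        (∀ a ∈ A, ∀ b ∈ A, a ≠ b →
          ∀ n : ℕ, 0 < n → (a : ℤ) - (b : ℤ) ≠ (H d).eval (n : ℤ)) →
        let σ : ℝ := (A.card : ℝ) / N
        let ghat : ℝ → ℂ := fun γ =>
          (∑ n ∈ A, e ((n : ℝ) * γ)) - (σ : ℂ) * ∑ n ∈ Finset.Icc 1 N, e ((n : ℝ) * γ)
        σ > Real.log N ^ (-Real.log (Real.log (Real.log N))) →
        ∀ ν : ℝ, ν ≥ (N : ℝ) ^ (-(1 : ℝ) / 2) →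
          (∃ Nst : ℕ, 0 < Nst ∧ (Nst : ℝ) ≥ c * ν * σ ^ (C : ℝ) * N ∧
            ∃ q : ℕ, 1 ≤ q ∧ (q : ℝ) ≤ C * σ ^ (-(C : ℝ)) ∧
            ∃ Ast : Finset ℕ, Ast ⊆ Finset.Icc 1 Nst ∧
              (∀ a ∈ Ast, ∀ b ∈ Ast, a ≠ b →
                ∀ n : ℕ, 0 < n → (a : ℤ) - (b : ℤ) ≠ (H (q * d)).eval (n : ℤ)) ∧
              (Ast.card : ℝ) / Nst ≥ (1 + ν / 73) * σ) ∨
          (∃ B : ℝ, c * σ ^ (C : ℝ) ≤ B ∧ B ≤ C * σ ^ (-(C : ℝ)) ∧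
            ∃ Q : ℕ, 1 ≤ Q ∧ (Q : ℝ) ≤ C * σ ^ (-(C : ℝ)) ∧
            ∃ Γ : Finset (ℕ × ℕ),
              (∀ p ∈ Γ, 1 ≤ p.1 ∧ p.1 ≤ p.2 ∧ p.2 ≤ Q ∧ Nat.gcd p.1 p.2 = 1) ∧
            ∃ γf : ℕ × ℕ → ℝ,
              (∀ p ∈ Γ, torusNorm (γf p - (p.1 : ℝ) / p.2) ≤ (κ / σ) / N) ∧
              (∑ p ∈ Γ, ‖∑ n ∈ A, e ((n : ℝ) * γf p)‖ ≥
                c * B * A.card * (Q : ℝ) ^ ((1 : ℝ) / 2) /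
                  (Real.log N ^ ((1 : ℝ) / 4) * Real.log (1 / σ) ^ 2)) ∧
              (∀ p ∈ Γ,
                (∫ γ in Set.Icc ((p.1 : ℝ) / p.2 - (κ / σ) / N)
                    ((p.1 : ℝ) / p.2 + (κ / σ) / N), ‖ghat γ‖ ^ 2) ≥
                  c * σ * A.card / B ^ 2) ∧
              (∀ q : ℕ, q ≤ Q →
                ((Γ.filter (fun p => p.2 = q)).card : ℝ) ≤ C * ν * B ^ 2)) := by
  let S : Sys k := ⟨hk, h, hdeg, hlead, z, hz, lam, hlam1, hlamMul, hlamP, r, hr, hrz, H, hH⟩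
  obtain ⟨N₀, hN₀⟩ := S.final
  refine ⟨1, 1, 1, one_pos, le_rfl, one_pos, N₀, ?_⟩
  intro N hN d hd hdN A hA hfree σ ghat hσ
  exfalso
  refine hN₀ N hN d hd hdN (A.map Nat.castEmbedding) ?_ ?_ ?_
  · intro x hx
    obtain ⟨a, ha, rfl⟩ := Finset.mem_map.1 hx
    have := Finset.mem_Icc.1 (hA ha)
    rw [Finset.mem_Icc]
    simp only [Nat.castEmbedding_apply]
    omega
  · intro x hx y hy hxy n hn
    obtain ⟨a, ha, rfl⟩ := Finset.mem_map.1 hx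
    obtain ⟨b, hb, rfl⟩ := Finset.mem_map.1 hy
    exact hfree a ha b hb (fun hab => hxy (by rw [hab])) n hn
  · rw [Finset.card_map]; exact hσ
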